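/- Let π ∈ ℤ[ρ] be a primary prime with p = π·π̄, and let f be any one of the functions φ, φ^{−1}, ψ (with p ≡ 7, 13, 1 (mod 18) in the respective case). Then the cube G_π(χ_π, f)³ of the elliptic Gauss sum is an algebraic integer lying in ℤ[ρ]. -/

import Mathlib

open Complex BigOperators

noncomputable section

/-- `ρ = e^{2πi/3}`, a primitive cube root of unity. -/
def ρ3 : ℂ := Complex.exp (2 * Real.pi * Complex.I / 3)

/-- The ring of Eisenstein integers `ℤ[ρ]`, realized as a subring of `ℂ`. -/
def O3 : Subring ℂ := Subring.closure {ρ3}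

/-- `√−3 = i·√3`. -/
def sqrtm3 : ℂ := Complex.I * (Real.sqrt 3 : ℝ)

/-- The congruence `a ≡ b (mod c)` in `ℤ[ρ]`. -/
def ECong (a b c : ℂ) : Prop := ∃ d ∈ O3, a - b = c * d

/-- `a` and `b` are coprime in `ℤ[ρ]`. -/
def ECoprime (a b : ℂ) : Prop := ∃ u ∈ O3, ∃ v ∈ O3, u * a + v * b = 1

/-- The real period `ϖ₁ = ∫₀¹ (1−x³)^{−2/3} dx`. -/
def varpi1 : ℝ := ∫ x in (0:ℝ)..(1:ℝ), (1 - x ^ 3) ^ (-(2:ℝ)/3)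

/-- The points of the period lattice `ϖ₁·ℤ[ρ]`. -/
def ω3 (m : ℤ × ℤ) : ℂ := (varpi1 : ℂ) * ((m.1 : ℂ) + (m.2 : ℂ) * ρ3)

/-- The Weierstrass `℘`-function of the period lattice `ϖ₁·ℤ[ρ]`
(so that `℘′² = 4℘³ − 27`). -/
def wp3 (u : ℂ) : ℂ :=
  (u ^ 2)⁻¹ + ∑' m : ℤ × ℤ, if m = 0 then 0 else (((u - ω3 m) ^ 2)⁻¹ - ((ω3 m) ^ 2)⁻¹)

/-- The derivative `℘′` of the Weierstrass `℘`-function of `ϖ₁·ℤ[ρ]`. -/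
def wp3' (u : ℂ) : ℂ := ∑' m : ℤ × ℤ, (-2) * ((u - ω3 m) ^ 3)⁻¹

/-- The Weierstrass `ζ`-function of the period lattice `ϖ₁·ℤ[ρ]`. -/
def wzeta3 (u : ℂ) : ℂ :=
  u⁻¹ + ∑' m : ℤ × ℤ, if m = 0 then 0 else ((u - ω3 m)⁻¹ + (ω3 m)⁻¹ + u * ((ω3 m) ^ 2)⁻¹)

/-- The non-analytic doubly periodic function `Z(u) = ζ(ϖ₁u) − (2π/(√3·ϖ₁))·ū`. -/
def Z3 (u : ℂ) : ℂ :=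
  wzeta3 ((varpi1 : ℂ) * u) -
    ((2 * Real.pi / (Real.sqrt 3 * varpi1) : ℝ) : ℂ) * (starRingEnd ℂ) u

/-- The elliptic function `φ(u) = 6℘(ϖ₁u)/(9+℘′(ϖ₁u))` of period lattice `ℤ[ρ]`. -/
def phi3 (u : ℂ) : ℂ := 6 * wp3 ((varpi1 : ℂ) * u) / (9 + wp3' ((varpi1 : ℂ) * u))

/-- The elliptic function `ψ(u) = (9−℘′(ϖ₁u))/(9+℘′(ϖ₁u))` of period lattice `ℤ[ρ]`. -/
def psi3 (u : ℂ) : ℂ := (9 - wp3' ((varpi1 : ℂ) * u)) / (9 + wp3' ((varpi1 : ℂ) * u))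

/-- A residue class character modulo `β` on `ℤ[ρ]`. -/
structure IsResChar3 (β : ℂ) (χ : ℂ → ℂ) : Prop where
  periodic : ∀ a ∈ O3, ∀ b ∈ O3, ECong a b β → χ a = χ b
  map_mul : ∀ a ∈ O3, ∀ b ∈ O3, χ (a * b) = χ a * χ b
  map_one : χ 1 = 1
  vanish : ∀ a ∈ O3, ¬ ECoprime a β → χ a = 0

/-- The cubic residue character `χ_π = (·/π)₃` modulo a prime `π` with `p = π·π̄`:
`χ_π(ν)³ = 1` and `χ_π(ν) ≡ ν^{(p−1)/3} (mod π)`. -/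
structure IsCubicChar (π : ℂ) (p : ℕ) (χ : ℂ → ℂ) : Prop where
  resChar : IsResChar3 π χ
  cube : ∀ ν ∈ O3, ECoprime ν π → χ ν ^ 3 = 1
  euler : ∀ ν ∈ O3, ECoprime ν π → ECong (χ ν) (ν ^ ((p - 1) / 3)) π

/-- The elliptic Gauss sum `G_π(χ, f) = (1/3)·Σ_{ν ∈ (ℤ[ρ]/(π))^×} χ(ν)·f(ν/π)`,
computed via the integer representatives `1, …, p−1` of `(ℤ[ρ]/(π))^× ≅ (ℤ/p)^×`. -/
def EGS3 (p : ℕ) (χ f : ℂ → ℂ) (π : ℂ) : ℂ :=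
  (1/3 : ℂ) * ∑ r ∈ Finset.Icc 1 (p - 1), χ (r : ℂ) * f ((r : ℂ) / π)

/-- `S` is a third set of `(ℤ[ρ]/(π))^×`, i.e. `(ℤ[ρ]/(π))^× = S ∪ ρS ∪ ρ̄S`. -/
def IsThirdSet (π : ℂ) (S : Finset ℂ) : Prop :=
  (∀ ν ∈ S, ν ∈ O3 ∧ ECoprime ν π) ∧
  (∀ a ∈ O3, ECoprime a π →
    ∃ ν ∈ S, ∃ ε ∈ ({1, ρ3, ρ3 ^ 2} : Set ℂ), ECong a (ε * ν) π) ∧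
  (∀ ν ∈ S, ∀ μ ∈ S, ∀ ε ∈ ({1, ρ3, ρ3 ^ 2} : Set ℂ), ∀ ε' ∈ ({1, ρ3, ρ3 ^ 2} : Set ℂ),
    ECong (ε * ν) (ε' * μ) π → ν = μ ∧ ε = ε')

/-- `γ(S)` is the cube root of unity with `γ(S) ≡ −∏_{ν∈S} ν (mod π)`. -/
def IsGamma3 (π : ℂ) (S : Finset ℂ) (γ : ℂ) : Prop :=
  γ ^ 3 = 1 ∧ ECong γ (-(∏ ν ∈ S, ν)) π

/-- `L` is the value at `s = 1` of the analytic continuation of the Hecke `L`-series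
`L(s, χ̃) = Σ_𝔞 χ̃(𝔞)·N𝔞^{−s} = (1/6)·Σ_{ν ∈ ℤ[ρ]} χ₁(ν)·ν̄·|ν|^{−2s}` attached to the
weight-one Hecke character `χ̃((ν)) = χ₁(ν)·ν̄` of `ℚ(ρ)`. -/
def IsLValue3 (χ₁ : ℂ → ℂ) (L : ℂ) : Prop :=
  ∃ F : ℂ → ℂ, DifferentiableOn ℂ F {s : ℂ | 0 < s.re} ∧
    (∀ s : ℂ, 3/2 < s.re →
      F s = (1/6 : ℂ) *
        ∑' ν : O3, χ₁ (ν : ℂ) * (starRingEnd ℂ) (ν : ℂ) *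
          ((Complex.normSq (ν : ℂ) : ℂ) ^ (-s))) ∧
    F 1 = L

/-- `T` is a complete residue system modulo `β` in `ℤ[ρ]`. -/
def IsCRS3 (β : ℂ) (T : Finset ℂ) : Prop :=
  (∀ a ∈ T, a ∈ O3) ∧ (∀ a ∈ T, ∀ b ∈ T, ECong a b β → a = b) ∧
  (∀ z ∈ O3, ∃ a ∈ T, ECong z a β)

/-- `e^{2πi·S(z)}` where `S(a + b·ρ̄) = a`, i.e. `2πi·S(z) = (2π/√3)·(zρ − z̄ρ̄)`. -/
def eS3 (z : ℂ) : ℂ :=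
  Complex.exp (((2 * Real.pi / Real.sqrt 3 : ℝ) : ℂ) *
    (z * ρ3 - (starRingEnd ℂ) z * (starRingEnd ℂ) ρ3))

/-- `χ₀`: the character mod `3` giving the natural isomorphism `(ℤ[ρ]/(3))^× ≅ W`,
i.e. `χ₀(ν) = ε` for `ν ≡ ε (mod 3)`, `ε ∈ W = {±1, ±ρ, ±ρ̄}`. -/
def IsChi0₃ (χ₀ : ℂ → ℂ) : Prop :=
  IsResChar3 3 χ₀ ∧ ∀ ε ∈ ({1, -1, ρ3, -ρ3, ρ3 ^ 2, -ρ3 ^ 2} : Set ℂ), χ₀ ε = ε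

/-- `χ₀′`: the character mod `√−3` giving `(ℤ[ρ]/(√−3))^× ≅ {±1}`,
i.e. `χ₀′(ν) = δ` for `ν ≡ δ (mod √−3)`, `δ ∈ {±1}`. -/
def IsChi0'₃ (χ₀' : ℂ → ℂ) : Prop :=
  IsResChar3 sqrtm3 χ₀' ∧ χ₀' (-1) = -1

/-- The classical cubic (Kummer) Gauss sum `G₃(π) = Σ_{r=1}^{p−1} (r/π)₃·e^{2πir/p}`. -/
def G3sum (p : ℕ) (χ : ℂ → ℂ) : ℂ :=
  ∑ r ∈ Finset.Icc 1 (p - 1), χ (r : ℂ) * Complex.exp (2 * Real.pi * Complex.I * (r : ℂ) / (p : ℂ))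

namespace PeriodPair
open Filter Topology

variable (L : PeriodPair)

lemma tendsto_sq_mul_weierstrassP :
    Tendsto (fun t => t ^ 2 * L.weierstrassP t) (𝓝[≠] 0) (𝓝 1) := by
  have hA : ContinuousAt (L.weierstrassPExcept 0) 0 :=
    (L.analyticAt_weierstrassPExcept 0).continuousAt
  have h1 : Tendsto (fun t : ℂ => t ^ 2 * L.weierstrassPExcept 0 t + 1) (𝓝[≠] 0) (𝓝 1) := by
    have : ContinuousAt (fun t : ℂ => t ^ 2 * L.weierstrassPExcept 0 t + 1) 0 := by fun_prop
    simpa using this.tendsto.mono_left nhdsWithin_le_nhds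
  refine h1.congr' ?_
  filter_upwards [self_mem_nhdsWithin] with t (ht : t ≠ 0)
  have := L.weierstrassPExcept_def ⟨0, zero_mem _⟩ t
  simp only at this
  rw [this]
  field_simp
  simp
  ring

lemma tendsto_cube_mul_derivWeierstrassP :
    Tendsto (fun t => t ^ 3 * L.derivWeierstrassP t) (𝓝[≠] 0) (𝓝 (-2)) := by
  have hA : ContinuousAt (L.derivWeierstrassPExcept 0) 0 :=
    (L.analyticAt_derivWeierstrassPExcept 0).continuousAt
  have h1 : Tendsto (fun t : ℂ => t ^ 3 * L.derivWeierstrassPExcept 0 t - 2) (𝓝[≠] 0) (𝓝 (-2)) := by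
    have : ContinuousAt (fun t : ℂ => t ^ 3 * L.derivWeierstrassPExcept 0 t - 2) 0 := by fun_prop
    simpa using this.tendsto.mono_left nhdsWithin_le_nhds
  refine h1.congr' ?_
  filter_upwards [self_mem_nhdsWithin] with t (ht : t ≠ 0)
  have := L.derivWeierstrassPExcept_def ⟨0, zero_mem _⟩ t
  simp only at this
  rw [this]
  field_simp
  ring

lemma isOpen_compl_lattice : IsOpen ((L.lattice : Set ℂ)ᶜ) := L.isClosed_lattice.isOpen_compl

lemma countable_lattice : (L.lattice : Set ℂ).Countable :=
  countable_of_Lindelof_of_discrete (X := L.lattice)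

lemma isPreconnected_compl_lattice : IsPreconnected ((L.lattice : Set ℂ)ᶜ) :=
  (L.countable_lattice.isConnected_compl_of_one_lt_rank (by simp)).isPreconnected

lemma eventually_notMem_lattice : ∀ᶠ t in 𝓝[≠] (0 : ℂ), t ∉ L.lattice := by
  have := L.compl_lattice_sdiff_singleton_mem_nhds 0
  filter_upwards [nhdsWithin_le_nhds this, self_mem_nhdsWithin] with t h1 h2 h3
  exact h1 ⟨h3, h2⟩

lemma eventually_notMem_lattice_of_notMem {u : ℂ} (hu : u ∉ L.lattice) :
    ∀ᶠ t in 𝓝 u, t ∉ L.lattice :=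
  L.isOpen_compl_lattice.mem_nhds hu

lemma hasDerivAt_weierstrassP {u : ℂ} (hu : u ∉ L.lattice) :
    HasDerivAt L.weierstrassP (L.derivWeierstrassP u) u := by
  have := (L.analyticOnNhd_weierstrassP u hu).differentiableAt.hasDerivAt
  simpa using this

lemma frequently_derivWeierstrassP_ne_zero {u : ℂ} (hu : u ∉ L.lattice) :
    ¬ ∀ᶠ t in 𝓝 u, L.derivWeierstrassP t = 0 := by
  intro h
  have h0 : Set.EqOn L.derivWeierstrassP (fun _ => 0) ((L.lattice : Set ℂ)ᶜ) :=
    L.analyticOnNhd_derivWeierstrassP.eqOn_of_preconnected_of_eventuallyEq analyticOnNhd_const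
      L.isPreconnected_compl_lattice hu h
  have h1 : Tendsto (fun t => t ^ 3 * L.derivWeierstrassP t) (𝓝[≠] 0) (𝓝 0) := by
    refine tendsto_const_nhds.congr' ?_
    filter_upwards [L.eventually_notMem_lattice] with t ht
    simp [h0 ht]
  have := tendsto_nhds_unique h1 L.tendsto_cube_mul_derivWeierstrassP
  norm_num at this

variable {L}

lemma hasDerivAt_derivWeierstrassP (h2 : L.g₂ = 0) {u : ℂ} (hu : u ∉ L.lattice) :
    HasDerivAt L.derivWeierstrassP (6 * L.weierstrassP u ^ 2) u := by
  have hA := L.analyticOnNhd_derivWeierstrassP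
  have hD : AnalyticOnNhd ℂ (deriv L.derivWeierstrassP) ((L.lattice : Set ℂ)ᶜ) := hA.deriv
  have hF : AnalyticOnNhd ℂ (fun t => deriv L.derivWeierstrassP t - 6 * L.weierstrassP t ^ 2)
      ((L.lattice : Set ℂ)ᶜ) :=
    hD.sub (analyticOnNhd_const.mul (L.analyticOnNhd_weierstrassP.pow 2))
  have key : ∀ t ∉ L.lattice, L.derivWeierstrassP t *
      (deriv L.derivWeierstrassP t - 6 * L.weierstrassP t ^ 2) = 0 := by
    intro t ht
    have e1 : HasDerivAt (fun t => L.derivWeierstrassP t ^ 2)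
        (2 * L.derivWeierstrassP t * deriv L.derivWeierstrassP t) t := by
      simpa using (hA t ht).differentiableAt.hasDerivAt.fun_pow 2
    have e2 : HasDerivAt (fun t => 4 * L.weierstrassP t ^ 3 - L.g₃)
        (4 * (3 * L.weierstrassP t ^ 2 * L.derivWeierstrassP t)) t := by
      simpa using (((L.hasDerivAt_weierstrassP ht).fun_pow 3).const_mul 4).sub_const L.g₃
    have e3 : (fun t => 4 * L.weierstrassP t ^ 3 - L.g₃) =ᶠ[𝓝 t]
        fun t => L.derivWeierstrassP t ^ 2 := by
      filter_upwards [L.eventually_notMem_lattice_of_notMem ht] with s hs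
      rw [L.derivWeierstrassP_sq s hs, h2]; ring
    have := (e2.congr_of_eventuallyEq e3.symm).unique e1
    linear_combination -this / 2
  have : deriv L.derivWeierstrassP u - 6 * L.weierstrassP u ^ 2 = 0 := by
    rcases (hF u hu).eventually_eq_zero_or_eventually_ne_zero with h | h
    · exact h.self_of_nhds
    · exfalso
      have h3 : ∀ᶠ t in 𝓝[≠] u, L.derivWeierstrassP t = 0 := by
        filter_upwards [h, nhdsWithin_le_nhds (L.eventually_notMem_lattice_of_notMem hu)]
          with t ht ht'
        exact (mul_eq_zero.mp (key t ht')).resolve_right ht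
      apply L.frequently_derivWeierstrassP_ne_zero hu
      rcases (hA u hu).eventually_eq_zero_or_eventually_ne_zero with h | h
      · exact h
      · obtain ⟨t, h4, h5⟩ := (h.and h3).exists
        exact absurd h5 h4
  have h4 := (hA u hu).differentiableAt.hasDerivAt
  rwa [sub_eq_zero.mp this] at h4

/-- The numerator in the addition theorem for `℘` when `g₂ = 0`. -/
private lemma addition_derivative_identity {p p' x y g D' N' : ℂ} (hp : p' ^ 2 = 4 * p ^ 3 - g)
    (hy : y ^ 2 = 4 * x ^ 3 - g) (hD : D' = p' + y)
    (hN : N' = p' * (2 * p * x + x ^ 2) - y * (p ^ 2 + 2 * p * x) -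
      (6 * p ^ 2 * y - p' * (6 * x ^ 2)) / 2) :
    N' * (p - x) = 2 * (p * x * (p + x) - p' * y / 2 - g / 2) * D' := by
  subst hD hN
  linear_combination p' * hy + y * hp

lemma addition_theorem (h2 : L.g₂ = 0) {u v : ℂ} (hu : u ∉ L.lattice) (hv : v ∉ L.lattice)
    (huv : u + v ∉ L.lattice) :
    (L.weierstrassP u - L.weierstrassP v) ^ 2 * L.weierstrassP (u + v) =
      L.weierstrassP u * L.weierstrassP v * (L.weierstrassP u + L.weierstrassP v) -
        L.derivWeierstrassP u * L.derivWeierstrassP v / 2 - L.g₃ / 2 := by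
  set P := L.weierstrassP with hP
  set Q := L.derivWeierstrassP with hQ
  set a := u + v with ha
  set D : ℂ → ℂ := fun t => P t - P (a - t) with hD
  set N : ℂ → ℂ := fun t => P t * P (a - t) * (P t + P (a - t)) - Q t * Q (a - t) / 2 - L.g₃ / 2
    with hN
  have hPa : AnalyticOnNhd ℂ P ((L.lattice : Set ℂ)ᶜ) := L.analyticOnNhd_weierstrassP
  have hQa : AnalyticOnNhd ℂ Q ((L.lattice : Set ℂ)ᶜ) := L.analyticOnNhd_derivWeierstrassP
  let U : Set ℂ := {t | t ∉ L.lattice ∧ a - t ∉ L.lattice}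
  have hUo : IsOpen U := L.isOpen_compl_lattice.inter
    (L.isOpen_compl_lattice.preimage (continuous_const.sub continuous_id))
  have hUc : IsPreconnected U := by
    have : U = ((L.lattice : Set ℂ) ∪ (fun t => a - t) '' (L.lattice : Set ℂ))ᶜ := by
      ext t
      simp only [U, Set.mem_ofPred_eq, Set.mem_compl_iff, Set.mem_union, Set.mem_image, not_or,
        SetLike.mem_coe]
      refine and_congr Iff.rfl (not_congr ⟨fun h => ⟨_, h, by ring⟩, ?_⟩)
      rintro ⟨s, hs, rfl⟩
      simpa using hs
    rw [this]
    exact ((L.countable_lattice.union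
      (L.countable_lattice.image _)).isConnected_compl_of_one_lt_rank
      (by simp)).isPreconnected
  have hrefl : AnalyticOnNhd ℂ (fun t : ℂ => a - t) U := fun t _ => by fun_prop
  have hPU : AnalyticOnNhd ℂ P U := hPa.mono fun t ht => ht.1
  have hQU : AnalyticOnNhd ℂ Q U := hQa.mono fun t ht => ht.1
  have hPU' : AnalyticOnNhd ℂ (fun t => P (a - t)) U := hPa.comp hrefl fun t ht => ht.2
  have hQU' : AnalyticOnNhd ℂ (fun t => Q (a - t)) U := hQa.comp hrefl fun t ht => ht.2
  have hDU : AnalyticOnNhd ℂ D U := hPU.sub hPU'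
  have hNU : AnalyticOnNhd ℂ N U := by
    refine AnalyticOnNhd.sub (AnalyticOnNhd.sub ((hPU.mul hPU').mul (hPU.add hPU')) ?_)
      analyticOnNhd_const
    simpa only [div_eq_mul_inv] using (hQU.mul hQU').mul analyticOnNhd_const
  -- limits at the origin
  have hcP : Tendsto (fun t => P (a - t)) (𝓝[≠] 0) (𝓝 (P a)) := by
    have : ContinuousAt (fun t => P (a - t)) 0 := by
      refine ContinuousAt.comp (g := P) (f := fun t => a - t) ?_ (by fun_prop)
      simpa using (hPa a huv).continuousAt
    simpa using this.tendsto.mono_left nhdsWithin_le_nhds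
  have hcQ : Tendsto (fun t => Q (a - t)) (𝓝[≠] 0) (𝓝 (Q a)) := by
    have : ContinuousAt (fun t => Q (a - t)) 0 := by
      refine ContinuousAt.comp (g := Q) (f := fun t => a - t) ?_ (by fun_prop)
      simpa using (hQa a huv).continuousAt
    simpa using this.tendsto.mono_left nhdsWithin_le_nhds
  have ht : Tendsto (fun t : ℂ => t) (𝓝[≠] 0) (𝓝 0) := nhdsWithin_le_nhds
  have lP := L.tendsto_sq_mul_weierstrassP
  have lQ := L.tendsto_cube_mul_derivWeierstrassP
  have lD : Tendsto (fun t => t ^ 2 * D t) (𝓝[≠] 0) (𝓝 1) := by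
    have := lP.sub ((ht.pow 2).mul hcP)
    simp only [zero_pow two_ne_zero, zero_mul, sub_zero] at this
    refine this.congr fun t => ?_
    simp only [hD]; ring
  have lN : Tendsto (fun t => t ^ 4 * N t) (𝓝[≠] 0) (𝓝 (P a)) := by
    have := (((lP.pow 2).mul hcP).add ((lP.mul (ht.pow 2)).mul (hcP.pow 2))).sub
      (((ht.mul lQ).mul hcQ).div_const 2) |>.sub (((ht.pow 4).mul_const (L.g₃ / 2)))
    simp only [one_pow, one_mul, zero_pow two_ne_zero, zero_pow four_ne_zero, zero_mul, add_zero,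
      sub_zero, zero_div] at this
    refine this.congr fun t => ?_
    simp only [hN]; ring
  have hU0 : ∀ᶠ t in 𝓝[≠] (0 : ℂ), t ∈ U := by
    have : ∀ᶠ t in 𝓝 (0 : ℂ), a - t ∉ L.lattice := by
      have hc : ContinuousAt (fun t : ℂ => a - t) 0 := by fun_prop
      exact hc.eventually (L.eventually_notMem_lattice_of_notMem (u := a - 0) (by simpa using huv))
    filter_upwards [L.eventually_notMem_lattice, nhdsWithin_le_nhds this] with t h1 h2
    exact ⟨h1, h2⟩
  have hD0 : ∀ᶠ t in 𝓝[≠] (0 : ℂ), D t ≠ 0 := by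
    filter_upwards [lD.eventually_ne one_ne_zero] with t h1 h
    simp [h] at h1
  have lH : Tendsto (fun t => N t / D t ^ 2) (𝓝[≠] 0) (𝓝 (P a)) := by
    have := lN.div (lD.pow 2) (by simp)
    simp only [one_pow, div_one] at this
    refine this.congr' ?_
    filter_upwards [self_mem_nhdsWithin, hD0] with t (h1 : t ≠ 0) h2
    simp only [Pi.div_apply]
    field_simp
  set H : ℂ → ℂ := Function.update (fun t => N t / D t ^ 2) 0 (P a) with hH
  have hHd : ∀ t ∈ U, t ≠ 0 → D t ≠ 0 → HasDerivAt H 0 t := by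
    intro t htU ht0 hDt
    have e0 : HasDerivAt (fun t : ℂ => a - t) (-1) t := by
      simpa using (hasDerivAt_id t).const_sub a
    have p1 : HasDerivAt P (Q t) t := L.hasDerivAt_weierstrassP htU.1
    have q1 : HasDerivAt Q (6 * P t ^ 2) t := hasDerivAt_derivWeierstrassP h2 htU.1
    have p2 : HasDerivAt (fun t => P (a - t)) (Q (a - t) * (-1)) t :=
      (L.hasDerivAt_weierstrassP htU.2).comp t e0
    have q2 : HasDerivAt (fun t => Q (a - t)) (6 * P (a - t) ^ 2 * (-1)) t :=
      (hasDerivAt_derivWeierstrassP h2 htU.2).comp t e0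
    have dD : HasDerivAt D (Q t - Q (a - t) * (-1)) t := p1.sub p2
    have dN := ((((p1.mul p2).mul (p1.add p2)).sub ((q1.mul q2).div_const 2)).sub_const (L.g₃ / 2))
    have dH := dN.div (dD.pow 2) (pow_ne_zero 2 hDt)
    have e : H =ᶠ[𝓝 t] fun t => N t / D t ^ 2 := by
      filter_upwards [isOpen_ne.mem_nhds ht0] with s hs
      simp [hH, Function.update_of_ne hs]
    refine (HasDerivAt.congr_of_eventuallyEq ?_ e)
    refine dH.congr_deriv ?_
    rw [div_eq_zero_iff]; left
    have s1 : Q t ^ 2 = 4 * P t ^ 3 - L.g₃ := by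
      rw [hQ, L.derivWeierstrassP_sq t htU.1, h2]; ring
    have s2 : Q (a - t) ^ 2 = 4 * P (a - t) ^ 3 - L.g₃ := by
      rw [hQ, L.derivWeierstrassP_sq _ htU.2, h2]; ring
    have key := addition_derivative_identity s1 s2 rfl rfl
    simp only [hD, Pi.mul_apply, Pi.add_apply, Nat.cast_ofNat, Pi.pow_apply, Pi.sub_apply]
    linear_combination (P t - P (a - t)) * key
  have hHc : ContinuousAt H 0 := by
    rw [hH, continuousAt_update_same]
    exact lH
  have hHA : AnalyticAt ℂ H 0 := by
    refine analyticAt_of_differentiable_on_punctured_nhds_of_continuousAt ?_ hHc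
    filter_upwards [hU0, hD0, self_mem_nhdsWithin] with t h1 h2 h3
    exact (hHd t h1 h3 h2).differentiableAt
  have hH0 : ∀ᶠ t in 𝓝[≠] 0, deriv H t = 0 := by
    filter_upwards [hU0, hD0, self_mem_nhdsWithin] with t h1 h2 h3
    exact (hHd t h1 h3 h2).deriv
  have hH1 : ∀ᶠ t in 𝓝 0, deriv H t = 0 := by
    rcases hHA.deriv.eventually_eq_zero_or_eventually_ne_zero with h | h
    · exact h
    · obtain ⟨t, h4, h5⟩ := (h.and hH0).exists
      exact absurd h5 h4
  have hHP : ∀ᶠ t in 𝓝 0, H t = P a := by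
    obtain ⟨r, hr, hball⟩ := Metric.eventually_nhds_iff_ball.mp
      (hH1.and hHA.eventually_analyticAt)
    filter_upwards [Metric.ball_mem_nhds 0 hr] with t ht
    have := Metric.isOpen_ball.is_const_of_deriv_eq_zero (convex_ball (0 : ℂ) r).isPreconnected
      (f := H) (fun x hx => (hball x hx).2.differentiableAt.differentiableWithinAt)
      (fun x hx => (hball x hx).1) ht (Metric.mem_ball_self hr)
    rw [this, hH, Function.update_self]
  have hev : ∀ᶠ t in 𝓝[≠] 0, N t - D t ^ 2 * P a = 0 := by
    filter_upwards [nhdsWithin_le_nhds hHP, hD0, self_mem_nhdsWithin] with t h1 h2 h3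
    rw [hH, Function.update_of_ne h3, div_eq_iff (pow_ne_zero 2 h2)] at h1
    rw [h1]; ring
  obtain ⟨z, hzU, hz⟩ : ∃ z ∈ U, ∀ᶠ t in 𝓝 z, N t - D t ^ 2 * P a = 0 := by
    have h3 := hev.and hU0
    have h4 : ∀ᶠ z in 𝓝[≠] (0 : ℂ), ∀ᶠ t in 𝓝 z, N t - D t ^ 2 * P a = 0 := by
      obtain ⟨s, hs, hs'⟩ := (mem_nhdsWithin.mp hev)
      refine mem_nhdsWithin.mpr ⟨s, hs, hs'.1, fun z hz => ?_⟩
      exact mem_of_superset ((hs.inter isOpen_ne).mem_nhds hz) hs'.2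
    obtain ⟨z, h5, h6⟩ := (h4.and hU0).exists
    exact ⟨z, h6, h5⟩
  have hall : Set.EqOn (fun t => N t - D t ^ 2 * P a) (fun _ => 0) U :=
    (hNU.sub ((hDU.pow 2).mul analyticOnNhd_const)).eqOn_of_preconnected_of_eventuallyEq
      analyticOnNhd_const hUc hzU hz
  have huU : u ∈ U := ⟨hu, by simpa [ha] using hv⟩
  have := hall huU
  simp only [hN, hD, ha, add_sub_cancel_left] at this
  linear_combination -this

lemma addition_theorem_deriv (h2 : L.g₂ = 0) {u v : ℂ} (hu : u ∉ L.lattice) (hv : v ∉ L.lattice)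
    (huv : u + v ∉ L.lattice) :
    (L.weierstrassP u - L.weierstrassP v) ^ 2 * L.derivWeierstrassP (u + v) =
      L.derivWeierstrassP u * (2 * L.weierstrassP u * L.weierstrassP v + L.weierstrassP v ^ 2) -
        3 * L.weierstrassP u ^ 2 * L.derivWeierstrassP v -
      2 * (L.weierstrassP u - L.weierstrassP v) * L.derivWeierstrassP u *
        L.weierstrassP (u + v) := by
  have e0 : HasDerivAt (fun t : ℂ => t + v) 1 u := (hasDerivAt_id u).add_const v
  have p1 := L.hasDerivAt_weierstrassP hu
  have q1 := hasDerivAt_derivWeierstrassP h2 hu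
  have p3 : HasDerivAt (fun t => L.weierstrassP (t + v)) (L.derivWeierstrassP (u + v)) u :=
    (L.hasDerivAt_weierstrassP huv).comp_add_const u v
  have l1 := ((p1.sub_const (L.weierstrassP v)).pow 2).mul p3
  have l2 := ((((p1.mul_const (L.weierstrassP v)).mul (p1.add_const (L.weierstrassP v))).sub
    ((q1.mul_const (L.derivWeierstrassP v)).div_const 2)).sub_const (L.g₃ / 2))
  have hev : ∀ᶠ t in 𝓝 u, t + v ∉ L.lattice :=
    e0.continuousAt.eventually (L.eventually_notMem_lattice_of_notMem huv)
  have := (l1.congr_of_eventuallyEq (f₁ := _) ?_).unique l2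
  · simp only [Nat.cast_ofNat, Pi.pow_apply] at this
    linear_combination this
  · filter_upwards [hev, L.eventually_notMem_lattice_of_notMem hu] with t h1 h3
    have := addition_theorem h2 h3 hv h1
    simp only [Pi.mul_apply, Pi.sub_apply, Pi.pow_apply]
    linear_combination -this

end PeriodPair

namespace PeriodPair
open Filter Topology

variable {L : PeriodPair}

lemma eventually_weierstrassP_ne (c : ℂ) : ∀ᶠ t in 𝓝[≠] (0 : ℂ), L.weierstrassP t ≠ c := by
  have ht : Tendsto (fun t : ℂ => t ^ 2 * c) (𝓝[≠] 0) (𝓝 0) := by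
    have : ContinuousAt (fun t : ℂ => t ^ 2 * c) 0 := by fun_prop
    simpa using this.tendsto.mono_left nhdsWithin_le_nhds
  filter_upwards [(L.tendsto_sq_mul_weierstrassP.sub ht).eventually_ne (b₂ := 0) (by simp)]
    with t h1
  intro h2
  simp [h2] at h1

/-- `℘` takes every finite value. -/
lemma exists_weierstrassP_eq (c : ℂ) : ∃ u ∉ L.lattice, L.weierstrassP u = c := by
  by_contra! hc
  classical
  let f : ℂ → ℂ := fun u => if u ∈ L.lattice then 0 else (L.weierstrassP u - c)⁻¹
  have hper : ∀ l ∈ L.lattice, ∀ u, f (u + l) = f u := by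
    intro l hl u
    simp only [f, add_mem_cancel_right hl]
    rw [show L.weierstrassP (u + l) = L.weierstrassP u from L.weierstrassP_add_coe u ⟨l, hl⟩]
  have hoff : ∀ u ∉ L.lattice, DifferentiableAt ℂ f u := by
    intro u hu
    have e : f =ᶠ[𝓝 u] fun t => (L.weierstrassP t - c)⁻¹ := by
      filter_upwards [L.eventually_notMem_lattice_of_notMem hu] with t ht
      simp [f, ht]
    refine DifferentiableAt.congr_of_eventuallyEq ?_ e
    exact ((L.hasDerivAt_weierstrassP hu).differentiableAt.sub_const c).inv
      (sub_ne_zero.mpr (hc u hu))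
  have hcont : ContinuousAt f 0 := by
    rw [continuousAt_iff_punctured_nhds]
    have h0 : f 0 = 0 := by simp [f]
    rw [h0]
    have ht : Tendsto (fun t : ℂ => t ^ 2 * c) (𝓝[≠] 0) (𝓝 0) := by
      have : ContinuousAt (fun t : ℂ => t ^ 2 * c) 0 := by fun_prop
      simpa using this.tendsto.mono_left nhdsWithin_le_nhds
    have ht2 : Tendsto (fun t : ℂ => t ^ 2) (𝓝[≠] 0) (𝓝 0) := by
      have : ContinuousAt (fun t : ℂ => t ^ 2) 0 := by fun_prop
      simpa using this.tendsto.mono_left nhdsWithin_le_nhds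
    have := ht2.div (L.tendsto_sq_mul_weierstrassP.sub ht) (by simp)
    simp only [sub_zero, zero_div] at this
    refine this.congr' ?_
    filter_upwards [L.eventually_notMem_lattice, self_mem_nhdsWithin] with t h1 (h2 : t ≠ 0)
    have h3 := sub_ne_zero.mpr (hc t h1)
    simp only [Pi.div_apply, f, h1, if_false]
    field_simp
  have hdiff0 : DifferentiableAt ℂ f 0 := by
    refine (analyticAt_of_differentiable_on_punctured_nhds_of_continuousAt ?_
      hcont).differentiableAt
    filter_upwards [L.eventually_notMem_lattice] with t ht using hoff t ht
  have hdiff : Differentiable ℂ f := by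
    intro u
    by_cases hu : u ∈ L.lattice
    · have e : f = fun t => f (t + -u) := by
        ext t; exact (hper _ (neg_mem hu) t).symm
      rw [e]
      exact (differentiableAt_comp_add_const (b := -u)).mpr (by simpa using hdiff0)
    · exact hoff u hu
  have hbdd : Bornology.IsBounded (Set.range f) := by
    refine (IsZLattice.isCompact_range_of_periodic L.lattice f hdiff.continuous ?_).isBounded
    intro z w hw
    exact hper w hw z
  obtain ⟨t, ht⟩ := L.eventually_notMem_lattice.exists
  have h1 := hdiff.apply_eq_apply_of_bounded hbdd t 0
  simp only [f, ht, if_false, zero_mem, if_true, inv_eq_zero] at h1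
  exact sub_ne_zero.mpr (hc t ht) h1

lemma derivWeierstrassP_sq' (h2 : L.g₂ = 0) {u : ℂ} (hu : u ∉ L.lattice) :
    L.derivWeierstrassP u ^ 2 = 4 * L.weierstrassP u ^ 3 - L.g₃ := by
  rw [L.derivWeierstrassP_sq u hu, h2]; ring

lemma eventually_add_notMem_lattice {u : ℂ} (hu : u ∉ L.lattice) :
    ∀ᶠ w in 𝓝 (0 : ℂ), u + w ∉ L.lattice := by
  have hc : ContinuousAt (fun t : ℂ => u + t) 0 := by fun_prop
  exact hc.eventually (L.eventually_notMem_lattice_of_notMem (u := u + 0) (by simpa using hu))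

lemma g₃_ne_zero (h2 : L.g₂ = 0) : L.g₃ ≠ 0 := by
  intro h3
  obtain ⟨u, hu, h0⟩ := L.exists_weierstrassP_eq 0
  have h0' : L.derivWeierstrassP u = 0 := by
    have := derivWeierstrassP_sq' h2 hu
    simpa [h0, h3] using this
  have hz : ∀ᶠ w in 𝓝[≠] (0 : ℂ), L.weierstrassP (u + w) = 0 := by
    filter_upwards [nhdsWithin_le_nhds (eventually_add_notMem_lattice hu),
      L.eventually_notMem_lattice, L.eventually_weierstrassP_ne 0] with w h1 h4 h5
    have := addition_theorem h2 hu h4 h1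
    simp only [h0, h0', h3] at this
    simpa [h5] using this
  obtain ⟨s, hs, hs'⟩ := mem_nhdsWithin.mp hz
  have h4 : ∀ᶠ z in 𝓝[≠] (0 : ℂ), ∀ᶠ w in 𝓝 z, L.weierstrassP (u + w) = 0 :=
    mem_nhdsWithin.mpr ⟨s, hs, hs'.1, fun z hz =>
      mem_of_superset ((hs.inter isOpen_ne).mem_nhds hz) hs'.2⟩
  obtain ⟨z, h5, h6⟩ :=
    (h4.and (nhdsWithin_le_nhds (eventually_add_notMem_lattice hu))).exists
  apply L.frequently_derivWeierstrassP_ne_zero h6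
  have hc : ContinuousAt (fun t : ℂ => t - u) (u + z) := by fun_prop
  have h7 : ∀ᶠ t in 𝓝 (u + z), L.weierstrassP t = 0 := by
    have := hc.eventually (by simpa using h5)
    simpa using this
  filter_upwards [h7.eventually_nhds] with t ht
  have := (show L.weierstrassP =ᶠ[𝓝 t] fun _ => 0 from ht).deriv_eq
  simpa using this

lemma derivWeierstrassP_eq_zero_of_add (h2 : L.g₂ = 0) {u v : ℂ} (hu : u ∉ L.lattice)
    (hv : v ∉ L.lattice) (huv : u + v ∉ L.lattice) (h : L.weierstrassP u = L.weierstrassP v)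
    (h' : L.derivWeierstrassP u = -L.derivWeierstrassP v) : L.derivWeierstrassP u = 0 := by
  have h1 := addition_theorem h2 hu hv huv
  have h3 := derivWeierstrassP_sq' h2 hu
  have h4 : L.derivWeierstrassP v = -L.derivWeierstrassP u := by rw [h']; ring
  rw [← h, h4] at h1
  have : L.derivWeierstrassP u ^ 2 = 0 := by linear_combination -h1 + h3 / 2
  simpa using this

lemma frequently_weierstrassP_add_ne_sub (h2 : L.g₂ = 0) {u v : ℂ} (hu : u ∉ L.lattice)
    (hv : v ∉ L.lattice) (huv : u + v ∉ L.lattice) :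
    ∃ᶠ w in 𝓝[≠] (0 : ℂ), L.weierstrassP (u + w) ≠ L.weierstrassP (v - w) := by
  intro h
  simp only [not_not] at h
  have hv' : ∀ᶠ w in 𝓝 (0 : ℂ), v - w ∉ L.lattice := by
    have hc : ContinuousAt (fun t : ℂ => v - t) 0 := by fun_prop
    exact hc.eventually (L.eventually_notMem_lattice_of_notMem (u := v - 0) (by simpa using hv))
  obtain ⟨s, hs, hs'⟩ := mem_nhdsWithin.mp h
  have h4 : ∀ᶠ z in 𝓝[≠] (0 : ℂ), ∀ᶠ w in 𝓝 z, L.weierstrassP (u + w) = L.weierstrassP (v - w) :=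
    mem_nhdsWithin.mpr ⟨s, hs, hs'.1, fun z hz =>
      mem_of_superset ((hs.inter isOpen_ne).mem_nhds hz) hs'.2⟩
  obtain ⟨z, ⟨h5, h6⟩, h7⟩ := ((h4.and (nhdsWithin_le_nhds
    (eventually_add_notMem_lattice hu))).and (nhdsWithin_le_nhds hv')).exists
  apply L.frequently_derivWeierstrassP_ne_zero h6
  have hc : ContinuousAt (fun t : ℂ => t - u) (u + z) := by fun_prop
  have hcv : ContinuousAt (fun t : ℂ => v - (t - u)) (u + z) := by fun_prop
  have h8 : ∀ᶠ t in 𝓝 (u + z), L.weierstrassP t = L.weierstrassP (v - (t - u)) := by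
    have := hc.eventually (by simpa using h5)
    simpa using this
  have h9 : ∀ᶠ t in 𝓝 (u + z), v - (t - u) ∉ L.lattice :=
    hcv.eventually (L.eventually_notMem_lattice_of_notMem (by simpa using h7))
  filter_upwards [h8.eventually_nhds, h9, L.eventually_notMem_lattice_of_notMem h6]
    with t h10 h11 h12
  refine derivWeierstrassP_eq_zero_of_add h2 h12 h11 ?_ h10.self_of_nhds ?_
  · rwa [show t + (v - (t - u)) = u + v by ring]
  · have e0 : HasDerivAt (fun t : ℂ => v - (t - u)) (-1) t := by
      simpa using ((hasDerivAt_id t).sub_const u).const_sub v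
    have e1 := (L.hasDerivAt_weierstrassP h11).comp_of_eq (h := fun t : ℂ => v - (t - u)) t e0 rfl
    have e2 := e1.congr_of_eventuallyEq (f₁ := L.weierstrassP) h10
    simpa using (L.hasDerivAt_weierstrassP h12).unique e2

end PeriodPair

/-- The curve `η² + aη = x³ - (27 + a²)/4`, isomorphic to `y² = 4x³ - 27` through `y = 2η + a`. -/
def cubicCurve (a : ℚ) : WeierstrassCurve ℚ := ⟨0, 0, a, 0, -(27 + a ^ 2) / 4⟩

namespace cubicCurve
open WeierstrassCurve WeierstrassCurve.Affine

variable {a : ℚ} {F : Type*} [Field F] [Algebra ℚ F]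

/-- The affine equation of `cubicCurve a`. -/
def Eqn (a : ℚ) (F : Type*) [Field F] [Algebra ℚ F] (x η : F) : Prop :=
  4 * (η ^ 2 + algebraMap ℚ F a * η) = 4 * x ^ 3 - (27 + algebraMap ℚ F a ^ 2)

lemma equation_iff {x η : F} : ((cubicCurve a)⁄F).Equation x η ↔ Eqn a F x η := by
  have h4 : (4 : F) ≠ 0 := by
    have := (algebraMap ℚ F).injective.ne (show (4 : ℚ) ≠ 0 by norm_num)
    simpa using this
  rw [WeierstrassCurve.Affine.equation_iff, Eqn]
  simp only [cubicCurve, WeierstrassCurve.baseChange, map_a₁, map_a₂, map_a₃, map_a₄,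
    map_a₆, map_zero, map_div₀,
    map_neg, map_add, map_pow, map_ofNat]
  constructor <;> intro h
  · field_simp at h
    linear_combination h
  · field_simp
    linear_combination h

lemma nonsingular_iff {x η : F} : ((cubicCurve a)⁄F).Nonsingular x η ↔ Eqn a F x η := by
  rw [← equation_iff]
  refine (equation_iff_nonsingular_of_Δ_ne_zero ?_).symm
  have h : ((cubicCurve a)⁄F).Δ = algebraMap ℚ F (-19683) := by
    refine (map_Δ ..).trans (congrArg _ ?_)
    simp only [WeierstrassCurve.Δ, b₂, b₄, b₆, b₈, cubicCurve]
    ring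
  rw [h, Ne, map_eq_zero_iff _ (algebraMap ℚ F).injective]
  norm_num

/-- `P` is the affine point with coordinates `(x, η)`. -/
def IsPt (P : ((cubicCurve a)⁄F).Point) (x η : F) : Prop :=
  ∃ h : ((cubicCurve a)⁄F).Nonsingular x η, P = .some x η h

variable {P Q : ((cubicCurve a)⁄F).Point} {x x' η η' : F}

lemma IsPt.eqn (h : IsPt P x η) : Eqn a F x η := nonsingular_iff.mp h.1

lemma IsPt.ne_zero (h : IsPt P x η) : P ≠ 0 := by
  obtain ⟨h, rfl⟩ := h
  exact Point.some_ne_zero h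

lemma exists_isPt (h : Eqn a F x η) : ∃ P : ((cubicCurve a)⁄F).Point, IsPt P x η :=
  ⟨_, nonsingular_iff.mpr h, rfl⟩

lemma exists_isPt_of_ne_zero (h : P ≠ 0) : ∃ x η, IsPt P x η := by
  match P, h with
  | .some x η h, _ => exact ⟨x, η, h, rfl⟩

lemma IsPt.coord_eq (h : IsPt P x η) (h' : IsPt P x' η') : x = x' ∧ η = η' := by
  obtain ⟨h, rfl⟩ := h
  obtain ⟨h', e⟩ := h'
  simpa using e

lemma IsPt.point_eq (h : IsPt P x η) (h' : IsPt Q x η) : P = Q := by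
  obtain ⟨h, rfl⟩ := h
  obtain ⟨h', rfl⟩ := h'
  rfl

lemma negY_eq : ((cubicCurve a)⁄F).negY x η = -η - algebraMap ℚ F a := by
  simp [negY, cubicCurve, WeierstrassCurve.baseChange]

lemma IsPt.neg (h : IsPt P x η) : IsPt (-P) x (-η - algebraMap ℚ F a) := by
  obtain ⟨h, rfl⟩ := h
  rw [Point.neg_some]
  rw [← negY_eq]
  exact ⟨_, rfl⟩

lemma IsPt.eq_or_eq_neg (hP : IsPt P x η) (hQ : IsPt Q x η') : P = Q ∨ P = -Q := by
  have h1 := hP.eqn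
  have h2 := hQ.eqn
  have h4 : (4 : F) ≠ 0 := by
    have := (algebraMap ℚ F).injective.ne (show (4 : ℚ) ≠ 0 by norm_num)
    simpa using this
  have : 4 * ((η - η') * (η - (-η' - algebraMap ℚ F a))) = 0 := by
    unfold Eqn at h1 h2
    linear_combination h1 - h2
  rcases mul_eq_zero.mp ((mul_eq_zero.mp this).resolve_left h4) with h | h
  · left
    rw [sub_eq_zero] at h
    subst h
    exact hP.point_eq hQ
  · right
    rw [sub_eq_zero] at h
    subst h
    exact hP.point_eq hQ.neg

variable [DecidableEq F]

lemma isPt_add_aux (hP : IsPt P x η) (hQ : IsPt Q x' η')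
    (h : ¬(x = x' ∧ η = ((cubicCurve a)⁄F).negY x' η')) {l : F}
    (hl : ((cubicCurve a)⁄F).slope x x' η η' = l) :
    IsPt (P + Q) (l ^ 2 - x - x') (-(l * (l ^ 2 - x - x' - x) + η) - algebraMap ℚ F a) := by
  obtain ⟨hP, rfl⟩ := hP
  obtain ⟨hQ, rfl⟩ := hQ
  rw [Point.add_some h]
  have e1 : ((cubicCurve a)⁄F).addX x x' (((cubicCurve a)⁄F).slope x x' η η') =
      l ^ 2 - x - x' := by
    rw [hl]
    simp [addX, cubicCurve, WeierstrassCurve.baseChange]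
  have e2 : ((cubicCurve a)⁄F).addY x x' η (((cubicCurve a)⁄F).slope x x' η η') =
      -(l * (l ^ 2 - x - x' - x) + η) - algebraMap ℚ F a := by
    rw [addY, negAddY, e1, hl, negY_eq]
  simp only [e1, e2]
  exact ⟨_, rfl⟩

/-- Addition of points with distinct abscissae. -/
lemma IsPt.add (hP : IsPt P x η) (hQ : IsPt Q x' η') (hx : x ≠ x') {l : F}
    (hl : l * (x - x') = η - η') :
    IsPt (P + Q) (l ^ 2 - x - x') (-(l * (l ^ 2 - x - x' - x) + η) - algebraMap ℚ F a) := by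
  refine isPt_add_aux hP hQ (fun h => hx h.1) ?_
  rw [slope_of_X_ne hx, div_eq_iff (sub_ne_zero.mpr hx), hl]

/-- Duplication of points. -/
lemma IsPt.add_self (hP : IsPt P x η) (hη : 2 * η + algebraMap ℚ F a ≠ 0) {l : F}
    (hl : l * (2 * η + algebraMap ℚ F a) = 3 * x ^ 2) :
    IsPt (P + P) (l ^ 2 - x - x) (-(l * (l ^ 2 - x - x - x) + η) - algebraMap ℚ F a) := by
  have h : η ≠ ((cubicCurve a)⁄F).negY x η := by
    rw [negY_eq]
    contrapose! hη
    linear_combination hη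
  refine isPt_add_aux hP hP (fun h' => h h'.2) ?_
  rw [slope_of_Y_ne rfl h, div_eq_iff (sub_ne_zero.mpr h), negY_eq]
  simp only [cubicCurve, WeierstrassCurve.baseChange, map_a₁, map_a₂, map_a₄, map_zero]
  linear_combination -hl

lemma IsPt.map {K : Type*} [Field K] [Algebra ℚ K] [DecidableEq K] (f : F →ₐ[ℚ] K)
    (hP : IsPt P x η) :
    IsPt (Point.map f P) (f x) (f η) := by
  obtain ⟨h, rfl⟩ := hP
  exact ⟨_, Point.map_some _ h⟩

end cubicCurve

namespace PeriodPair
open Filter Topology WeierstrassCurve WeierstrassCurve.Affine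

/-- The curve `℘'² = 4℘³ - g₃` is a scaling by `κ` of `y² = 4x³ - 27`. -/
structure IsScaled (L : PeriodPair) (κ : ℂ) : Prop where
  g₂_eq : L.g₂ = 0
  g₃_eq : L.g₃ = 27 * κ ^ 6

/-- The scaled function `℘ / κ²`. -/
def px (L : PeriodPair) (κ u : ℂ) : ℂ := L.weierstrassP u / κ ^ 2

/-- The scaled function `℘' / κ³`. -/
def py (L : PeriodPair) (κ u : ℂ) : ℂ := L.derivWeierstrassP u / κ ^ 3

open Classical in
/-- The uniformization of `cubicCurve a`. -/
def point (L : PeriodPair) (κ : ℂ) (a : ℚ) (u : ℂ) : ((cubicCurve a)⁄ℂ).Point :=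
  if h : ∃ P : ((cubicCurve a)⁄ℂ).Point, u ∉ L.lattice ∧
    cubicCurve.IsPt P (L.px κ u) ((L.py κ u - a) / 2) then h.choose else 0

variable {L : PeriodPair} {κ : ℂ} {a : ℚ} {u v : ℂ}

lemma point_of_mem (hu : u ∈ L.lattice) : L.point κ a u = 0 := by
  rw [point, dif_neg]
  simp [hu]

@[simp] lemma point_zero : L.point κ a 0 = 0 := point_of_mem (zero_mem _)

lemma px_neg : L.px κ (-u) = L.px κ u := by simp [px]

lemma py_neg : L.py κ (-u) = -L.py κ u := by simp [py, neg_div]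

lemma px_add_of_mem (hv : v ∈ L.lattice) : L.px κ (u + v) = L.px κ u := by
  rw [px, px, show L.weierstrassP (u + v) = _ from L.weierstrassP_add_coe u ⟨v, hv⟩]

lemma py_add_of_mem (hv : v ∈ L.lattice) : L.py κ (u + v) = L.py κ u := by
  rw [py, py, show L.derivWeierstrassP (u + v) = _ from L.derivWeierstrassP_add_coe u ⟨v, hv⟩]

namespace IsScaled
open cubicCurve
variable (h : L.IsScaled κ)
include h

lemma ne_zero : κ ≠ 0 := by
  rintro rfl
  exact g₃_ne_zero h.g₂_eq (by simp [h.g₃_eq])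

lemma py_sq (hu : u ∉ L.lattice) : L.py κ u ^ 2 = 4 * L.px κ u ^ 3 - 27 := by
  have h0 := h.ne_zero
  have := derivWeierstrassP_sq' h.g₂_eq hu
  rw [h.g₃_eq] at this
  rw [px, py]
  field_simp
  linear_combination this

lemma isPt_point (hu : u ∉ L.lattice) :
    IsPt (L.point κ a u) (L.px κ u) ((L.py κ u - a) / 2) := by
  have hex : ∃ P : ((cubicCurve a)⁄ℂ).Point, u ∉ L.lattice ∧
      cubicCurve.IsPt P (L.px κ u) ((L.py κ u - a) / 2) := by
    obtain ⟨P, hP⟩ := exists_isPt (a := a) (F := ℂ) (x := L.px κ u) (η := (L.py κ u - a) / 2) (by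
      rw [Eqn, eq_ratCast]
      linear_combination h.py_sq hu)
    exact ⟨P, hu, hP⟩
  rw [point, dif_pos hex]
  exact hex.choose_spec.2

lemma point_neg : L.point κ a (-u) = -L.point κ a u := by
  by_cases hu : u ∈ L.lattice
  · rw [point_of_mem hu, point_of_mem (neg_mem hu), neg_zero]
  · refine (h.isPt_point (by simpa using hu)).point_eq ?_
    convert (h.isPt_point hu).neg using 1
    · exact px_neg
    · rw [py_neg, eq_ratCast]; ring

lemma point_add_of_mem (hv : v ∈ L.lattice) : L.point κ a (u + v) = L.point κ a u := by
  by_cases hu : u ∈ L.lattice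
  · rw [point_of_mem hu, point_of_mem (add_mem hu hv)]
  · refine (h.isPt_point (by rwa [add_mem_cancel_right hv])).point_eq ?_
    rw [px_add_of_mem hv, py_add_of_mem hv]
    exact h.isPt_point hu

lemma point_eq_zero_iff : L.point κ a u = 0 ↔ u ∈ L.lattice := by
  refine ⟨fun h0 => ?_, point_of_mem⟩
  by_contra hu
  exact (h.isPt_point hu).ne_zero h0

lemma point_add_of_ne (hu : u ∉ L.lattice) (hv : v ∉ L.lattice)
    (hne : L.weierstrassP u ≠ L.weierstrassP v) :
    L.point κ a (u + v) = L.point κ a u + L.point κ a v := by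
  have h0 := h.ne_zero
  have huv : u + v ∉ L.lattice := by
    contrapose! hne
    have := L.weierstrassP_add_coe (-v) ⟨u + v, hne⟩
    simpa using this
  have hx : L.px κ u ≠ L.px κ v := by
    rw [px, px]
    contrapose! hne
    field_simp at hne
    exact hne
  have hd := sub_ne_zero.mpr hx
  have hd' := sub_ne_zero.mpr hne
  refine (h.isPt_point huv).point_eq ?_
  have := (h.isPt_point (a := a) hu).add (h.isPt_point hv) hx
    (l := (L.py κ u - L.py κ v) / (2 * (L.px κ u - L.px κ v))) (by field_simp; ring)
  have e1 : L.px κ (u + v) = ((L.py κ u - L.py κ v) / (2 * (L.px κ u - L.px κ v))) ^ 2 -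
      L.px κ u - L.px κ v := by
    have e := addition_theorem h.g₂_eq hu hv huv
    have s1 := derivWeierstrassP_sq' h.g₂_eq hu
    have s2 := derivWeierstrassP_sq' h.g₂_eq hv
    have : L.weierstrassP (u + v) = ((L.derivWeierstrassP u - L.derivWeierstrassP v) /
        (2 * (L.weierstrassP u - L.weierstrassP v))) ^ 2 - L.weierstrassP u - L.weierstrassP v := by
      field_simp
      linear_combination 4 * e - s1 - s2
    simp only [px, py, this]
    field_simp
  have e2 : L.py κ (u + v) = -(L.py κ u) - 2 *
      ((L.py κ u - L.py κ v) / (2 * (L.px κ u - L.px κ v))) * (L.px κ (u + v) - L.px κ u) := by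
    have e := addition_theorem_deriv h.g₂_eq hu hv huv
    have e' := addition_theorem h.g₂_eq hu hv huv
    have s1 := derivWeierstrassP_sq' h.g₂_eq hu
    have s2 := derivWeierstrassP_sq' h.g₂_eq hv
    have : L.derivWeierstrassP (u + v) = -L.derivWeierstrassP u - 2 *
        ((L.derivWeierstrassP u - L.derivWeierstrassP v) /
        (2 * (L.weierstrassP u - L.weierstrassP v))) *
        (L.weierstrassP (u + v) - L.weierstrassP u) := by
      field_simp
      refine mul_left_cancel₀ (pow_ne_zero 2 hd') ?_
      linear_combination (L.weierstrassP u - L.weierstrassP v) * e -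
        (L.derivWeierstrassP u + L.derivWeierstrassP v) * e' + L.derivWeierstrassP v / 2 * s1 +
        L.derivWeierstrassP u / 2 * s2
    simp only [px, py, this]
    field_simp
  rw [e1, e2]
  convert this using 1
  rw [e1, eq_ratCast]
  ring

theorem point_add : L.point κ a (u + v) = L.point κ a u + L.point κ a v := by
  by_cases hu : u ∈ L.lattice
  · rw [add_comm, h.point_add_of_mem hu, point_of_mem hu, zero_add]
  by_cases hv : v ∈ L.lattice
  · rw [h.point_add_of_mem hv, point_of_mem hv, add_zero]
  by_cases huv : u + v ∈ L.lattice
  · rw [point_of_mem huv, eq_comm, add_eq_zero_iff_eq_neg, ← h.point_neg,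
      show u = -v + (u + v) by ring, h.point_add_of_mem huv]
  have e1 := L.eventually_weierstrassP_ne (L.weierstrassP u)
  have e2 := L.eventually_weierstrassP_ne (L.weierstrassP v)
  have e3 : ∀ᶠ w in 𝓝[≠] (0 : ℂ), u + w ∉ L.lattice :=
    nhdsWithin_le_nhds (eventually_add_notMem_lattice hu)
  have e4 : ∀ᶠ w in 𝓝[≠] (0 : ℂ), v - w ∉ L.lattice := by
    have hc : ContinuousAt (fun t : ℂ => v - t) 0 := by fun_prop
    exact nhdsWithin_le_nhds
      (hc.eventually (L.eventually_notMem_lattice_of_notMem (u := v - 0) (by simpa using hv)))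
  obtain ⟨w, ⟨⟨⟨⟨h0, h1⟩, h2⟩, h3⟩, h4⟩, h5⟩ :=
    ((frequently_weierstrassP_add_ne_sub h.g₂_eq hu hv huv).and_eventually e1 |>.and_eventually e2
      |>.and_eventually e3 |>.and_eventually e4
      |>.and_eventually L.eventually_notMem_lattice).exists
  calc L.point κ a (u + v) = L.point κ a ((u + w) + (v - w)) := by congr 1; ring
    _ = L.point κ a (u + w) + L.point κ a (v + -w) := by
      rw [h.point_add_of_ne h3 h4 h0, sub_eq_add_neg]
    _ = _ := by
      rw [h.point_add_of_ne hu h5 h1.symm, h.point_add_of_ne hv (by simpa using h5)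
        (by simpa using h2.symm), h.point_neg]
      abel

lemma point_sub : L.point κ a (u - v) = L.point κ a u - L.point κ a v := by
  rw [sub_eq_add_neg, h.point_add, h.point_neg, sub_eq_add_neg]

lemma point_zsmul (n : ℤ) : L.point κ a (n * u) = n • L.point κ a u := by
  let f : ℂ →+ ((cubicCurve a)⁄ℂ).Point := ⟨⟨L.point κ a, point_zero⟩, fun _ _ => h.point_add⟩
  have : f (n • u) = n • f u := map_zsmul f n u
  rwa [zsmul_eq_mul] at this

lemma point_surjective : Function.Surjective (L.point κ a) := by
  intro P
  by_cases hP : P = 0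
  · exact ⟨0, by rw [hP, point_zero]⟩
  obtain ⟨x, η, hP⟩ := exists_isPt_of_ne_zero hP
  obtain ⟨u, hu, hx⟩ := L.exists_weierstrassP_eq (x * κ ^ 2)
  have hx' : L.px κ u = x := by
    rw [px, hx, mul_div_cancel_right₀ _ (pow_ne_zero 2 h.ne_zero)]
  have := h.isPt_point (a := a) hu
  rw [hx'] at this
  rcases hP.eq_or_eq_neg this with e | e
  · exact ⟨u, e.symm⟩
  · exact ⟨-u, by rw [h.point_neg, e]⟩

lemma point_eq_iff : L.point κ a u = L.point κ a v ↔ u - v ∈ L.lattice := by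
  rw [← sub_eq_zero, ← h.point_sub, h.point_eq_zero_iff]

end IsScaled

end PeriodPair

namespace Eisenstein
open PeriodPair

lemma ρ3_eq : ρ3 = ⟨-1 / 2, Real.sqrt 3 / 2⟩ := by
  have : (2 * Real.pi * I / 3 : ℂ) = ((2 * Real.pi / 3 : ℝ) : ℂ) * I := by push_cast; ring
  rw [ρ3, this, Complex.exp_mul_I, ← Complex.ofReal_cos, ← Complex.ofReal_sin,
    show 2 * Real.pi / 3 = Real.pi - Real.pi / 3 by ring, Real.cos_pi_sub, Real.sin_pi_sub,
    Real.cos_pi_div_three, Real.sin_pi_div_three]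
  apply Complex.ext <;> simp [neg_div]

lemma ρ3_im_ne_zero : ρ3.im ≠ 0 := by
  rw [ρ3_eq]
  simp

lemma ρ3_sq : ρ3 ^ 2 = -1 - ρ3 := by
  have h : Real.sqrt 3 ^ 2 = 3 := Real.sq_sqrt (by norm_num)
  rw [ρ3_eq]
  apply Complex.ext
  · simp [sq]; nlinarith
  · simp [sq]; ring

lemma ρ3_cube : ρ3 ^ 3 = 1 := by
  have := ρ3_sq
  linear_combination (ρ3 - 1) * this

lemma ρ3_ne_zero : ρ3 ≠ 0 := fun h => by simpa [h] using ρ3_cube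

lemma ρ3_ne_one : ρ3 ≠ 1 := fun h => by simpa [h] using ρ3_im_ne_zero

lemma conj_ρ3 : (starRingEnd ℂ) ρ3 = -1 - ρ3 := by
  rw [ρ3_eq]
  apply Complex.ext
  · simp; norm_num
  · simp

lemma mem_O3_iff {z : ℂ} : z ∈ O3 ↔ ∃ a b : ℤ, z = a + b * ρ3 := by
  constructor
  · intro h
    refine Subring.closure_induction (p := fun z _ => ∃ a b : ℤ, z = a + b * ρ3)
      ?_ ?_ ?_ ?_ ?_ ?_ h
    · rintro x rfl; exact ⟨0, 1, by simp⟩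
    · exact ⟨0, 0, by simp⟩
    · exact ⟨1, 0, by simp⟩
    · rintro x y - - ⟨a, b, rfl⟩ ⟨c, d, rfl⟩
      exact ⟨a + c, b + d, by push_cast; ring⟩
    · rintro x - ⟨a, b, rfl⟩
      exact ⟨-a, -b, by push_cast; ring⟩
    · rintro x y - - ⟨a, b, rfl⟩ ⟨c, d, rfl⟩
      refine ⟨a * c - b * d, a * d + b * c - b * d, ?_⟩
      have := ρ3_sq
      push_cast
      linear_combination (b * d : ℂ) * this
  · rintro ⟨a, b, rfl⟩
    exact add_mem (intCast_mem _ _) (mul_mem (intCast_mem _ _) (Subring.subset_closure rfl))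

lemma ρ3_mem : ρ3 ∈ O3 := Subring.subset_closure rfl

lemma coord_eq {a b c d : ℝ} (h : (a : ℂ) + b * ρ3 = c + d * ρ3) : a = c ∧ b = d := by
  have h1 := congrArg Complex.im h
  have h2 := congrArg Complex.re h
  simp only [add_im, ofReal_im, zero_add, im_ofReal_mul] at h1
  have hb := mul_right_cancel₀ ρ3_im_ne_zero h1
  subst hb
  simpa using h2

/-- The lattice `ℤ[ρ]`. -/
def eisPair : PeriodPair where
  ω₁ := 1
  ω₂ := ρ3
  indep := by
    rw [LinearIndependent.pair_iff]
    intro s t h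
    have := coord_eq (a := s) (b := t) (c := 0) (d := 0) (by simpa using h)
    exact this

lemma mem_lattice_iff {z : ℂ} : z ∈ eisPair.lattice ↔ z ∈ O3 := by
  rw [mem_lattice, mem_O3_iff]
  simp only [eisPair, mul_one, eq_comm]

lemma ρ3_mul_mem_iff {z : ℂ} : ρ3 * z ∈ eisPair.lattice ↔ z ∈ eisPair.lattice := by
  rw [mem_lattice_iff, mem_lattice_iff]
  refine ⟨fun h => ?_, fun h => mul_mem ρ3_mem h⟩
  have := mul_mem (pow_mem ρ3_mem 2) h
  rwa [← mul_assoc, ← pow_succ, ρ3_cube, one_mul] at this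

/-- Multiplication by `ρ` on the lattice. -/
def rhoEquiv : eisPair.lattice ≃ eisPair.lattice where
  toFun l := ⟨ρ3 * l, ρ3_mul_mem_iff.mpr l.2⟩
  invFun l := ⟨ρ3 ^ 2 * l, by
    rw [pow_two, mul_assoc]; exact ρ3_mul_mem_iff.mpr (ρ3_mul_mem_iff.mpr l.2)⟩
  left_inv l := by ext; simp only [← mul_assoc, ← pow_succ, Nat.reduceAdd, ρ3_cube, one_mul]
  right_inv l := by ext; simp only [← mul_assoc, ← pow_succ', Nat.reduceAdd, ρ3_cube, one_mul]

lemma conj_mem {z : ℂ} (h : z ∈ eisPair.lattice) : (starRingEnd ℂ) z ∈ eisPair.lattice := by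
  rw [mem_lattice_iff, mem_O3_iff] at *
  obtain ⟨a, b, rfl⟩ := h
  refine ⟨a - b, -b, ?_⟩
  simp only [map_add, map_mul, map_intCast, conj_ρ3]
  push_cast
  ring

/-- Complex conjugation on the lattice. -/
def conjEquiv : eisPair.lattice ≃ eisPair.lattice where
  toFun l := ⟨(starRingEnd ℂ) l, conj_mem l.2⟩
  invFun l := ⟨(starRingEnd ℂ) l, conj_mem l.2⟩
  left_inv l := by ext; simp
  right_inv l := by ext; simp

lemma ρ3_sq_inv : (ρ3 ^ 2)⁻¹ = ρ3 := by
  exact inv_eq_of_mul_eq_one_right (by rw [← pow_succ, ρ3_cube])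

lemma weierstrassP_ρ3_mul (u : ℂ) :
    eisPair.weierstrassP (ρ3 * u) = ρ3 * eisPair.weierstrassP u := by
  rw [weierstrassP, weierstrassP, ← rhoEquiv.tsum_eq, ← tsum_mul_left]
  congr with l
  simp only [rhoEquiv, Equiv.coe_fn_mk, ← mul_sub, mul_pow, one_div, mul_inv, ρ3_sq_inv]

lemma derivWeierstrassP_ρ3_mul (u : ℂ) :
    eisPair.derivWeierstrassP (ρ3 * u) = eisPair.derivWeierstrassP u := by
  rw [derivWeierstrassP, derivWeierstrassP, ← rhoEquiv.tsum_eq]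
  congr with l
  simp only [rhoEquiv, Equiv.coe_fn_mk, ← mul_sub, mul_pow, ρ3_cube, one_mul]

lemma g₂_eq_zero : eisPair.g₂ = 0 := by
  have h : eisPair.G 4 = ρ3 ^ 2 * eisPair.G 4 := by
    conv_lhs => rw [G, ← rhoEquiv.tsum_eq]
    rw [G, ← tsum_mul_left]
    congr with l
    simp only [rhoEquiv, Equiv.coe_fn_mk, mul_pow, mul_inv]
    congr 1
    rw [show 4 = 2 * 2 from rfl, pow_mul, ← inv_pow, ρ3_sq_inv]
  have h' : (1 - ρ3 ^ 2) * eisPair.G 4 = 0 := by linear_combination h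
  rcases mul_eq_zero.mp h' with h1 | h1
  · exfalso
    have h2 := ρ3_cube
    refine ρ3_ne_one ?_
    linear_combination ρ3_cube + ρ3 * h1
  · rw [g₂, h1, mul_zero]

lemma weierstrassP_conj (u : ℂ) :
    eisPair.weierstrassP ((starRingEnd ℂ) u) = (starRingEnd ℂ) (eisPair.weierstrassP u) := by
  rw [weierstrassP, weierstrassP, ← conjEquiv.tsum_eq, Complex.conj_tsum]
  congr with l
  simp [conjEquiv]

lemma derivWeierstrassP_conj (u : ℂ) : eisPair.derivWeierstrassP ((starRingEnd ℂ) u) =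
    (starRingEnd ℂ) (eisPair.derivWeierstrassP u) := by
  rw [derivWeierstrassP, derivWeierstrassP, ← conjEquiv.tsum_eq, map_neg, Complex.conj_tsum]
  congr with l
  simp only [conjEquiv, Equiv.coe_fn_mk, map_div₀, map_pow, map_sub, map_ofNat]

lemma g₃_conj : (starRingEnd ℂ) eisPair.g₃ = eisPair.g₃ := by
  rw [g₃, map_mul, G, Complex.conj_tsum]
  conv_rhs => rw [← conjEquiv.tsum_eq]
  congr 1
  · exact map_ofNat (starRingEnd ℂ) 140
  · congr with l
    simp [conjEquiv]

lemma exists_isScaled : ∃ κ, eisPair.IsScaled κ := by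
  obtain ⟨κ, hκ⟩ := IsAlgClosed.exists_pow_nat_eq (eisPair.g₃ / 27) (n := 6) (by norm_num)
  exact ⟨κ, g₂_eq_zero, by rw [hκ]; ring⟩

lemma ofReal_notMem {t : ℝ} (h0 : 0 < t) (h1 : t < 1) : (t : ℂ) ∉ eisPair.lattice := by
  rw [mem_lattice_iff, mem_O3_iff]
  rintro ⟨a, b, h⟩
  have := coord_eq (a := t) (b := 0) (c := a) (d := b) (by simpa using h)
  rw [this.1] at h0 h1
  norm_cast at h0 h1
  omega

lemma third_notMem : (1 / 3 : ℂ) ∉ eisPair.lattice := by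
  have := ofReal_notMem (t := 1 / 3) (by norm_num) (by norm_num)
  simpa using this

variable {κ : ℂ}

lemma px_ρ3_mul (u : ℂ) : eisPair.px κ (ρ3 * u) = ρ3 * eisPair.px κ u := by
  rw [px, px, weierstrassP_ρ3_mul, mul_div_assoc]

lemma py_ρ3_mul (u : ℂ) : eisPair.py κ (ρ3 * u) = eisPair.py κ u := by
  rw [py, py, derivWeierstrassP_ρ3_mul]

variable (h : eisPair.IsScaled κ)
include h

open cubicCurve

lemma px_third_cube : eisPair.px κ (1 / 3) ^ 3 = 27 := by
  have hP := h.isPt_point (a := 0) third_notMem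
  set x := eisPair.px κ (1 / 3)
  set y := eisPair.py κ (1 / 3)
  set P := eisPair.point κ 0 (1 / 3) with hPdef
  have h3 : P + P = -P := by
    rw [eq_neg_iff_add_eq_zero, hPdef, ← h.point_add, ← h.point_add, h.point_eq_zero_iff,
      mem_lattice_iff]
    convert one_mem O3 using 1
    norm_num
  have hsq := h.py_sq third_notMem
  have hx0 : x ≠ 0 := by
    intro hx
    have hR := h.isPt_point (a := 0) (u := ρ3 * (1 / 3))
      (by rw [ρ3_mul_mem_iff]; exact third_notMem)
    rw [px_ρ3_mul, py_ρ3_mul] at hR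
    change IsPt _ (ρ3 * x) _ at hR
    rw [hx, mul_zero] at hR
    rw [hx] at hP
    have := hR.point_eq hP
    rw [hPdef, h.point_eq_iff, mem_lattice_iff, mem_O3_iff] at this
    obtain ⟨a, b, hab⟩ := this
    have := coord_eq (a := -1 / 3) (b := 1 / 3) (c := a) (d := b)
      (by push_cast; linear_combination hab)
    have h4 : (b : ℝ) * 3 = 1 := by rw [← this.2]; norm_num
    norm_cast at h4
    omega
  have hy0 : y ≠ 0 := by
    intro hy
    have hn := hP.neg
    have e : (-((y - (0 : ℚ)) / 2) - algebraMap ℚ ℂ 0) = (y - (0 : ℚ)) / 2 := by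
      rw [hy]; simp
    rw [e] at hn
    have := hP.point_eq hn
    rw [← h3] at this
    exact hP.ne_zero (by simpa using this)
  have hd := hP.add_self (l := 3 * x ^ 2 / y) (by simpa using hy0) (by
    simp only [Rat.cast_zero, sub_zero, map_zero, add_zero]
    field_simp)
  rw [h3] at hd
  have e := (hP.neg.coord_eq hd).1
  field_simp at e
  change y ^ 2 = 4 * x ^ 3 - 27 at hsq
  have : x * (x ^ 3 - 27) = 0 := by
    linear_combination x * (e / 3 - hsq)
  exact sub_eq_zero.mp ((mul_eq_zero.mp this).resolve_left hx0)

end Eisenstein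

namespace Eisenstein
open PeriodPair Filter Topology Set cubicCurve

lemma exists_isScaled_ofReal : ∃ κ : ℝ, 0 < κ ∧ eisPair.IsScaled κ := by
  obtain ⟨κ, h⟩ := exists_isScaled
  have hy := h.py_sq third_notMem
  have hy2 : eisPair.derivWeierstrassP (1 / 3) ^ 2 = 3 * eisPair.g₃ := by
    rw [px_third_cube h, py] at hy
    have h0 := h.ne_zero
    field_simp at hy
    rw [hy, h.g₃_eq]
    ring
  have hreal := derivWeierstrassP_conj (1 / 3)
  rw [map_div₀, map_one, map_ofNat, eq_comm, conj_eq_iff_re] at hreal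
  have hg := g₃_conj
  rw [conj_eq_iff_re] at hg
  rw [← hreal, ← hg] at hy2
  have hy3 : (eisPair.derivWeierstrassP (1 / 3)).re ^ 2 = 3 * eisPair.g₃.re := by
    exact_mod_cast hy2
  have hg0 : eisPair.g₃.re ≠ 0 := fun h0 =>
    g₃_ne_zero h.g₂_eq (by rw [← hg, h0, ofReal_zero])
  have hpos : 0 < eisPair.g₃.re :=
    lt_of_le_of_ne (by nlinarith [sq_nonneg (eisPair.derivWeierstrassP (1 / 3)).re]) hg0.symm
  refine ⟨(eisPair.g₃.re / 27) ^ ((1 : ℝ) / 6), by positivity, g₂_eq_zero, ?_⟩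
  rw [← hg]
  have : ((eisPair.g₃.re / 27) ^ ((1 : ℝ) / 6)) ^ 6 = eisPair.g₃.re / 27 := by
    rw [← Real.rpow_natCast, ← Real.rpow_mul (by positivity)]
    norm_num
  have h2 : 27 * ((eisPair.g₃.re / 27) ^ ((1 : ℝ) / 6)) ^ 6 = eisPair.g₃.re := by
    rw [this]; ring
  conv_lhs => rw [← h2]
  norm_cast

/-- The real-valued restriction of `℘ / κ²` to the real axis. -/
def realX (κ t : ℝ) : ℝ := (eisPair.px κ t).re

/-- The real-valued restriction of `℘' / κ³` to the real axis. -/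
def realY (κ t : ℝ) : ℝ := (eisPair.py κ t).re

variable {κ t : ℝ}

lemma ofReal_realX : (realX κ t : ℂ) = eisPair.px κ t := by
  rw [realX, ← conj_eq_iff_re, px, map_div₀, ← weierstrassP_conj, map_pow, conj_ofReal, conj_ofReal]

lemma ofReal_realY : (realY κ t : ℂ) = eisPair.py κ t := by
  rw [realY, ← conj_eq_iff_re, py, map_div₀, ← derivWeierstrassP_conj, map_pow, conj_ofReal,
    conj_ofReal]

lemma tendsto_ofReal_nhdsNE : Tendsto (fun t : ℝ => (t : ℂ)) (𝓝[>] 0) (𝓝[≠] 0) := by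
  refine tendsto_nhdsWithin_iff.mpr ⟨?_, ?_⟩
  · exact (continuous_ofReal.tendsto' 0 0 (by simp)).mono_left nhdsWithin_le_nhds
  · filter_upwards [self_mem_nhdsWithin] with t ht
    simpa using (ne_of_gt ht)

lemma tendsto_realX : Tendsto (fun t => t ^ 2 * realX κ t) (𝓝[>] 0) (𝓝 (1 / κ ^ 2)) := by
  have := ((eisPair.tendsto_sq_mul_weierstrassP.comp tendsto_ofReal_nhdsNE).div_const
    ((κ : ℂ) ^ 2))
  have h2 := (continuous_re.tendsto _).comp this
  convert h2 using 2
  · simp only [Function.comp_apply, mul_div_assoc]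
    rw [← px, ← ofReal_realX]
    norm_cast
  · norm_cast

lemma tendsto_realY : Tendsto (fun t => t ^ 3 * realY κ t) (𝓝[>] 0) (𝓝 (-2 / κ ^ 3)) := by
  have := ((eisPair.tendsto_cube_mul_derivWeierstrassP.comp tendsto_ofReal_nhdsNE).div_const
    ((κ : ℂ) ^ 3))
  have h2 := (continuous_re.tendsto _).comp this
  convert h2 using 2
  · simp only [Function.comp_apply, mul_div_assoc]
    rw [← py, ← ofReal_realY]
    norm_cast
  · norm_cast

variable (h : eisPair.IsScaled κ)
include h

lemma realY_sq (h0 : 0 < t) (h1 : t < 1) : realY κ t ^ 2 = 4 * realX κ t ^ 3 - 27 := by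
  have := h.py_sq (ofReal_notMem h0 h1)
  rw [← ofReal_realX, ← ofReal_realY] at this
  exact_mod_cast this

lemma hasDerivAt_realX (h0 : 0 < t) (h1 : t < 1) :
    HasDerivAt (realX κ) (κ * realY κ t) t := by
  have hκ := h.ne_zero
  have := ((eisPair.hasDerivAt_weierstrassP
    (ofReal_notMem h0 h1)).div_const ((κ : ℂ) ^ 2)).real_of_complex
  refine this.congr_deriv ?_
  rw [show eisPair.derivWeierstrassP t / (κ : ℂ) ^ 2 = (κ * realY κ t : ℝ) by
    push_cast; rw [ofReal_realY, py]; field_simp]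
  rfl

lemma hasDerivAt_realY (h0 : 0 < t) (h1 : t < 1) :
    HasDerivAt (realY κ) (6 * κ * realX κ t ^ 2) t := by
  have hκ := h.ne_zero
  have := ((eisPair.hasDerivAt_derivWeierstrassP g₂_eq_zero (ofReal_notMem h0 h1)).div_const
    ((κ : ℂ) ^ 3)).real_of_complex
  refine this.congr_deriv ?_
  rw [show 6 * eisPair.weierstrassP t ^ 2 / (κ : ℂ) ^ 3 = (6 * κ * realX κ t ^ 2 : ℝ) by
    push_cast; rw [ofReal_realX, px]; field_simp]
  rfl

lemma realX_third : realX κ (1 / 3) = 3 := by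
  have := px_third_cube h
  have e : ((1 / 3 : ℝ) : ℂ) = 1 / 3 := by push_cast; rfl
  rw [← e, ← ofReal_realX] at this
  have h3 : realX κ (1 / 3) ^ 3 = 3 ^ 3 := by norm_num; exact_mod_cast this
  exact (Odd.strictMono_pow (by decide : Odd 3)).injective h3

lemma realX_ne_three (h0 : 0 < t) (h1 : t < 1 / 3) : realX κ t ≠ 3 := by
  intro hx
  rw [← realX_third h, ← ofReal_inj, ofReal_realX, ofReal_realX] at hx
  have n1 : ((1 / 3 : ℝ) : ℂ) ∉ eisPair.lattice := ofReal_notMem (by norm_num) (by norm_num)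
  have p1 := h.isPt_point (a := 0) (ofReal_notMem h0 (by linarith))
  have p2 := h.isPt_point (a := 0) n1
  rw [hx] at p1
  rcases p1.eq_or_eq_neg p2 with e | e
  · rw [eq_comm, h.point_eq_iff, ← ofReal_sub] at e
    exact ofReal_notMem (by linarith) (by linarith) e
  · rw [← h.point_neg, h.point_eq_iff, sub_neg_eq_add, ← ofReal_add] at e
    exact ofReal_notMem (by linarith) (by linarith) e

lemma realY_lt (hκ : 0 < κ) (h0 : 0 < t) (h1 : t < 1 / 3) : realY κ t < -9 := by
  by_contra! hle
  have hev : ∀ᶠ s in 𝓝[>] (0 : ℝ), realY κ s < -9 := by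
    have hc : Tendsto (fun s : ℝ => s ^ 3 * realY κ s + 9 * s ^ 3) (𝓝[>] 0)
        (𝓝 (-2 / κ ^ 3 + 0)) := by
      refine tendsto_realY.add ?_
      have : Continuous (fun s : ℝ => 9 * s ^ 3) := by fun_prop
      exact (this.tendsto' 0 0 (by simp)).mono_left nhdsWithin_le_nhds
    have hneg : -2 / κ ^ 3 + 0 < 0 := by
      rw [add_zero]; exact div_neg_of_neg_of_pos (by norm_num) (by positivity)
    filter_upwards [hc.eventually_lt_const hneg, self_mem_nhdsWithin] with s hs hs0
    have hs0 : 0 < s := hs0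
    have : 0 < s ^ 3 := by positivity
    nlinarith
  obtain ⟨s, hs, hs0⟩ := (hev.and (Ioo_mem_nhdsGT h0)).exists
  have hcont : ContinuousOn (realY κ) (Icc s t) := fun r hr =>
    (hasDerivAt_realY h (by linarith [hs0.1, hr.1]) (by linarith [hr.2])).continuousAt
      |>.continuousWithinAt
  obtain ⟨r, hr, hr9⟩ := intermediate_value_Icc hs0.2.le hcont ⟨hs.le, hle⟩
  have hr0 : 0 < r := by linarith [hs0.1, hr.1]
  have hsq := realY_sq h hr0 (by linarith [hr.2])
  rw [hr9] at hsq
  have h3 : realX κ r ^ 3 = 3 ^ 3 := by linarith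
  exact realX_ne_three h hr0 (by linarith [hr.2])
    ((Odd.strictMono_pow (by decide : Odd 3)).injective h3)

lemma realY_third (hκ : 0 < κ) : realY κ (1 / 3) = -9 := by
  have hsq := realY_sq h (t := 1 / 3) (by norm_num) (by norm_num)
  rw [realX_third h] at hsq
  have hc := (hasDerivAt_realY h (t := 1 / 3) (by norm_num) (by norm_num)).continuousAt
  have hle : realY κ (1 / 3) ≤ -9 := by
    refine le_of_tendsto (hc.tendsto.mono_left (nhdsWithin_le_nhds (s := Iio (1 / 3)))) ?_
    filter_upwards [Ioo_mem_nhdsLT (show (0 : ℝ) < 1 / 3 by norm_num)] with s hs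
    exact (realY_lt h hκ hs.1 hs.2).le
  nlinarith

theorem varpi1_eq (hκ : 0 < κ) : varpi1 = κ := by
  set S : ℝ → ℝ := fun t => 6 * realX κ t / (9 - realY κ t) with hS
  set C : ℝ → ℝ := fun t => -(9 + realY κ t) / (9 - realY κ t) with hC
  have hYle : ∀ t ∈ Ioc (0 : ℝ) (1 / 3), realY κ t ≤ -9 := fun t ht => by
    rcases ht.2.lt_or_eq with h1 | h1
    · exact (realY_lt h hκ ht.1 h1).le
    · rw [h1, realY_third h hκ]
  have hd : ∀ t ∈ Ioc (0 : ℝ) (1 / 3), HasDerivAt S (3 * κ * C t ^ 2) t := fun t ht => by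
    have hne : 9 - realY κ t ≠ 0 := by linarith [hYle t ht]
    have h1 : t < 1 := by linarith [ht.2]
    have := ((hasDerivAt_realX h ht.1 h1).const_mul 6).div
      ((hasDerivAt_realY h ht.1 h1).const_sub 9) hne
    refine this.congr_deriv ?_
    simp only [hC]
    field_simp
    linear_combination (-9 : ℝ) * realY_sq h ht.1 h1
  have hScube : ∀ t ∈ Ioc (0 : ℝ) (1 / 3), 1 - S t ^ 3 = C t ^ 3 := fun t ht => by
    have hne : 9 - realY κ t ≠ 0 := by linarith [hYle t ht]
    have h1 : t < 1 := by linarith [ht.2]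
    simp only [hS, hC]
    field_simp
    linear_combination 54 * realY_sq h ht.1 h1
  have hCpos : ∀ t ∈ Ioo (0 : ℝ) (1 / 3), 0 < C t := fun t ht => by
    have := realY_lt h hκ ht.1 ht.2
    exact div_pos (by linarith) (by linarith)
  have hcont : ContinuousOn S (Ioc 0 (1 / 3)) := fun t ht =>
    (hd t ht).continuousAt.continuousWithinAt
  have hmono : StrictMonoOn S (Ioc 0 (1 / 3)) := by
    refine strictMonoOn_of_deriv_pos (convex_Ioc _ _) hcont fun t ht => ?_
    rw [interior_Ioc] at ht
    rw [(hd t (Ioo_subset_Ioc_self ht)).deriv]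
    have := hCpos t ht
    positivity
  have hS1 : S (1 / 3) = 1 := by
    simp only [hS, realX_third h, realY_third h hκ]; norm_num
  have hlim : Tendsto S (𝓝[>] 0) (𝓝 0) := by
    have hc : Tendsto (fun s : ℝ => s * (6 * (s ^ 2 * realX κ s)) / (9 * s ^ 3 - s ^ 3 * realY κ s))
        (𝓝[>] 0) (𝓝 (0 * (6 * (1 / κ ^ 2)) / (9 * 0 ^ 3 - -2 / κ ^ 3))) := by
      have hid : Tendsto (fun s : ℝ => s) (𝓝[>] 0) (𝓝 0) := nhdsWithin_le_nhds
      refine Tendsto.div (hid.mul (tendsto_realX.const_mul 6))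
        (((hid.pow 3).const_mul 9).sub tendsto_realY) ?_
      have := hκ.ne'
      field_simp
      norm_num [this]
    rw [zero_mul, zero_div] at hc
    refine hc.congr' ?_
    filter_upwards [self_mem_nhdsWithin] with s hs
    have hs : s ≠ 0 := ne_of_gt hs
    simp only [hS]
    rw [show s * (6 * (s ^ 2 * realX κ s)) = s ^ 3 * (6 * realX κ s) by ring,
      show 9 * s ^ 3 - s ^ 3 * realY κ s = s ^ 3 * (9 - realY κ s) by ring,
      mul_div_mul_left _ _ (pow_ne_zero 3 hs)]
  have himage : S '' Ioo 0 (1 / 3) = Ioo 0 1 := by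
    ext s
    constructor
    · rintro ⟨t, ht, rfl⟩
      refine ⟨?_, ?_⟩
      · have hx : 0 < realX κ t := by
          have := realY_sq h ht.1 (by linarith [ht.2])
          by_contra! hle
          nlinarith [sq_nonneg (realY κ t), sq_nonneg (realX κ t),
            mul_nonneg (sq_nonneg (realX κ t)) (neg_nonneg.mpr hle)]
        exact div_pos (by linarith) (by linarith [realY_lt h hκ ht.1 ht.2])
      · rw [← hS1]
        exact hmono (Ioo_subset_Ioc_self ht) (by norm_num) ht.2
    · rintro ⟨hs0, hs1⟩
      obtain ⟨r, hr, hr0⟩ := ((hlim.eventually_lt_const hs0).and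
        (Ioo_mem_nhdsGT (show (0 : ℝ) < 1 / 3 by norm_num))).exists
      have hsub : Icc r (1 / 3) ⊆ Ioc 0 (1 / 3) := fun x hx => ⟨hr0.1.trans_le hx.1, hx.2⟩
      obtain ⟨t, ht, hts⟩ := intermediate_value_Icc hr0.2.le (hcont.mono hsub)
        (show s ∈ Icc (S r) (S (1 / 3)) from ⟨hr.le, by rw [hS1]; exact hs1.le⟩)
      refine ⟨t, ⟨hr0.1.trans_le ht.1, lt_of_le_of_ne ht.2 ?_⟩, hts⟩
      rintro rfl
      rw [hS1] at hts
      exact hs1.ne' hts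
  have key := MeasureTheory.integral_image_eq_integral_abs_deriv_smul (s := Ioo 0 (1 / 3))
    measurableSet_Ioo (fun t ht => (hd t (Ioo_subset_Ioc_self ht)).hasDerivWithinAt)
    (hmono.injOn.mono Ioo_subset_Ioc_self) (fun x : ℝ => (1 - x ^ 3) ^ (-(2:ℝ)/3))
  rw [varpi1, intervalIntegral.integral_of_le zero_le_one,
    MeasureTheory.integral_Ioc_eq_integral_Ioo, ← himage, key]
  rw [MeasureTheory.setIntegral_congr_fun (g := fun _ => 3 * κ) measurableSet_Ioo]
  · simp
  · intro t ht
    have hp := hCpos t ht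
    simp only [smul_eq_mul]
    rw [hScube t (Ioo_subset_Ioc_self ht), ← Real.rpow_natCast (C t) 3, ← Real.rpow_mul hp.le,
      abs_of_pos (by positivity), ← Real.rpow_natCast (C t) 2]
    rw [mul_assoc, ← Real.rpow_add hp]
    norm_num

end Eisenstein

namespace Eisenstein
open PeriodPair

lemma isScaled_varpi1 : eisPair.IsScaled varpi1 := by
  obtain ⟨κ, hκ, h⟩ := exists_isScaled_ofReal
  rwa [varpi1_eq h hκ]

lemma wp3_varpi1_mul (u : ℂ) : wp3 (varpi1 * u) = eisPair.px varpi1 u := by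
  have h0 := isScaled_varpi1.ne_zero
  rw [wp3, px, ← eisPair.weierstrassPExcept_add 0, weierstrassPExcept,
    ← eisPair.latticeEquivProd.symm.toEquiv.tsum_eq, add_div, ← tsum_div_const, add_comm]
  congr 1
  · congr with m
    have e : ω3 m = varpi1 * (eisPair.latticeEquivProd.symm m : ℂ) := by
      rw [ω3, eisPair.latticeEquiv_symm_apply]; simp [eisPair]
    simp only [LinearEquiv.coe_toEquiv, ZeroMemClass.coe_zero, ZeroMemClass.coe_eq_zero,
      LinearEquiv.map_eq_zero_iff, e]
    split_ifs
    · simp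
    · rw [← mul_sub, mul_pow, mul_pow, mul_inv, mul_inv]
      ring
  · simp only [ZeroMemClass.coe_zero, sub_zero, mul_pow, mul_inv]
    ring

lemma wp3'_varpi1_mul (u : ℂ) : wp3' (varpi1 * u) = eisPair.py varpi1 u := by
  have h0 := isScaled_varpi1.ne_zero
  rw [wp3', py, derivWeierstrassP, ← eisPair.latticeEquivProd.symm.toEquiv.tsum_eq,
    neg_div, ← tsum_div_const, ← tsum_neg]
  congr with m
  have e : ω3 m = varpi1 * (eisPair.latticeEquivProd.symm m : ℂ) := by
    rw [ω3, eisPair.latticeEquiv_symm_apply]; simp [eisPair]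
  simp only [LinearEquiv.coe_toEquiv, e]
  rw [← mul_sub, mul_pow, mul_inv]
  ring

lemma phi3_eq (u : ℂ) : phi3 u = 6 * eisPair.px varpi1 u / (9 + eisPair.py varpi1 u) := by
  rw [phi3, wp3_varpi1_mul, wp3'_varpi1_mul]

lemma psi3_eq (u : ℂ) :
    psi3 u = (9 - eisPair.py varpi1 u) / (9 + eisPair.py varpi1 u) := by
  rw [psi3, wp3'_varpi1_mul]

lemma phi3_ρ3_mul (u : ℂ) : phi3 (ρ3 * u) = ρ3 * phi3 u := by
  rw [phi3_eq, phi3_eq, px_ρ3_mul, py_ρ3_mul]; ring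

lemma psi3_ρ3_mul (u : ℂ) : psi3 (ρ3 * u) = psi3 u := by
  rw [psi3_eq, psi3_eq, py_ρ3_mul]

lemma phi3_add_of_mem {u v : ℂ} (hv : v ∈ O3) : phi3 (u + v) = phi3 u := by
  rw [← mem_lattice_iff] at hv
  rw [phi3_eq, phi3_eq, px_add_of_mem hv, py_add_of_mem hv]

lemma psi3_add_of_mem {u v : ℂ} (hv : v ∈ O3) : psi3 (u + v) = psi3 u := by
  rw [← mem_lattice_iff] at hv
  rw [psi3_eq, psi3_eq, py_add_of_mem hv]

end Eisenstein

namespace cubicCurve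
open WeierstrassCurve WeierstrassCurve.Affine

variable {F : Type*} [Field F] {α β z₁ z₂ z₃ w₁ w₂ w₃ l m : F}

/-- The chord construction in the coordinates `z = x / η`, `w = 1 / η` at infinity. -/
lemma chord_identities (h₁ : w₁ + α * w₁ ^ 2 = z₁ ^ 3 + β * w₁ ^ 3) (hw₁ : w₁ = l * z₁ + m)
    (hw₂ : w₂ = l * z₂ + m) (hw₃ : w₃ = l * z₃ + m)
    (hl : l * (1 + α * (w₁ + w₂) - β * (w₁ ^ 2 + w₁ * w₂ + w₂ ^ 2)) = z₁ ^ 2 + z₁ * z₂ + z₂ ^ 2)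
    (hz₃ : (1 + β * l ^ 3) * (z₁ + z₂ + z₃) = α * l ^ 2 - 3 * β * l ^ 2 * m) :
    (1 + β * l ^ 3) * w₁ * w₂ * w₃ = m ^ 3 ∧
      (1 + β * l ^ 3) * (z₁ * w₂ * w₃ + z₂ * w₁ * w₃ + z₃ * w₁ * w₂) = l ^ 2 * m := by
  have d2 : (1 + β * l ^ 3) * (z₁ ^ 2 + z₁ * z₂ + z₂ ^ 2) +
      (3 * β * l ^ 2 * m - α * l ^ 2) * (z₁ + z₂) +
      (3 * β * l * m ^ 2 - l - 2 * α * l * m) = 0 := by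
    rw [hw₁, hw₂] at hl
    linear_combination -hl
  have e2 : (1 + β * l ^ 3) * (z₁ * z₂ + z₁ * z₃ + z₂ * z₃) =
      3 * β * l * m ^ 2 - l - 2 * α * l * m := by
    linear_combination (z₁ + z₂) * hz₃ - d2
  have e3 : -(1 + β * l ^ 3) * (z₁ * z₂ * z₃) = β * m ^ 3 - m - α * m ^ 2 := by
    rw [hw₁] at h₁
    linear_combination -z₁ * e2 + z₁ ^ 2 * hz₃ + h₁
  rw [hw₁, hw₂, hw₃]
  constructor
  · linear_combination l ^ 2 * m * e2 - l ^ 3 * e3 + l * m ^ 2 * hz₃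
  · linear_combination -3 * l ^ 2 * e3 + 2 * l * m * e2 + m ^ 2 * hz₃

variable {a : ℚ} [Algebra ℚ F]

/-- `P` has coordinates `z = x / η`, `w = 1 / η` in the chart at infinity. -/
def IsZW (P : ((cubicCurve a)⁄F).Point) (z w : F) : Prop :=
  (w = 0 ∧ z = 0 ∧ P = 0) ∨ (w ≠ 0 ∧ IsPt P (z / w) (1 / w))

variable {P Q : ((cubicCurve a)⁄F).Point} {z w z' w' : F}

/-- The constant coefficient of `cubicCurve a`. -/
def coeff₆ (a : ℚ) (F : Type*) [Field F] [Algebra ℚ F] : F := algebraMap ℚ F (-(27 + a ^ 2) / 4)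

lemma four_mul_coeff₆ : 4 * coeff₆ a F = -(27 + algebraMap ℚ F a ^ 2) := by
  rw [coeff₆, show (4 : F) = algebraMap ℚ F 4 by simp, ← map_mul, mul_div_cancel₀ _ (by norm_num)]
  simp only [map_neg, map_add, map_pow, map_ofNat]

lemma four_ne_zero' : (4 : F) ≠ 0 := by
  have := (algebraMap ℚ F).injective.ne (show (4 : ℚ) ≠ 0 by norm_num)
  simpa using this

lemma eqn_iff {x η : F} : Eqn a F x η ↔ η ^ 2 + algebraMap ℚ F a * η = x ^ 3 + coeff₆ a F := by
  have h4 := four_ne_zero' (F := F)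
  have h6 := four_mul_coeff₆ (a := a) (F := F)
  rw [Eqn]
  constructor <;> intro h
  · refine mul_left_cancel₀ h4 ?_
    linear_combination h - h6
  · linear_combination 4 * h + h6

lemma IsZW.zero : IsZW (0 : ((cubicCurve a)⁄F).Point) 0 0 := .inl ⟨rfl, rfl, rfl⟩

lemma IsZW.eqn (h : IsZW P z w) :
    w + algebraMap ℚ F a * w ^ 2 = z ^ 3 + coeff₆ a F * w ^ 3 := by
  rcases h with ⟨rfl, rfl, -⟩ | ⟨h0, h⟩
  · ring
  · have := eqn_iff.mp h.eqn
    field_simp at this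
    linear_combination this

lemma IsPt.isZW {x η : F} (h : IsPt P x η) (h0 : η ≠ 0) : IsZW P (x / η) (1 / η) := by
  refine .inr ⟨one_div_ne_zero h0, ?_⟩
  convert h using 1 <;> field_simp

lemma IsZW.coord_eq (h : IsZW P z w) (h' : IsZW P z' w') : z = z' ∧ w = w' := by
  rcases h with ⟨rfl, rfl, rfl⟩ | ⟨h0, h⟩ <;> rcases h' with ⟨rfl, rfl, h2⟩ | ⟨h0', h'⟩
  · exact ⟨rfl, rfl⟩
  · exact (h'.ne_zero rfl).elim
  · exact (h.ne_zero h2).elim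
  · obtain ⟨e1, e2⟩ := h.coord_eq h'
    have : w = w' := by simpa using e2
    subst this
    exact ⟨by field_simp at e1; exact e1, rfl⟩

lemma IsZW.neg (h : IsZW P z w) (h1 : 1 + algebraMap ℚ F a * w ≠ 0) :
    IsZW (-P) (-z / (1 + algebraMap ℚ F a * w)) (-w / (1 + algebraMap ℚ F a * w)) := by
  rcases h with ⟨rfl, rfl, rfl⟩ | ⟨h0, h⟩
  · simpa using IsZW.zero
  · refine .inr ⟨div_ne_zero (neg_ne_zero.mpr h0) h1, ?_⟩
    convert h.neg using 1
    · field_simp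
    · field_simp
      ring

variable [DecidableEq F]

lemma IsPt.neg_add (hP : IsPt P (z₁ / w₁) (1 / w₁)) (hQ : IsPt Q (z₂ / w₂) (1 / w₂))
    (h0₁ : w₁ ≠ 0) (h0₂ : w₂ ≠ 0) (hPQ : P ≠ -Q) (hw₁ : w₁ = l * z₁ + m)
    (hw₂ : w₂ = l * z₂ + m) (hw₃ : w₃ = l * z₃ + m)
    (hU : 1 + algebraMap ℚ F a * (w₁ + w₂) - coeff₆ a F * (w₁ ^ 2 + w₁ * w₂ + w₂ ^ 2) ≠ 0)
    (hl : l * (1 + algebraMap ℚ F a * (w₁ + w₂) - coeff₆ a F * (w₁ ^ 2 + w₁ * w₂ + w₂ ^ 2)) =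
      z₁ ^ 2 + z₁ * z₂ + z₂ ^ 2)
    (hA : 1 + coeff₆ a F * l ^ 3 ≠ 0)
    (hz₃ : (1 + coeff₆ a F * l ^ 3) * (z₁ + z₂ + z₃) =
      algebraMap ℚ F a * l ^ 2 - 3 * coeff₆ a F * l ^ 2 * m) :
    w₃ ≠ 0 ∧ IsPt (-(P + Q)) (z₃ / w₃) (1 / w₃) := by
  have h₁ := IsZW.eqn (.inr ⟨h0₁, hP⟩)
  obtain ⟨k1, k2⟩ := chord_identities h₁ hw₁ hw₂ hw₃ hl hz₃
  have main : m ≠ 0 ∧ IsPt (P + Q) ((-l / m) ^ 2 - z₁ / w₁ - z₂ / w₂)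
      (-(-l / m * ((-l / m) ^ 2 - z₁ / w₁ - z₂ / w₂ - z₁ / w₁) + 1 / w₁) - algebraMap ℚ F a) := by
    by_cases hz : z₁ = z₂
    · have hw : w₁ = w₂ := by rw [hw₁, hw₂, hz]
      subst hz; subst hw
      have hQP := hP.point_eq hQ
      subst hQP
      have hne : 2 * (1 / w₁) + algebraMap ℚ F a ≠ 0 := by
        contrapose! hPQ
        have hn := hP.neg
        rw [show -(1 / w₁) - algebraMap ℚ F a = 1 / w₁ by linear_combination -hPQ] at hn
        exact hP.point_eq hn
      have hmU : m * (1 + algebraMap ℚ F a * (w₁ + w₁) -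
          coeff₆ a F * (w₁ ^ 2 + w₁ * w₁ + w₁ ^ 2)) =
          - w₁ ^ 2 * (2 * (1 / w₁) + algebraMap ℚ F a) := by
        have : w₁ ^ 2 * (1 / w₁) = w₁ := by field_simp
        linear_combination (-z₁) * hl - (1 + algebraMap ℚ F a * (w₁ + w₁) -
          coeff₆ a F * (w₁ ^ 2 + w₁ * w₁ + w₁ ^ 2)) * hw₁ + 3 * h₁ + 2 * this
      have hm : m ≠ 0 := by
        rintro rfl
        rw [zero_mul, eq_comm, mul_eq_zero] at hmU
        exact hmU.elim (neg_ne_zero.mpr (pow_ne_zero 2 h0₁)) hne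
      refine ⟨hm, hP.add_self hne ?_⟩
      have e : -l * (2 * (1 / w₁) + algebraMap ℚ F a) = m * (3 * (z₁ / w₁) ^ 2) := by
        refine mul_left_cancel₀ (pow_ne_zero 2 h0₁) ?_
        have : w₁ ^ 2 * (m * (3 * (z₁ / w₁) ^ 2)) = m * (3 * z₁ ^ 2) := by field_simp
        rw [this]
        linear_combination m * hl - l * hmU
      rw [neg_div, neg_mul, div_mul_eq_mul_div, neg_eq_iff_eq_neg, div_eq_iff hm]
      linear_combination -e
    · have hx : z₁ / w₁ ≠ z₂ / w₂ := by
        intro hx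
        rw [hx] at hP
        rcases hP.eq_or_eq_neg hQ with e | e
        · rw [← e] at hQ
          have := (hP.coord_eq hQ).2
          have hw : w₁ = w₂ := by simpa using this
          subst hw
          field_simp at hx
          exact hz hx
        · exact hPQ e
      have hm : m ≠ 0 := by
        rintro rfl
        rw [add_zero] at hw₁ hw₂
        apply hx
        rw [hw₁] at h0₁
        rw [hw₂] at h0₂
        have hl0 := left_ne_zero_of_mul h0₁
        have hz1 := right_ne_zero_of_mul h0₁
        have hz2 := right_ne_zero_of_mul h0₂
        rw [hw₁, hw₂]
        field_simp
      refine ⟨hm, hP.add hQ hx ?_⟩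
      field_simp
      rw [hw₁, hw₂]
      ring
  obtain ⟨hm, main⟩ := main
  have hw₃0 : w₃ ≠ 0 := by
    rintro rfl
    rw [mul_zero, eq_comm] at k1
    exact pow_ne_zero 3 hm k1
  have ex : z₃ / w₃ = (-l / m) ^ 2 - z₁ / w₁ - z₂ / w₂ := by
    have : z₁ / w₁ + z₂ / w₂ + z₃ / w₃ = (-l / m) ^ 2 := by
      have e : (1 + coeff₆ a F * l ^ 3) * w₁ * w₂ * w₃ * (z₁ / w₁ + z₂ / w₂ + z₃ / w₃) =
          l ^ 2 * m := by
        rw [← k2]; field_simp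
      rw [k1] at e
      rw [div_pow, neg_sq, eq_div_iff (pow_ne_zero 2 hm)]
      refine mul_left_cancel₀ hm ?_
      linear_combination e
    linear_combination this
  refine ⟨hw₃0, ?_⟩
  convert main.neg using 1
  rw [← ex]
  field_simp
  rw [hw₁, hw₃]
  ring

end cubicCurve

namespace cubicCurve
open WeierstrassCurve WeierstrassCurve.Affine

variable {F : Type*} [Field F] {a : ℚ} [Algebra ℚ F] {Γ : Type*}
  [LinearOrderedCommGroupWithZero Γ] (v : Valuation F Γ)

/-- `P` lies in the neighbourhood of radius `M` of the origin, with local parameter `z`. -/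
def Near (M : Γ) (P : ((cubicCurve a)⁄F).Point) (z : F) : Prop :=
  ∃ w, IsZW P z w ∧ v z ≤ M ∧ v w ≤ M ^ 3

lemma map_mul_le_of_le_one {F : Type*} [Field F] {v : Valuation F Γ} {x y : F} {M : Γ}
    (hx : v x ≤ 1) (hy : v y ≤ M) : v (x * y) ≤ M := by
  rw [map_mul]
  simpa using mul_le_mul' hx hy

lemma map_natCast_le_one {F : Type*} [Field F] (v : Valuation F Γ) (n : ℕ) : v n ≤ 1 := by
  induction n with
  | zero => simp
  | succ n ih => rw [Nat.cast_succ]; exact v.map_add_le ih (by simp)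

lemma map_intCast_le_one {F : Type*} [Field F] (v : Valuation F Γ) (n : ℤ) : v n ≤ 1 := by
  obtain ⟨n, rfl | rfl⟩ := n.eq_nat_or_neg
  · simpa using map_natCast_le_one v n
  · simpa [Valuation.map_neg] using map_natCast_le_one v n

variable {v} {M E : Γ} {P Q : ((cubicCurve a)⁄F).Point} {z z₁ z₂ : F}

lemma Near.zero : Near v M (0 : ((cubicCurve a)⁄F).Point) 0 :=
  ⟨0, IsZW.zero, by simp, by simp⟩

lemma Near.coord_eq (h : Near v M P z₁) (h' : Near v M P z₂) : z₁ = z₂ := by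
  obtain ⟨w, h, -⟩ := h
  obtain ⟨w', h', -⟩ := h'
  exact (h.coord_eq h').1

variable (hα : v (algebraMap ℚ F a) ≤ 1) (hM : M < 1)
include hα hM

lemma Near.neg (hE : v (algebraMap ℚ F a) * M ^ 4 ≤ E) (h : Near v M P z) :
    ∃ z', Near v M (-P) z' ∧ v (z' + z) ≤ E := by
  obtain ⟨w, h, hz, hw⟩ := h
  have hw1 : v (algebraMap ℚ F a * w) < 1 :=
    (map_mul_le_of_le_one hα hw).trans_lt (pow_lt_one₀ zero_le hM (by norm_num))
  have hu : v (1 + algebraMap ℚ F a * w) = 1 := Valuation.map_one_add_of_lt v hw1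
  have hu0 : 1 + algebraMap ℚ F a * w ≠ 0 := by
    intro h0; rw [h0] at hu; simp at hu
  refine ⟨_, ⟨_, h.neg hu0, ?_, ?_⟩, ?_⟩
  · rwa [map_div₀, hu, div_one, Valuation.map_neg]
  · rwa [map_div₀, hu, div_one, Valuation.map_neg]
  · have : -z / (1 + algebraMap ℚ F a * w) + z =
        algebraMap ℚ F a * (w * z) / (1 + algebraMap ℚ F a * w) := by
      field_simp; ring
    rw [this, map_div₀, hu, div_one, map_mul, map_mul]
    refine le_trans (mul_le_mul_right (?_ : _ ≤ M ^ 4) _) hE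
    rw [pow_succ]
    exact mul_le_mul' hw hz

variable [DecidableEq F] (hβ : v (coeff₆ a F) ≤ 1)
include hβ

lemma Near.add (hE : v (algebraMap ℚ F a) * M ^ 4 ≤ E) (hE' : M ^ 7 ≤ E)
    (hP : Near v M P z₁) (hQ : Near v M Q z₂) :
    ∃ z', Near v M (P + Q) z' ∧ v (z' - (z₁ + z₂)) ≤ E := by
  by_cases hPQ : P = -Q
  · obtain ⟨z', h, h'⟩ := hQ.neg hα hM hE
    rw [← hPQ] at h
    rw [h.coord_eq hP] at h'
    refine ⟨0, ?_, by rwa [zero_sub, Valuation.map_neg]⟩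
    rw [hPQ, neg_add_cancel]
    exact Near.zero
  obtain ⟨w₁, ⟨rfl, rfl, rfl⟩ | ⟨h₁, hP⟩, hz₁, hw₁⟩ := hP
  · exact ⟨z₂, by rwa [zero_add], by simp⟩
  obtain ⟨w₂, ⟨rfl, rfl, rfl⟩ | ⟨h₂, hQ⟩, hz₂, hw₂⟩ := hQ
  · exact ⟨z₁, by rw [add_zero]; exact ⟨w₁, .inr ⟨h₁, hP⟩, hz₁, hw₁⟩, by simp⟩
  have e₁ := IsZW.eqn (.inr ⟨h₁, hP⟩)
  have e₂ := IsZW.eqn (.inr ⟨h₂, hQ⟩)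
  have hM3 : M ^ 3 < 1 := pow_lt_one₀ zero_le hM (by norm_num)
  have three : v (3 : F) ≤ 1 := by simpa using map_natCast_le_one v 3
  set α := algebraMap ℚ F a
  set β := coeff₆ a F
  set U := 1 + α * (w₁ + w₂) - β * (w₁ ^ 2 + w₁ * w₂ + w₂ ^ 2) with hU
  have hUv : v U = 1 := by
    rw [hU, add_sub_assoc]
    refine Valuation.map_one_add_of_lt v (lt_of_le_of_lt ?_ hM3)
    refine v.map_sub_le (map_mul_le_of_le_one hα (v.map_add_le hw₁ hw₂)) 
      (map_mul_le_of_le_one hβ (v.map_add_le (v.map_add_le ?_ ?_) ?_))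
    · rw [sq]; exact map_mul_le_of_le_one (hw₁.trans hM3.le) hw₁
    · exact map_mul_le_of_le_one (hw₁.trans hM3.le) hw₂
    · rw [sq]; exact map_mul_le_of_le_one (hw₂.trans hM3.le) hw₂
  have hU0 : U ≠ 0 := by
    intro h0; rw [h0] at hUv; simp at hUv
  set l := (z₁ ^ 2 + z₁ * z₂ + z₂ ^ 2) / U with hldef
  have hl : l * U = z₁ ^ 2 + z₁ * z₂ + z₂ ^ 2 := div_mul_cancel₀ _ hU0
  have hlv : v l ≤ M ^ 2 := by
    rw [hldef, map_div₀, hUv, div_one]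
    refine v.map_add_le (v.map_add_le ?_ ?_) ?_
    · rw [map_pow]; exact pow_le_pow_left' hz₁ 2
    · rw [map_mul, sq]; exact mul_le_mul' hz₁ hz₂
    · rw [map_pow]; exact pow_le_pow_left' hz₂ 2
  have hw₁₂ : w₁ - w₂ = l * (z₁ - z₂) := by
    refine mul_right_cancel₀ hU0 ?_
    linear_combination (z₂ - z₁) * hl + e₁ - e₂
  set m := w₁ - l * z₁ with hm
  have hmv : v m ≤ M ^ 3 := by
    refine v.map_sub_le hw₁ ?_
    rw [map_mul, pow_succ]
    exact mul_le_mul' hlv hz₁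
  have hl1 : v l ≤ 1 := hlv.trans (pow_le_one₀ zero_le hM.le)
  have hlb : v (β * l ^ 3) < 1 := by
    refine (map_mul_le_of_le_one hβ ?_).trans_lt (pow_lt_one₀ zero_le hM two_ne_zero)
    rw [pow_succ]
    exact map_mul_le_of_le_one (by rw [map_pow]; exact pow_le_one₀ zero_le hl1) hlv
  have hAv := Valuation.map_one_add_of_lt v hlb
  have hA : 1 + β * l ^ 3 ≠ 0 := by
    intro h0; rw [h0] at hAv; simp at hAv
  set d := (α * l ^ 2 - 3 * β * l ^ 2 * m) / (1 + β * l ^ 3) with hd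
  have hdE : ∀ E', v α * M ^ 4 ≤ E' → M ^ 7 ≤ E' → v d ≤ E' := by
    intro E' h1 h2
    rw [hd, map_div₀, hAv, div_one]
    refine v.map_sub_le (le_trans ?_ h1) (le_trans ?_ h2)
    · rw [map_mul, map_pow, show 4 = 2 * 2 from rfl, pow_mul]
      exact mul_le_mul_right (pow_le_pow_left' hlv 2) _
    · rw [mul_assoc]
      refine map_mul_le_of_le_one (map_mul_le_of_le_one three hβ) ?_
      rw [map_mul, map_pow, show 7 = 2 * 2 + 3 from rfl, pow_add, pow_mul]
      exact mul_le_mul' (pow_le_pow_left' hlv 2) hmv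
  set z₃ := d - z₁ - z₂ with hz₃
  have hz₃v : v z₃ ≤ M := by
    refine v.map_sub_le (v.map_sub_le (hdE M ?_ ?_) hz₁) hz₂
    · calc v α * M ^ 4 ≤ 1 * M ^ 4 := mul_le_mul_left hα _
        _ ≤ M := by rw [one_mul]; exact pow_le_of_le_one zero_le hM.le (by norm_num)
    · exact pow_le_of_le_one zero_le hM.le (by norm_num)
  set w₃ := l * z₃ + m with hw₃
  have hw₃v : v w₃ ≤ M ^ 3 := by
    refine v.map_add_le ?_ hmv
    rw [map_mul, pow_succ]
    exact mul_le_mul' hlv hz₃v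
  obtain ⟨h₃, hR⟩ := hP.neg_add hQ h₁ h₂ hPQ (w₃ := w₃) (z₃ := z₃) (l := l) (m := m)
    (by rw [hm]; ring) (by rw [hm]; linear_combination -hw₁₂) hw₃ hU0 hl hA
    (by
      have hd' : (1 + β * l ^ 3) * d = α * l ^ 2 - 3 * β * l ^ 2 * m := mul_div_cancel₀ _ hA
      linear_combination hd' + (1 + β * l ^ 3) * hz₃)
  have hR' : IsZW _ _ _ := .inr ⟨h₃, hR⟩
  have hw1 : v (α * w₃) < 1 := (map_mul_le_of_le_one hα hw₃v).trans_lt hM3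
  have hu : v (1 + α * w₃) = 1 := Valuation.map_one_add_of_lt v hw1
  have hu0 : 1 + α * w₃ ≠ 0 := by
    intro h0; rw [h0] at hu; simp at hu
  have := hR'.neg hu0
  rw [neg_neg] at this
  refine ⟨_, ⟨_, this, ?_, ?_⟩, ?_⟩
  · rwa [map_div₀, hu, div_one, Valuation.map_neg]
  · rwa [map_div₀, hu, div_one, Valuation.map_neg]
  · have : -z₃ / (1 + α * w₃) - (z₁ + z₂) =
        (-d - α * (w₃ * (z₁ + z₂))) / (1 + α * w₃) := by
      rw [hz₃]
      field_simp; ring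
    rw [this, map_div₀, hu, div_one]
    refine v.map_sub_le (by rw [Valuation.map_neg]; exact hdE E hE hE') (le_trans ?_ hE)
    rw [map_mul, map_mul, pow_succ]
    exact mul_le_mul_right (mul_le_mul' hw₃v (v.map_add_le hz₁ hz₂)) _

lemma Near.nsmul (hE : v (algebraMap ℚ F a) * M ^ 4 ≤ E) (hE' : M ^ 7 ≤ E)
    (hP : Near v M P z) (n : ℕ) : ∃ z', Near v M (n • P) z' ∧ v (z' - n * z) ≤ E := by
  induction n with
  | zero => exact ⟨0, by rw [zero_smul]; exact Near.zero, by simp⟩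
  | succ n ih =>
    obtain ⟨z', h1, h2⟩ := ih
    obtain ⟨z'', h3, h4⟩ := h1.add hα hM hβ hE hE' hP
    refine ⟨z'', by rwa [succ_nsmul], ?_⟩
    rw [show z'' - ((n + 1 : ℕ) : F) * z = (z'' - (z' + z)) + (z' - n * z) by push_cast; ring]
    exact v.map_add_le h4 h2

lemma Near.zsmul (hE : v (algebraMap ℚ F a) * M ^ 4 ≤ E) (hE' : M ^ 7 ≤ E)
    (hP : Near v M P z) (n : ℤ) : ∃ z', Near v M (n • P) z' ∧ v (z' - n * z) ≤ E := by
  obtain ⟨n, rfl | rfl⟩ := n.eq_nat_or_neg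
  · simpa using hP.nsmul hα hM hβ hE hE' n
  · obtain ⟨z', h1, h2⟩ := hP.nsmul hα hM hβ hE hE' n
    obtain ⟨z'', h3, h4⟩ := h1.neg hα hM hE
    refine ⟨z'', by simpa using h3, ?_⟩
    rw [show z'' - ((-(n : ℤ) : ℤ) : F) * z = (z'' + z') - (z' - n * z) by push_cast; ring]
    exact v.map_sub_le h4 h2

end cubicCurve

namespace cubicCurve
open WeierstrassCurve WeierstrassCurve.Affine

variable {F : Type*} [Field F] {a : ℚ} [Algebra ℚ F] {Γ : Type*}
  [LinearOrderedCommGroupWithZero Γ] {v : Valuation F Γ} {x η : F}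
  {P : ((cubicCurve a)⁄F).Point}

lemma lt_of_mul_self_lt {x y : Γ} (h : x * x < y * y) : x < y := by
  by_contra! hle
  exact (mul_le_mul' hle hle).not_gt h

lemma map_eta_sq (hα : v (algebraMap ℚ F a) ≤ 1) (hβ : v (coeff₆ a F) ≤ 1)
    (hP : IsPt P x η) (hx : 1 < v x) : v η ^ 2 = v x ^ 3 ∧ 1 < v η := by
  have he := eqn_iff.mp hP.eqn
  have hx3 : 1 < v x ^ 3 := one_lt_pow₀ hx (by norm_num)
  have hr : v (x ^ 3 + coeff₆ a F) = v x ^ 3 := by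
    rw [Valuation.map_add_eq_of_lt_left, map_pow]
    rw [map_pow]; exact hβ.trans_lt hx3
  have hη : 1 < v η := by
    by_contra! hle
    rw [← he] at hr
    refine (hx3.trans_eq hr.symm).not_ge (v.map_add_le ?_ (map_mul_le_of_le_one hα hle))
    rw [map_pow]; exact pow_le_one₀ zero_le hle
  refine ⟨?_, hη⟩
  rw [← hr, ← he, Valuation.map_add_eq_of_lt_left, map_pow]
  rw [map_pow, sq]
  refine (map_mul_le_of_le_one hα le_rfl).trans_lt ?_
  simpa using mul_lt_mul_of_pos_right hη (zero_lt_one.trans hη)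

lemma IsPt.near (hα : v (algebraMap ℚ F a) ≤ 1) (hβ : v (coeff₆ a F) ≤ 1)
    (hP : IsPt P x η) (hx : 1 < v x) : Near v (v (x / η)) P (x / η) ∧ v (x / η) < 1 := by
  obtain ⟨h1, h2⟩ := map_eta_sq hα hβ hP hx
  have hη : v η ≠ 0 := (zero_lt_one.trans h2).ne'
  have hx0 : v x ≠ 0 := (zero_lt_one.trans hx).ne'
  have hη0 : η ≠ 0 := by simpa using hη
  refine ⟨⟨1 / η, hP.isZW hη0, le_rfl, ?_⟩, ?_⟩
  · rw [map_div₀, map_div₀, div_pow, ← h1, map_one, div_le_div_iff₀ (zero_lt_iff.mpr hη)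
      (zero_lt_iff.mpr (pow_ne_zero 3 hη)), one_mul, ← pow_succ]
  · rw [map_div₀]
    refine lt_of_mul_self_lt ?_
    rw [← sq, div_pow, h1, mul_one, div_lt_one₀ (zero_lt_iff.mpr (pow_ne_zero 3 hx0)), pow_succ _ 2]
    exact lt_mul_of_one_lt_right (zero_lt_iff.mpr (pow_ne_zero 2 hx0)) hx

lemma Near.one_lt {M : Γ} {z : F} (h : Near v M P z) (hM : M < 1) (hP : IsPt P x η) :
    1 < v η ∧ η ≠ 0 ∧ z = x / η := by
  obtain ⟨w, ⟨-, -, rfl⟩ | ⟨h0, h⟩, hz, hw⟩ := h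
  · exact (hP.ne_zero rfl).elim
  · obtain ⟨rfl, rfl⟩ := hP.coord_eq h
    refine ⟨?_, one_div_ne_zero h0, by field_simp⟩
    rw [one_div, map_inv₀, one_lt_inv₀ (by simpa [zero_lt_iff] using h0)]
    exact hw.trans_lt (pow_lt_one₀ zero_le hM (by norm_num))

variable [DecidableEq F]

lemma eq_zero_of_three_smul {A : Type*} [AddCommGroup A] {P : A} {p : ℕ} (hp : p % 3 = 1)
    (hpP : p • P = 0) : P = -((p / 3 : ℕ) : ℤ) • (3 • P) := by
  have : p • P = (p / 3) • (3 • P) + P := by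
    conv_lhs => rw [← Nat.div_add_mod' p 3, hp, add_smul, mul_smul, one_smul]
  rw [hpP] at this
  rw [neg_smul, eq_neg_iff_add_eq_zero, add_comm]
  exact_mod_cast this.symm

lemma torsion_dichotomy {P : ((cubicCurve (-9))⁄F).Point} {p : ℕ} (hp : p % 3 = 1)
    (hpP : p • P = 0) (hP : IsPt P x η) (h3 : v 3 = 1) :
    (v x = 1 ∧ v η = 1) ∨ 1 < v x := by
  have hαe : algebraMap ℚ F (-9) = -9 := by simp
  have hβe : coeff₆ (-9) F = -27 := by
    rw [coeff₆, show (-(27 + (-9) ^ 2) / 4 : ℚ) = -27 by norm_num]; simp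
  have h9 : v 9 = 1 := by rw [show (9 : F) = 3 * 3 by norm_num, map_mul, h3, one_mul]
  have h27 : v 27 = 1 := by rw [show (27 : F) = 3 * 9 by norm_num, map_mul, h3, h9, one_mul]
  have h81 : v 81 = 1 := by rw [show (81 : F) = 9 * 9 by norm_num, map_mul, h9, one_mul]
  have h2 : v 2 ≤ 1 := by simpa using map_natCast_le_one v 2
  have h4 : v 4 ≤ 1 := by simpa using map_natCast_le_one v 4
  have hα : v (algebraMap ℚ F (-9)) ≤ 1 := by rw [hαe, Valuation.map_neg, h9]
  have hβ : v (coeff₆ (-9) F) ≤ 1 := by rw [hβe, Valuation.map_neg, h27]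
  have he := eqn_iff.mp hP.eqn
  rw [hαe, hβe] at he
  by_contra! hcon
  obtain ⟨hcon, hx⟩ := hcon
  have hη : v η ≤ 1 := by
    by_contra! hη
    have : v (η * (η - 9)) ≤ 1 := by
      rw [show η * (η - 9) = x ^ 3 - 27 by linear_combination he]
      refine v.map_sub_le ?_ h27.le
      rw [map_pow]; exact pow_le_one₀ zero_le hx
    rw [map_mul, Valuation.map_sub_eq_of_lt_left _ (by rwa [h9])] at this
    exact (one_lt_mul'' hη hη).not_ge this
  have hsmall : v (x * (27 - x ^ 3)) < 1 ∧ v (4 * x ^ 3 - 27) = 1 := by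
    have h27x : v (27 - x ^ 3) ≤ 1 := by
      refine v.map_sub_le h27.le ?_
      rw [map_pow]; exact pow_le_one₀ zero_le hx
    rcases hx.lt_or_eq with hx1 | hx1
    · refine ⟨?_, ?_⟩
      · rw [mul_comm]
        exact (map_mul_le_of_le_one h27x le_rfl).trans_lt hx1
      · rw [Valuation.map_sub_eq_of_lt_right _, h27]
        rw [h27]
        refine (map_mul_le_of_le_one h4 le_rfl).trans_lt ?_
        rw [map_pow]
        exact pow_lt_one₀ zero_le hx1 (by norm_num)
    · have hη1 := lt_of_le_of_ne hη (hcon hx1)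
      have hs : v (27 - x ^ 3) < 1 := by
        rw [show 27 - x ^ 3 = (9 - η) * η by linear_combination he]
        exact (map_mul_le_of_le_one (v.map_sub_le h9.le hη) le_rfl).trans_lt hη1
      refine ⟨(map_mul_le_of_le_one hx le_rfl).trans_lt hs, ?_⟩
      rw [show 4 * x ^ 3 - 27 = 81 - 4 * (27 - x ^ 3) by ring,
        Valuation.map_sub_eq_of_lt_left _, h81]
      rw [h81]
      exact (map_mul_le_of_le_one h4 le_rfl).trans_lt hs
  obtain ⟨hs, hD⟩ := hsmall
  have hD2 : (2 * η - 9) ^ 2 = 4 * x ^ 3 - 27 := by linear_combination 4 * he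
  have hD1 : v (2 * η - 9) = 1 := by
    rw [← hD2, map_pow] at hD
    exact (pow_eq_one_iff_of_nonneg zero_le two_ne_zero).mp hD
  have hD0 : 2 * η - 9 ≠ 0 := by
    intro h0; rw [h0] at hD1; simp at hD1
  set l := 3 * x ^ 2 / (2 * η - 9) with hl
  have hl1 : v l ≤ 1 := by
    rw [hl, map_div₀, hD1, div_one, map_mul, h3, one_mul, map_pow]
    exact pow_le_one₀ zero_le hx
  have h2P := hP.add_self (l := l) (by rw [hαe]; simpa [sub_eq_add_neg] using hD0)
    (by rw [hαe, hl, ← sub_eq_add_neg]; field_simp)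
  set x' := l ^ 2 - x - x with hx'
  rw [hαe] at h2P
  have hd : x' - x = 3 * (x * (27 - x ^ 3)) / (4 * x ^ 3 - 27) := by
    rw [hx', hl, ← hD2, eq_div_iff (pow_ne_zero 2 hD0)]
    field_simp
    linear_combination (-3 * x) * hD2
  have hdv : v (x' - x) < 1 := by
    rw [hd, map_div₀, hD, div_one, map_mul, h3, one_mul]
    exact hs
  have h3P : 3 • P ≠ 0 := by
    intro h0
    have := eq_zero_of_three_smul hp hpP
    rw [h0, smul_zero] at this
    exact hP.ne_zero this
  have hne : x ≠ x' := by
    intro h0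
    rw [← h0] at h2P
    rcases hP.eq_or_eq_neg h2P with e | e
    · exact hP.ne_zero (by simpa using e)
    · exact h3P (by rw [show (3 : ℕ) = 1 + 2 from rfl, add_smul, one_smul, two_smul];
                    nth_rewrite 1 [e]; exact neg_add_cancel _)
  have hne' : x - x' ≠ 0 := sub_ne_zero.mpr hne
  have hsum := hP.add h2P hne (l := (2 * η - 9 + l * (x' - x)) / (x - x')) (by
    rw [div_mul_cancel₀ _ hne']; ring)
  set m := (2 * η - 9 + l * (x' - x)) / (x - x') with hm
  have hmv : 1 < v m := by
    have e : v (2 * η - 9 + l * (x' - x)) = 1 := by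
      rw [Valuation.map_add_eq_of_lt_left, hD1]
      rw [hD1]
      exact (map_mul_le_of_le_one hl1 le_rfl).trans_lt hdv
    rw [hm, map_div₀, e, one_lt_div₀ (by simpa [zero_lt_iff] using hne'), Valuation.map_sub_swap]
    exact hdv
  have hx'v : v x' ≤ 1 := by
    rw [hx']
    refine v.map_sub_le (v.map_sub_le ?_ hx) hx
    rw [map_pow]; exact pow_le_one₀ zero_le hl1
  have hX : 1 < v (m ^ 2 - x - x') := by
    have hm2 : 1 < v (m ^ 2) := by rw [map_pow]; exact one_lt_pow₀ hmv two_ne_zero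
    rw [sub_sub, Valuation.map_sub_eq_of_lt_left]
    · exact hm2
    · exact (v.map_add_le hx hx'v).trans_lt hm2
  rw [show P + (P + P) = 3 • P by abel] at hsum
  obtain ⟨hN, hM⟩ := hsum.near hα hβ hX
  obtain ⟨z, hz, -⟩ := hN.zsmul hα hM hβ (E := 1)
    ((mul_le_one' hα (pow_le_one₀ zero_le hM.le))) (pow_le_one₀ zero_le hM.le) (-(p / 3 : ℕ))
  have e := eq_zero_of_three_smul hp hpP
  rw [← e] at hz
  exact (hz.one_lt hM hP).1.not_ge hη

end cubicCurve

namespace Eisenstein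
open PeriodPair cubicCurve

/-- The abscissa of the curve `η² - 9η = x³ - 27` at the parameter `u`. -/
def xc (u : ℂ) : ℂ := eisPair.px varpi1 u

/-- The ordinate of the curve `η² - 9η = x³ - 27` at the parameter `u`. -/
def ηc (u : ℂ) : ℂ := (eisPair.py varpi1 u + 9) / 2

/-- The nonzero `p`-torsion points of `ℂ / ℤ[ρ]`. -/
def IsTorsion (p : ℕ) (u : ℂ) : Prop := u ∉ O3 ∧ p * u ∈ O3

lemma ηc_sq {u : ℂ} (hu : u ∉ O3) : ηc u ^ 2 - 9 * ηc u = xc u ^ 3 - 27 := by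
  rw [← mem_lattice_iff] at hu
  have := isScaled_varpi1.py_sq hu
  rw [ηc, xc]
  linear_combination this / 4

lemma phi3_eq_div (u : ℂ) : phi3 u = 3 * xc u / ηc u := by
  rw [phi3_eq, xc, ηc, div_div_eq_mul_div, add_comm]
  ring

lemma phi3_cube {u : ℂ} (hu : u ∉ O3) (h : ηc u ≠ 0) : phi3 u ^ 3 = 1 + psi3 u ^ 3 := by
  have h1 := ηc_sq hu
  have h2 : 9 + eisPair.py varpi1 u ≠ 0 := by
    intro h0; exact h (by rw [ηc, add_comm, h0, zero_div])
  rw [phi3_eq, psi3_eq]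
  rw [ηc, xc] at h1
  field_simp
  linear_combination -216 * h1

section torsion

variable {p : ℕ} {u : ℂ}

lemma IsTorsion.mul (hu : IsTorsion p u) (hp : p % 3 = 1) {c d : ℂ} (hc : c ∈ O3)
    (hd : d ∈ O3) (hdc : d * c = 3) : IsTorsion p (c * u) := by
  refine ⟨fun h => hu.1 ?_, ?_⟩
  · have h1 : u = p * u - (p / 3 : ℕ) * (d * (c * u)) := by
      have : (p : ℂ) = (p / 3 : ℕ) * 3 + 1 := by
        exact_mod_cast (by omega : p = p / 3 * 3 + 1)
      rw [← mul_assoc d, hdc, this]; ring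
    rw [h1]
    exact sub_mem hu.2 (mul_mem (natCast_mem O3 _) (mul_mem hd h))
  · rw [mul_left_comm]; exact mul_mem hc hu.2

lemma one_sub_mem : 1 - ρ3 ∈ O3 := sub_mem (one_mem _) ρ3_mem

lemma IsTorsion.one_sub (hu : IsTorsion p u) (hp : p % 3 = 1) :
    IsTorsion p ((1 - ρ3) * u) :=
  hu.mul hp one_sub_mem (d := 1 - ρ3 ^ 2) (sub_mem (one_mem _) (pow_mem ρ3_mem 2))
    (by linear_combination ρ3_cube - ρ3_sq)

lemma IsTorsion.xc_ne_zero (hu : IsTorsion p u) (hp : p % 3 = 1) : xc u ≠ 0 := by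
  intro h0
  refine (hu.one_sub hp).1 ?_
  have h := isScaled_varpi1
  have h1 := hu.1
  rw [← mem_lattice_iff] at h1
  have h2 := h.isPt_point (a := 0) h1
  have h3 := h.isPt_point (a := 0) (mt ρ3_mul_mem_iff.mp h1)
  rw [px_ρ3_mul, py_ρ3_mul, show eisPair.px varpi1 u = 0 from h0, mul_zero] at h3
  rw [show eisPair.px varpi1 u = 0 from h0] at h2
  have := h.point_eq_iff.mp (h2.point_eq h3)
  rwa [mem_lattice_iff, ← one_sub_mul] at this

lemma IsTorsion.xc_one_sub (hu : IsTorsion p u) (hp : p % 3 = 1) :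
    xc ((1 - ρ3) * u) = ρ3 ^ 2 * (27 - xc u ^ 3) / (3 * xc u ^ 2) := by
  have h := isScaled_varpi1
  have h0 := hu.xc_ne_zero hp
  have h1 := hu.1
  have h4 := (hu.one_sub hp).1
  rw [← mem_lattice_iff] at h1 h4
  have h2 := h.isPt_point (a := 0) h1
  have h3 := (h.isPt_point (a := 0) (mt ρ3_mul_mem_iff.mp h1)).neg
  have h5 := h.isPt_point (a := 0) h4
  rw [px_ρ3_mul, py_ρ3_mul] at h3
  rw [one_sub_mul ρ3 u, h.point_sub, sub_eq_add_neg, ← one_sub_mul ρ3 u] at h5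
  have hρ : 1 - ρ3 ≠ 0 := sub_ne_zero.mpr ρ3_ne_one.symm
  set y := eisPair.py varpi1 u
  have hy : y ^ 2 = 4 * xc u ^ 3 - 27 := h.py_sq h1
  change IsPt _ (xc u) _ at h2
  change IsPt _ (ρ3 * xc u) _ at h3
  have h6 := h2.add h3 (l := y / ((1 - ρ3) * xc u)) (fun e => by
      apply mul_ne_zero hρ h0; linear_combination e) (by
      rw [div_mul_eq_mul_div, div_eq_iff (mul_ne_zero hρ h0), map_zero]
      push_cast; ring)
  change IsPt _ (xc _) _ at h5
  rw [(h5.coord_eq h6).1, eq_div_iff (by simpa using h0)]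
  have hρ2 : (1 - ρ3) ^ 2 = -3 * ρ3 := by linear_combination ρ3_sq
  rw [div_pow, mul_pow, hρ2, hy]
  have := ρ3_ne_zero
  field_simp
  linear_combination (-3 * xc u ^ 3) * ρ3_sq + (xc u ^ 3 - 27) * ρ3_cube

lemma IsTorsion.one_sub_pow (hu : IsTorsion p u) (hp : p % 3 = 1) (n : ℕ) :
    IsTorsion p ((1 - ρ3) ^ n * u) := by
  induction n with
  | zero => simpa
  | succ n ih => rw [pow_succ', mul_assoc]; exact ih.one_sub hp

lemma xc_add_of_mem {w : ℂ} (hw : w ∈ O3) : xc (u + w) = xc u := by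
  rw [← mem_lattice_iff] at hw
  exact px_add_of_mem hw

lemma IsTorsion.xc_one_sub_pow (hu : IsTorsion p u) (hp : p.Prime) (hp3 : p % 3 = 1) :
    xc ((1 - ρ3) ^ (6 * (p - 1)) * u) = xc u := by
  have h6 : (1 - ρ3) ^ 6 = -27 := by
    have hρ2 : (1 - ρ3) ^ 2 = -3 * ρ3 := by linear_combination ρ3_sq
    rw [show 6 = 2 * 3 from rfl, pow_mul, hρ2, mul_pow, ρ3_cube]; norm_num
  have hcop : IsCoprime (-27 : ℤ) p := by
    rw [show (-27 : ℤ) = -(3 ^ 3) by norm_num, IsCoprime.neg_left_iff]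
    refine IsCoprime.pow_left ?_
    rw [Int.isCoprime_iff_gcd_eq_one]
    have : Nat.Coprime 3 p := (Nat.coprime_primes Nat.prime_three hp).mpr (by omega)
    exact_mod_cast this
  obtain ⟨k, hk⟩ := (Int.ModEq.pow_card_sub_one_eq_one hp hcop).symm.dvd
  have e : (1 - ρ3) ^ (6 * (p - 1)) * u = u + k * (p * u) := by
    rw [pow_mul, h6]
    have : ((-27 : ℤ) : ℂ) ^ (p - 1) - 1 = p * k := by exact_mod_cast hk
    push_cast at this
    linear_combination u * this
  rw [e, xc_add_of_mem (mul_mem (intCast_mem O3 k) hu.2)]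

variable {Γ : Type*} [LinearOrderedCommGroupWithZero Γ] {v : Valuation ℂ Γ}

lemma map_ρ3 : v ρ3 = 1 := by
  have := congrArg v ρ3_cube
  rw [map_pow, map_one] at this
  exact (pow_eq_one_iff_of_nonneg zero_le three_ne_zero).mp this

lemma map_three_pos : 0 < v 3 := zero_lt_iff.mpr (by simp)

lemma map_27 : v 27 = v 3 ^ 3 := by rw [← map_pow]; norm_num

lemma map_xc_one_sub (hu : IsTorsion p u) (hp : p % 3 = 1) :
    v (xc ((1 - ρ3) * u)) * (v 3 * v (xc u) ^ 2) = v (27 - xc u ^ 3) := by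
  have h0 := hu.xc_ne_zero hp
  have h1 : xc ((1 - ρ3) * u) * (3 * xc u ^ 2) = ρ3 ^ 2 * (27 - xc u ^ 3) := by
    rw [hu.xc_one_sub hp]; field_simp
  have := congrArg v h1
  simpa [map_ρ3] using this

lemma map_xc_lt (h3 : v 3 < 1) (hu : IsTorsion p u) (hp : p % 3 = 1) (hx : v 3 < v (xc u)) :
    v (xc u) < v (xc ((1 - ρ3) * u)) := by
  have h1 := map_xc_one_sub (v := v) hu hp
  have h27 : v 27 < v (xc u ^ 3) := by
    rw [map_27, map_pow]
    exact pow_lt_pow_left₀ hx zero_le three_ne_zero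
  rw [Valuation.map_sub_eq_of_lt_right _ h27, map_pow, pow_succ' _ 2, ← mul_assoc] at h1
  have hpos : 0 < v (xc u) := map_three_pos.trans hx
  have h2 := mul_right_cancel₀ (pow_ne_zero 2 hpos.ne') h1
  rw [← h2]
  exact mul_lt_of_lt_one_right (zero_lt_iff.mpr fun h => by simp [h] at h2; simp [h2] at hpos) h3

lemma map_xc_le (hp : p.Prime) (hp3 : p % 3 = 1) (h3 : v 3 < 1) (hu : IsTorsion p u) :
    v (xc u) ≤ v 3 := by
  by_contra! hx
  have key : ∀ n : ℕ, v (xc u) < v (xc ((1 - ρ3) ^ (n + 1) * u)) := by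
    intro n
    induction n with
    | zero => simpa using map_xc_lt h3 hu hp3 hx
    | succ n ih =>
      refine ih.trans ?_
      rw [pow_succ' _ (n + 1), mul_assoc]
      exact map_xc_lt h3 (hu.one_sub_pow hp3 _) hp3 (hx.trans ih)
  have := key (6 * (p - 1) - 1)
  rw [Nat.sub_add_cancel (by have := hp.two_le; omega), hu.xc_one_sub_pow hp hp3] at this
  exact this.false

lemma map_xc_eq (hp : p.Prime) (hp3 : p % 3 = 1) (h3 : v 3 < 1) (hu : IsTorsion p u) :
    v (xc u) = v 3 := by
  refine (map_xc_le hp hp3 h3 hu).antisymm ?_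
  by_contra! hx
  have h1 := map_xc_one_sub (v := v) hu hp3
  have hle := map_xc_le hp hp3 h3 (hu.one_sub hp3)
  rw [Valuation.map_sub_eq_of_lt_left, map_27] at h1
  · have h2 : v (xc ((1 - ρ3) * u)) * (v 3 * v (xc u) ^ 2) ≤ v 3 * (v 3 * v (xc u) ^ 2) :=
      mul_le_mul_left hle _
    rw [h1, pow_succ', mul_le_mul_iff_right₀ map_three_pos, sq] at h2
    have h4 := (mul_le_of_le_one_left' h3.le : v 3 * v (xc u) ^ 2 ≤ v (xc u) ^ 2)
    have h5 : v (xc u) ^ 2 < v 3 ^ 2 := pow_lt_pow_left₀ hx zero_le two_ne_zero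
    rw [sq (v 3)] at h5
    exact (h2.trans h4).not_gt h5
  · rw [map_27, map_pow]
    exact pow_lt_pow_left₀ hx zero_le three_ne_zero

lemma map_ηc_eq (hp : p.Prime) (hp3 : p % 3 = 1) (h3 : v 3 < 1) (hu : IsTorsion p u) :
    v (ηc u) = v 3 ^ 2 := by
  have h1 := map_xc_one_sub (v := v) hu hp3
  rw [map_xc_eq hp hp3 h3 (hu.one_sub hp3), map_xc_eq hp hp3 h3 hu] at h1
  have h2 : v (ηc u) * v (ηc u - 9) = v 9 * v 9 := by
    rw [← map_mul, show ηc u * (ηc u - 9) = -(27 - xc u ^ 3) by linear_combination ηc_sq hu.1,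
      Valuation.map_neg, ← h1, show (9 : ℂ) = 3 * 3 by norm_num, map_mul]
    simp only [sq, mul_assoc]
  rw [sq, ← map_mul]
  norm_num
  have h9 : 0 < v 9 := zero_lt_iff.mpr (by simp)
  rcases lt_trichotomy (v (ηc u)) (v 9) with h | h | h
  · rw [Valuation.map_sub_eq_of_lt_right _ h] at h2
    exact mul_right_cancel₀ h9.ne' h2
  · exact h
  · rw [Valuation.map_sub_eq_of_lt_left _ h] at h2
    exact ((mul_lt_mul'' h h zero_le zero_le).ne' h2).elim

lemma map_phi3_of_lt (hp : p.Prime) (hp3 : p % 3 = 1) (h3 : v 3 < 1) (hu : IsTorsion p u) :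
    v (phi3 u) = 1 := by
  rw [phi3_eq_div, map_div₀, map_mul, map_xc_eq hp hp3 h3 hu, map_ηc_eq hp hp3 h3 hu, ← sq,
    div_self (pow_ne_zero 2 map_three_pos.ne')]

end torsion
end Eisenstein

namespace Eisenstein
open PeriodPair cubicCurve

variable {p : ℕ} {u : ℂ} {Γ : Type*} [LinearOrderedCommGroupWithZero Γ] {v : Valuation ℂ Γ}

lemma isPt_point (hu : u ∉ O3) : IsPt (eisPair.point varpi1 (-9) u) (xc u) (ηc u) := by
  rw [← mem_lattice_iff] at hu
  have := isScaled_varpi1.isPt_point (a := -9) hu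
  rwa [show (eisPair.py varpi1 u - ((-9 : ℚ) : ℂ)) / 2 = ηc u by rw [ηc]; push_cast; ring] at this

lemma isPt_point_zero (hu : u ∉ O3) :
    IsPt (eisPair.point varpi1 0 u) (xc u) (ηc u - 9 / 2) := by
  rw [← mem_lattice_iff] at hu
  have := isScaled_varpi1.isPt_point (a := 0) hu
  rwa [show (eisPair.py varpi1 u - ((0 : ℚ) : ℂ)) / 2 = ηc u - 9 / 2 by
    rw [ηc]; push_cast; ring] at this

lemma point_nsmul (a : ℚ) (n : ℕ) (u : ℂ) :
    eisPair.point varpi1 a (n * u) = n • eisPair.point varpi1 a u := by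
  have := isScaled_varpi1.point_zsmul (a := a) (u := u) n
  simpa using this

lemma IsTorsion.nsmul_eq_zero (hu : IsTorsion p u) (a : ℚ) :
    p • eisPair.point varpi1 a u = 0 := by
  rw [← point_nsmul]
  exact point_of_mem (mem_lattice_iff.mpr hu.2)

lemma coeff₆_neg_nine : coeff₆ (-9) ℂ = -27 := by
  rw [coeff₆, show (-(27 + (-9) ^ 2) / 4 : ℚ) = -27 by norm_num]; simp

lemma coeff₆_zero : coeff₆ 0 ℂ = -27 / 4 := by
  rw [coeff₆]; norm_num

lemma map_three_le_one : v 3 ≤ 1 := by simpa using map_natCast_le_one v 3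

lemma map_neg_nine_le_one : v (algebraMap ℚ ℂ (-9)) ≤ 1 := by
  simpa using map_intCast_le_one v (-9)

lemma map_coeff₆_neg_nine_le_one : v (coeff₆ (-9) ℂ) ≤ 1 := by
  simpa [coeff₆_neg_nine] using map_intCast_le_one v (-27)

lemma phi3_dichotomy (hp : p.Prime) (hp3 : p % 3 = 1) (hu : IsTorsion p u) :
    (v (phi3 u) = 1 ∧ ηc u ≠ 0) ∨ (v 3 = 1 ∧ 1 < v (xc u)) := by
  rcases (map_three_le_one (v := v)).lt_or_eq with h3 | h3
  · refine .inl ⟨map_phi3_of_lt hp hp3 h3 hu, fun h0 => ?_⟩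
    have := map_ηc_eq (v := v) hp hp3 h3 hu
    rw [h0, map_zero] at this
    exact (pow_ne_zero 2 map_three_pos.ne') this.symm
  · rcases torsion_dichotomy hp3 (hu.nsmul_eq_zero (-9)) (isPt_point hu.1) h3 with ⟨h1, h2⟩ | h
    · refine .inl ⟨by rw [phi3_eq_div, map_div₀, map_mul, h1, h2, h3, mul_one, div_one], ?_⟩
      intro h0; simp [h0] at h2
    · exact .inr ⟨h3, h⟩

lemma map_phi3_of_eq (h3 : v 3 = 1) : v (phi3 u) = v (xc u / ηc u) := by
  rw [phi3_eq_div, mul_div_assoc, map_mul, h3, one_mul]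

lemma near_phi3 (hu : u ∉ O3) (h3 : v 3 = 1) (hx : 1 < v (xc u)) :
    Near v (v (phi3 u)) (eisPair.point varpi1 (-9) u) (xc u / ηc u) ∧ v (phi3 u) < 1 := by
  rw [map_phi3_of_eq h3]
  exact (isPt_point hu).near map_neg_nine_le_one map_coeff₆_neg_nine_le_one hx

lemma map_phi3_le_one (hp : p.Prime) (hp3 : p % 3 = 1) (hu : IsTorsion p u) :
    v (phi3 u) ≤ 1 := by
  rcases phi3_dichotomy (v := v) hp hp3 hu with ⟨h, -⟩ | ⟨h3, hx⟩
  · exact h.le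
  · exact (near_phi3 hu.1 h3 hx).2.le

lemma ηc_ne_zero (hp : p.Prime) (hp3 : p % 3 = 1) (hu : IsTorsion p u) : ηc u ≠ 0 := by
  intro h0
  rcases phi3_dichotomy (v := (⊤ : ValuationSubring ℂ).valuation) hp hp3 hu with ⟨-, h⟩ | ⟨-, hx⟩
  · exact h h0
  · exact hx.not_ge (by rw [ValuationSubring.valuation_le_one_iff]; trivial)

lemma phi3_ne_zero (hp : p.Prime) (hp3 : p % 3 = 1) (hu : IsTorsion p u) : phi3 u ≠ 0 := by
  rw [phi3_eq_div]
  exact div_ne_zero (mul_ne_zero three_ne_zero (hu.xc_ne_zero hp3)) (ηc_ne_zero hp hp3 hu)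

lemma map_psi3_le_one (hp : p.Prime) (hp3 : p % 3 = 1) (hu : IsTorsion p u) :
    v (psi3 u) ≤ 1 := by
  have h1 := phi3_cube hu.1 (ηc_ne_zero hp hp3 hu)
  have h2 : v (psi3 u ^ 3) ≤ 1 := by
    rw [show psi3 u ^ 3 = phi3 u ^ 3 - 1 by rw [h1]; ring]
    refine v.map_sub_le ?_ v.map_one.le
    rw [map_pow]
    exact pow_le_one₀ zero_le (map_phi3_le_one hp hp3 hu)
  rw [map_pow] at h2
  exact (pow_le_one_iff_of_nonneg zero_le three_ne_zero).mp h2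

lemma map_phi3_mul_le (hp : p.Prime) (hp3 : p % 3 = 1) (hu : IsTorsion p u) {r : ℕ}
    (hr : IsTorsion p (r * u)) : v (phi3 (r * u)) ≤ v (phi3 u) := by
  rcases phi3_dichotomy (v := v) hp hp3 hu with ⟨h, -⟩ | ⟨h3, hx⟩
  · exact (map_phi3_le_one hp hp3 hr).trans_eq h.symm
  · obtain ⟨hN, hM⟩ := near_phi3 hu.1 h3 hx
    obtain ⟨z, hz, -⟩ := hN.nsmul map_neg_nine_le_one hM map_coeff₆_neg_nine_le_one (E := 1)
      (mul_le_one' map_neg_nine_le_one (pow_le_one₀ zero_le hM.le)) (pow_le_one₀ zero_le hM.le) r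
    rw [← point_nsmul] at hz
    rw [map_phi3_of_eq h3, ← (hz.one_lt hM (isPt_point hr.1)).2.2]
    exact hz.choose_spec.2.1

lemma IsTorsion.natCast_mul (hu : IsTorsion p u) (hp : p.Prime) {r : ℕ} (hr : ¬ p ∣ r) :
    IsTorsion p (r * u) ∧ ∃ s : ℕ, ∃ w ∈ O3, s * (r * u) = u + w := by
  have hc : Nat.Coprime r p := ((Nat.Prime.coprime_iff_not_dvd hp).mpr hr).symm
  obtain ⟨s, -, hs⟩ := Nat.exists_mul_mod_eq_one_of_coprime hc hp.one_lt
  have e : (s : ℂ) * (r * u) = u + (r * s / p : ℕ) * (p * u) := by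
    have : (r * s : ℂ) = 1 + p * (r * s / p : ℕ) := by
      have := Nat.mod_add_div (r * s) p
      rw [hs] at this
      exact_mod_cast this.symm
    linear_combination u * this
  have hw : ((r * s / p : ℕ) : ℂ) * (p * u) ∈ O3 := mul_mem (natCast_mem O3 _) hu.2
  refine ⟨⟨fun h => hu.1 ?_, ?_⟩, s, _, hw, e⟩
  · have := sub_mem (mul_mem (natCast_mem O3 s) h) hw
    rwa [e, add_sub_cancel_right] at this
  · rw [mul_left_comm]; exact mul_mem (natCast_mem O3 r) hu.2

lemma map_phi3_mul_eq (hp : p.Prime) (hp3 : p % 3 = 1) (hu : IsTorsion p u) {r : ℕ}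
    (hr : ¬ p ∣ r) : v (phi3 (r * u)) = v (phi3 u) := by
  obtain ⟨hr, s, w, hw, e⟩ := hu.natCast_mul hp hr
  refine (map_phi3_mul_le hp hp3 hu hr).antisymm ?_
  have := phi3_add_of_mem (u := u) hw
  rw [← this, ← e]
  refine map_phi3_mul_le hp hp3 hr ?_
  rw [e]
  refine ⟨fun h => hu.1 ?_, ?_⟩
  · simpa using sub_mem h hw
  · rw [mul_add]; exact add_mem hu.2 (mul_mem (natCast_mem O3 p) hw)

/-- The estimate at a place where the torsion point `u` reduces to the origin. -/
lemma map_le_phi3_pow (hp : p.Prime) (hp3 : p % 3 = 1) (hu : IsTorsion p u)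
    (h1 : v (phi3 u) ≠ 1) {π : ℂ} (hπ : π ∈ O3) (hπu : π * u ∈ O3) :
    v π ≤ v (phi3 u) ^ 6 := by
  obtain ⟨h, -⟩ | ⟨h3, hx⟩ := phi3_dichotomy (v := v) hp hp3 hu
  · exact (h1 h).elim
  obtain ⟨hN, hM⟩ := near_phi3 hu.1 h3 hx
  have hM0 : 0 < v (phi3 u) := zero_lt_iff.mpr (by simpa using phi3_ne_zero hp hp3 hu)
  have hM7 {m n : ℕ} (hmn : m ≤ n) : v (phi3 u) ^ n ≤ v (phi3 u) ^ m :=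
    pow_le_pow_right_of_le_one' hM.le hmn
  have hzM : v (xc u / ηc u) = v (phi3 u) := (map_phi3_of_eq h3).symm
  have hvp : v p < 1 := by
    obtain ⟨z, hz, hz'⟩ := hN.nsmul map_neg_nine_le_one hM map_coeff₆_neg_nine_le_one
      (E := v (phi3 u) ^ 4) (mul_le_of_le_one_left' map_neg_nine_le_one) (hM7 (by norm_num)) p
    rw [hu.nsmul_eq_zero] at hz
    rw [← Near.zero.coord_eq hz, zero_sub, Valuation.map_neg, map_mul, hzM, pow_succ,
      mul_le_mul_iff_left₀ hM0] at hz'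
    exact hz'.trans_lt (pow_lt_one₀ zero_le hM three_ne_zero)
  have h2 : v 2 = 1 := by
    refine (by simpa using map_natCast_le_one v 2 : v 2 ≤ 1).antisymm ?_
    by_contra! h2
    have hodd : p % 2 = 1 := hp.eq_two_or_odd.resolve_left (by rintro rfl; omega)
    have e : (1 : ℂ) = p - (p / 2 : ℕ) * 2 := by
      rw [eq_sub_iff_add_eq]; exact_mod_cast (by omega : 1 + p / 2 * 2 = p)
    have : v 1 < 1 := by
      rw [e]
      exact v.map_sub_lt hvp ((map_mul_le_of_le_one (map_natCast_le_one v _) le_rfl).trans_lt h2)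
    exact this.ne v.map_one
  have hα : v (algebraMap ℚ ℂ 0) ≤ 1 := by simp
  have hα' : v (algebraMap ℚ ℂ 0) * v (phi3 u) ^ 4 ≤ v (phi3 u) ^ 7 := by simp
  have hβ : v (coeff₆ 0 ℂ) ≤ 1 := by
    rw [coeff₆_zero, map_div₀, Valuation.map_neg, map_27, h3,
      show (4 : ℂ) = 2 * 2 by norm_num, map_mul, h2]
    simp
  have hη0 : v (ηc u - 9 / 2) = v (ηc u) := by
    have e1 := (map_eta_sq map_neg_nine_le_one map_coeff₆_neg_nine_le_one (isPt_point hu.1) hx).1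
    have e2 := (map_eta_sq hα hβ (isPt_point_zero hu.1) hx).1
    rw [← e1] at e2
    exact (pow_left_inj₀ zero_le zero_le two_ne_zero).mp e2
  have near {w : ℂ} (hw : w ∉ O3) (hx' : v (xc w) = v (xc u)) (hη : ηc w = ηc u) :
      Near v (v (phi3 u)) (eisPair.point varpi1 0 w) (xc w / (ηc u - 9 / 2)) := by
    have hNw := ((isPt_point_zero hw).near hα hβ (hx'.symm ▸ hx)).1
    rwa [hη, map_div₀, hx', hη0, ← map_div₀, hzM] at hNw
  have hρu : ρ3 * u ∉ O3 := by rw [← mem_lattice_iff, ρ3_mul_mem_iff, mem_lattice_iff]; exact hu.1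
  have hxρ : xc (ρ3 * u) = ρ3 * xc u := px_ρ3_mul u
  have hN1 := near hu.1 rfl rfl
  have hN2 := near hρu (by rw [hxρ, map_mul, map_ρ3, one_mul]) (by rw [ηc, py_ρ3_mul, ηc])
  obtain ⟨a, b, rfl⟩ := mem_O3_iff.mp hπ
  obtain ⟨z₁, hz₁, h₁⟩ := hN1.zsmul hα hM hβ hα' le_rfl a
  obtain ⟨z₂, hz₂, h₂⟩ := hN2.zsmul hα hM hβ hα' le_rfl b
  obtain ⟨z, hz, h⟩ := hz₁.add hα hM hβ hα' le_rfl hz₂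
  rw [← isScaled_varpi1.point_zsmul, ← isScaled_varpi1.point_zsmul, ← isScaled_varpi1.point_add,
    point_of_mem (by rw [mem_lattice_iff]; convert hπu using 1; ring)] at hz
  rw [← Near.zero.coord_eq hz] at h
  have key : v ((a + b * ρ3) * (xc u / (ηc u - 9 / 2))) ≤ v (phi3 u) ^ 7 := by
    rw [show (a + b * ρ3) * (xc u / (ηc u - 9 / 2)) = -((z₁ - a * (xc u / (ηc u - 9 / 2))) +
      (z₂ - b * (xc (ρ3 * u) / (ηc u - 9 / 2))) + (0 - (z₁ + z₂))) by rw [hxρ]; ring,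
      Valuation.map_neg]
    exact v.map_add_le (v.map_add_le h₁ h₂) h
  rwa [map_mul, map_div₀, hη0, ← map_div₀, hzM, pow_succ, mul_le_mul_iff_left₀ hM0] at key


lemma isIntegral_of_forall_mem {x : ℂ}
    (h : ∀ V : ValuationSubring ℂ, V.valuation x ≤ 1) : IsIntegral ℤ x := by
  by_contra hx
  obtain ⟨V, -, hV⟩ := Subring.exists_le_valuationSubring_of_isIntegrallyClosedIn
    (R := (integralClosure ℤ ℂ).toSubring) (x := x) hx
  exact hV ((V.valuation_le_one_iff x).mp (h V))

lemma isIntegral_ρ3 : IsIntegral ℤ ρ3 :=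
  ⟨Polynomial.X ^ 3 - 1, Polynomial.monic_X_pow_sub_C 1 three_ne_zero, by simp [ρ3_cube]⟩

lemma isIntegral_of_mem_O3 {z : ℂ} (hz : z ∈ O3) : IsIntegral ℤ z := by
  obtain ⟨a, b, rfl⟩ := mem_O3_iff.mp hz
  exact (isIntegral_algebraMap (x := a)).add ((isIntegral_algebraMap (x := b)).mul isIntegral_ρ3)

lemma exists_int_of_isIntegral {q : ℚ} (h : IsIntegral ℤ (q : ℂ)) : ∃ n : ℤ, q = n := by
  have : IsIntegral ℤ q :=
    (isIntegral_algHom_iff (Algebra.ofId ℚ ℂ |>.restrictScalars ℤ)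
      (algebraMap ℚ ℂ).injective).mp (by simpa using h)
  obtain ⟨n, hn⟩ := IsIntegrallyClosed.isIntegral_iff.mp this
  exact ⟨n, by simpa using hn.symm⟩

lemma mem_O3_of_isIntegral {a b : ℚ} (h : IsIntegral ℤ (a + b * ρ3 : ℂ)) :
    (a + b * ρ3 : ℂ) ∈ O3 := by
  have hc : IsIntegral ℤ (a + b * (-1 - ρ3) : ℂ) := by
    have := h.map ((starRingEnd ℂ).toIntAlgHom)
    simpa [conj_ρ3] using this
  have hρ' : IsIntegral ℤ (-1 - ρ3) := by
    rw [← ρ3_sq]; exact isIntegral_ρ3.pow 2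
  obtain ⟨m, hm⟩ := exists_int_of_isIntegral (q := 2 * a - b) (by
    have e : ((2 * a - b : ℚ) : ℂ) = (a + b * ρ3) + (a + b * (-1 - ρ3)) := by push_cast; ring
    rw [e]
    exact h.add hc)
  obtain ⟨n, hn⟩ := exists_int_of_isIntegral (q := a + b) (by
    have e : ((a + b : ℚ) : ℂ) =
        -((a + b * ρ3) * ρ3 + (a + b * (-1 - ρ3)) * (-1 - ρ3)) := by
      push_cast; linear_combination (2 * b : ℂ) * ρ3_sq
    rw [e]
    exact ((h.mul isIntegral_ρ3).add (hc.mul hρ')).neg)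
  obtain ⟨k, hk⟩ := exists_int_of_isIntegral (q := a ^ 2 - a * b + b ^ 2) (by
    have e : ((a ^ 2 - a * b + b ^ 2 : ℚ) : ℂ) = (a + b * ρ3) * (a + b * (-1 - ρ3)) := by
      push_cast; linear_combination (b ^ 2 : ℂ) * ρ3_sq
    rw [e]
    exact h.mul hc)
  have ha : a = (m + n) / 3 := by linear_combination (hm + hn) / 3
  have hb : b = (2 * n - m) / 3 := by linear_combination (2 * hn - hm) / 3
  have h9 : (m + n) ^ 2 - (m + n) * (2 * n - m) + (2 * n - m) ^ 2 = 9 * k := by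
    rw [ha, hb] at hk
    have : ((m + n) ^ 2 - (m + n) * (2 * n - m) + (2 * n - m) ^ 2 : ℚ) = 9 * k := by
      linear_combination 9 * hk
    exact_mod_cast this
  have h3 : (3 : ℤ) ∣ m + n := by
    have h3 : (3 : ℤ) ∣ (m + n) * (m + n) := ⟨n * (m + n) - n ^ 2 + k, by linarith⟩
    exact (Int.prime_three.dvd_mul.mp h3).elim id id
  obtain ⟨c, hc⟩ := h3
  refine mem_O3_iff.mpr ⟨c, n - c, ?_⟩
  have ha' : a = c := by
    rw [ha, div_eq_iff three_ne_zero, mul_comm]; exact_mod_cast hc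
  have hb' : b = n - c := by rw [← hn, ha']; ring
  rw [ha', hb']; push_cast; ring

/-- `π` generates a prime ideal of `ℤ[ρ]` of prime norm `p`. -/
structure IsSplitPrime (p : ℕ) (π : ℂ) : Prop where
  prime : p.Prime
  mod_three : p % 3 = 1
  mem : π ∈ O3
  norm_eq : (p : ℂ) = π * (starRingEnd ℂ) π

namespace IsSplitPrime

variable {p : ℕ} {π : ℂ} (h : IsSplitPrime p π)
include h

lemma conj_mem : (starRingEnd ℂ) π ∈ O3 := by
  rw [← mem_lattice_iff]; exact Eisenstein.conj_mem (mem_lattice_iff.mpr h.mem)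

lemma ne_zero : π ≠ 0 := by
  rintro rfl
  have := h.norm_eq
  rw [zero_mul] at this
  exact h.prime.ne_zero (by exact_mod_cast this)

lemma natCast_div_mem : (p : ℂ) / π ∈ O3 := by
  rw [h.norm_eq, mul_div_cancel_left₀ _ h.ne_zero]; exact h.conj_mem

lemma inv_notMem : 1 / π ∉ O3 := by
  intro h1
  have h2 : (starRingEnd ℂ) (1 / π) ∈ O3 := by
    rw [← mem_lattice_iff]; exact Eisenstein.conj_mem (mem_lattice_iff.mpr h1)
  have h3 := mul_mem h1 h2
  rw [map_div₀, map_one, div_mul_div_comm, one_mul, ← h.norm_eq, ← mem_lattice_iff] at h3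
  have hp : (1 : ℝ) < p := by exact_mod_cast h.prime.one_lt
  refine ofReal_notMem (t := 1 / p) (by positivity) ?_ (by simpa using h3)
  rwa [div_lt_one (by linarith)]

lemma isTorsion : IsTorsion p (1 / π) :=
  ⟨h.inv_notMem, by rw [mul_one_div]; exact h.natCast_div_mem⟩

lemma exists_mul_add {k : ℤ} (hk : ¬ (p : ℤ) ∣ k) : ∃ s t : ℤ, s * k + t * p = 1 := by
  have : IsCoprime (p : ℤ) k :=
    (Nat.prime_iff_prime_int.mp h.prime).coprime_iff_not_dvd.mpr hk
  exact this.symm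

lemma intCast_div_mem_iff {k : ℤ} : (k : ℂ) / π ∈ O3 ↔ (p : ℤ) ∣ k := by
  constructor
  · intro hk
    by_contra hpk
    obtain ⟨s, t, hst⟩ := h.exists_mul_add hpk
    refine h.inv_notMem ?_
    have : (1 : ℂ) / π = s * (k / π) + t * (p / π) := by
      rw [mul_div_assoc', mul_div_assoc', ← add_div]; congr 1; exact_mod_cast hst.symm
    rw [this]
    exact add_mem (mul_mem (intCast_mem O3 s) hk) (mul_mem (intCast_mem O3 t) h.natCast_div_mem)
  · rintro ⟨c, rfl⟩
    push_cast
    rw [mul_div_right_comm]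
    exact mul_mem h.natCast_div_mem (intCast_mem O3 c)

lemma three_div_notMem : (3 : ℂ) / π ∉ O3 := by
  have := h.intCast_div_mem_iff (k := 3)
  push_cast at this
  rw [this]
  intro hd
  have := Nat.le_of_dvd (by norm_num) (by exact_mod_cast hd : p ∣ 3)
  have := h.mod_three
  have := h.prime.two_le
  interval_cases p <;> omega

lemma exists_natCast_congr {z : ℂ} (hz : z ∈ O3) : ∃ m : ℕ, ∃ w ∈ O3, z = m + π * w := by
  suffices hint : ∃ n : ℤ, ∃ w ∈ O3, z = n + π * w by
    obtain ⟨n, w, hw, rfl⟩ := hint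
    have hp : (0 : ℤ) < p := by exact_mod_cast h.prime.pos
    refine ⟨(n % p).toNat, w + (n / p : ℤ) * (p / π),
      add_mem hw (mul_mem (intCast_mem O3 _) h.natCast_div_mem), ?_⟩
    have e : (((n % p).toNat : ℤ) : ℂ) = n - p * (n / p : ℤ) := by
      rw [Int.toNat_of_nonneg (Int.emod_nonneg _ hp.ne'), Int.emod_def]; push_cast; rfl
    rw [Int.cast_natCast] at e
    rw [e, mul_add, mul_left_comm, mul_div_cancel₀ _ h.ne_zero]
    ring
  obtain ⟨a, b, hab⟩ := mem_O3_iff.mp h.mem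
  obtain ⟨c, d, rfl⟩ := mem_O3_iff.mp hz
  have hn : (p : ℤ) = a * a - a * b + b * b := by
    have := h.norm_eq
    rw [hab, map_add, map_mul, conj_ρ3] at this
    simp only [map_intCast] at this
    have : (p : ℂ) = a * a - a * b + b * b := by
      rw [this]; linear_combination (-b ^ 2 : ℂ) * ρ3_sq
    exact_mod_cast this
  have hpb : ¬ (p : ℤ) ∣ b := by
    intro hb
    have hpr := Nat.prime_iff_prime_int.mp h.prime
    have ha : (p : ℤ) ∣ a * a := by
      rw [show a * a = p + (a - b) * b by rw [hn]; ring]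
      exact dvd_add dvd_rfl (dvd_mul_of_dvd_right hb _)
    have ha : (p : ℤ) ∣ a := (hpr.dvd_mul.mp ha).elim id id
    have hpp : (p : ℤ) * p ∣ p * 1 := by
      rw [mul_one]
      nth_rewrite 3 [hn]
      exact dvd_add (dvd_sub (mul_dvd_mul ha ha) (mul_dvd_mul ha hb)) (mul_dvd_mul hb hb)
    exact hpr.not_dvd_one ((mul_dvd_mul_iff_left hpr.ne_zero).mp hpp)
  obtain ⟨s, t, hst⟩ := h.exists_mul_add hpb
  have hst' : (s * b + t * p : ℂ) = 1 := by exact_mod_cast hst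
  refine ⟨c - d * s * a, d * s + d * t * (p / π) * ρ3, add_mem ?_ (mul_mem (mul_mem ?_
    h.natCast_div_mem) ρ3_mem), ?_⟩
  · exact_mod_cast intCast_mem O3 (d * s)
  · exact_mod_cast intCast_mem O3 (d * t)
  · have h0 := h.ne_zero
    have e : π * (d * s + d * t * (p / π) * ρ3) = d * s * π + d * t * p * ρ3 := by
      field_simp
    rw [e]
    push_cast
    linear_combination (-d * ρ3) * hst' - d * s * hab

lemma div_mem_of_sq {z : ℂ} (hz : z ∈ O3) (hz2 : z ^ 2 / π ∈ O3) : z / π ∈ O3 := by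
  obtain ⟨m, w, hw, rfl⟩ := h.exists_natCast_congr hz
  have h0 := h.ne_zero
  have hm : ((m ^ 2 : ℤ) : ℂ) / π ∈ O3 := by
    have e : ((m ^ 2 : ℤ) : ℂ) / π = (m + π * w) ^ 2 / π - (2 * m * w + π * w * w) := by
      push_cast; field_simp; ring
    rw [e]
    refine sub_mem hz2 (add_mem (mul_mem (mul_mem ?_ (natCast_mem O3 m)) hw)
      (mul_mem (mul_mem h.mem hw) hw))
    exact_mod_cast natCast_mem O3 2
  rw [h.intCast_div_mem_iff] at hm
  have hm' : (p : ℤ) ∣ m := (Nat.prime_iff_prime_int.mp h.prime).dvd_of_dvd_pow hm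
  have := h.intCast_div_mem_iff.mpr hm'
  rw [add_div, mul_div_cancel_left₀ _ h0]
  exact add_mem (by simpa using this) hw

end IsSplitPrime


lemma exists_sum_eq_three_mul {α : Type*} [DecidableEq α] (M : AddSubgroup ℂ) (σ : α → α)
    (g : α → ℂ) (s : Finset α) (hg : ∀ a ∈ s, g a ∈ M) (hσ : ∀ a ∈ s, σ a ∈ s)
    (hσ3 : ∀ a ∈ s, σ (σ (σ a)) = a) (hne : ∀ a ∈ s, σ a ≠ a) (hgσ : ∀ a ∈ s, g (σ a) = g a) :
    ∃ m ∈ M, ∑ a ∈ s, g a = 3 * m := by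
  induction s using Finset.strongInduction with
  | H s ih =>
    rcases s.eq_empty_or_nonempty with rfl | ⟨a, ha⟩
    · exact ⟨0, zero_mem _, by simp⟩
    have h1 := hσ a ha
    have h2 := hσ _ h1
    have h3 := hσ3 a ha
    have hn1 := hne a ha
    have hn2 := hne _ h1
    have hn3 := hne _ h2
    rw [h3] at hn3
    set t : Finset α := {a, σ a, σ (σ a)} with ht
    have hts : t ⊆ s := by
      intro b hb
      simp only [ht, Finset.mem_insert, Finset.mem_singleton] at hb
      rcases hb with rfl | rfl | rfl <;> assumption
    have hsub : ∀ b ∈ s \ t, b ∈ s := fun b hb => (Finset.mem_sdiff.mp hb).1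
    obtain ⟨m, hm, e⟩ := ih (s \ t) (Finset.sdiff_ssubset hts ⟨a, by simp [ht]⟩)
      (fun b hb => hg b (hsub b hb)) (fun b hb => by
        refine Finset.mem_sdiff.mpr ⟨hσ b (hsub b hb), fun hσb => (Finset.mem_sdiff.mp hb).2 ?_⟩
        rw [← hσ3 b (hsub b hb)]
        simp only [ht, Finset.mem_insert, Finset.mem_singleton] at hσb ⊢
        rcases hσb with h | h | h <;> simp [h, h3])
      (fun b hb => hσ3 b (hsub b hb)) (fun b hb => hne b (hsub b hb))
      (fun b hb => hgσ b (hsub b hb))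
    refine ⟨m + g a, add_mem hm (hg a ha), ?_⟩
    rw [← Finset.sum_sdiff hts, e, ht, Finset.sum_insert (by simp [hn1.symm, hn3]),
      Finset.sum_insert (by simpa using hn2.symm), Finset.sum_singleton, hgσ _ h1, hgσ _ ha]
    ring

lemma eq_of_cube_eq_one {ζ : ℂ} (h : ζ ^ 3 = 1) : ζ = 1 ∨ ζ = ρ3 ∨ ζ = -1 - ρ3 := by
  have : (ζ - 1) * ((ζ - ρ3) * (ζ - (-1 - ρ3))) = 0 := by
    linear_combination h + (1 - ζ) * ρ3_sq
  simpa [sub_eq_zero] using this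

lemma mem_O3_of_cube_eq_one {ζ : ℂ} (h : ζ ^ 3 = 1) : ζ ∈ O3 := by
  rcases eq_of_cube_eq_one h with rfl | rfl | rfl
  · exact one_mem _
  · exact ρ3_mem
  · exact sub_mem (neg_mem (one_mem _)) ρ3_mem

namespace IsSplitPrime

variable {p : ℕ} {π : ℂ} (h : IsSplitPrime p π)
include h

lemma eCoprime {r : ℕ} (hr : ¬ p ∣ r) : ECoprime (r : ℂ) π := by
  obtain ⟨s, t, hst⟩ := h.exists_mul_add (k := r) (by exact_mod_cast hr)
  refine ⟨s, intCast_mem O3 s, t * (p / π), mul_mem (intCast_mem O3 t) h.natCast_div_mem, ?_⟩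
  rw [mul_assoc, div_mul_cancel₀ _ h.ne_zero]
  exact_mod_cast hst

lemma eq_of_eCong {ζ ζ' : ℂ} (hζ : ζ ^ 3 = 1) (hζ' : ζ' ^ 3 = 1) (hc : ECong ζ ζ' π) :
    ζ = ζ' := by
  by_contra hne
  obtain ⟨d, hd, e⟩ := hc
  refine h.three_div_notMem ?_
  have h1 : (ζ - ζ') * (ζ ^ 2 + ζ * ζ' + ζ' ^ 2) = 0 := by linear_combination hζ - hζ'
  have h2 := (mul_eq_zero.mp h1).resolve_left (sub_ne_zero.mpr hne)
  have h3 : 3 = ζ ^ 2 * (ζ - ζ') * (1 - (ζ ^ 2 * ζ') ^ 2) := by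
    linear_combination ζ * h2 + ((ζ ^ 3 + 1) * (ζ * ζ' ^ 2 - ζ' ^ 3) - 2) * hζ - hζ'
  rw [h3, e, show ζ ^ 2 * (π * d) * (1 - (ζ ^ 2 * ζ') ^ 2) / π =
    ζ ^ 2 * d * (1 - (ζ ^ 2 * ζ') ^ 2) by have := h.ne_zero; field_simp]
  have m1 := mem_O3_of_cube_eq_one hζ
  have m2 := mem_O3_of_cube_eq_one hζ'
  exact mul_mem (mul_mem (pow_mem m1 2) hd)
    (sub_mem (one_mem _) (pow_mem (mul_mem (pow_mem m1 2) m2) 2))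

variable {χ : ℂ → ℂ} (hχ : IsCubicChar π p χ)
include hχ

lemma χ_ρ3 : χ ρ3 = ρ3 ^ ((p - 1) / 3) := by
  have hco : ECoprime ρ3 π :=
    ⟨ρ3 ^ 2, pow_mem ρ3_mem 2, 0, zero_mem _, by rw [← pow_succ, ρ3_cube]; simp⟩
  refine h.eq_of_eCong (hχ.cube _ ρ3_mem hco) ?_ (hχ.euler _ ρ3_mem hco)
  rw [← pow_mul, mul_comm, pow_mul, ρ3_cube, one_pow]

lemma χ_cube {r : ℕ} (hr : ¬ p ∣ r) : χ r ^ 3 = 1 :=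
  hχ.cube _ (natCast_mem O3 r) (h.eCoprime hr)

omit hχ in
lemma mem_Icc {r : ℕ} : r ∈ Finset.Icc 1 (p - 1) ↔ r < p ∧ ¬ p ∣ r := by
  have := h.prime.pos
  rw [Finset.mem_Icc]
  constructor
  · rintro ⟨h1, h2⟩
    exact ⟨by omega, Nat.not_dvd_of_pos_of_lt h1 (by omega)⟩
  · rintro ⟨h1, h2⟩
    refine ⟨Nat.pos_of_ne_zero ?_, by omega⟩
    rintro rfl
    exact h2 (dvd_zero _)

omit hχ in
lemma mul_mod_mem {m r : ℕ} (hm : ¬ p ∣ m) (hr : ¬ p ∣ r) : m * r % p ∈ Finset.Icc 1 (p - 1) := by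
  rw [h.mem_Icc, Nat.dvd_mod_iff dvd_rfl, h.prime.dvd_mul]
  exact ⟨Nat.mod_lt _ h.prime.pos, by tauto⟩

lemma χ_mod (r : ℕ) : χ (r % p : ℕ) = χ r := by
  refine hχ.resChar.periodic _ (natCast_mem O3 _) _ (natCast_mem O3 _)
    ⟨-((p / π) * (r / p : ℕ)), neg_mem (mul_mem h.natCast_div_mem (natCast_mem O3 _)), ?_⟩
  have := Nat.mod_add_div r p
  have e : ((r % p : ℕ) : ℂ) + p * (r / p : ℕ) = r := by exact_mod_cast this
  have h0 := h.ne_zero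
  field_simp
  linear_combination e

omit hχ in
lemma apply_mod {f : ℂ → ℂ} (hf : ∀ u, ∀ w ∈ O3, f (u + w) = f u) (r : ℕ) :
    f ((r % p : ℕ) / π) = f (r / π) := by
  rw [← hf (_ / π) ((p / π) * (r / p : ℕ)) (mul_mem h.natCast_div_mem (natCast_mem O3 _))]
  have := Nat.mod_add_div r p
  have e : ((r % p : ℕ) : ℂ) + p * (r / p : ℕ) = r := by exact_mod_cast this
  congr 1
  rw [← e]; ring

omit h in
lemma χ_mul (m r : ℕ) : χ (m * r : ℕ) = χ m * χ r := by
  rw [Nat.cast_mul]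
  exact hχ.resChar.map_mul _ (natCast_mem O3 m) _ (natCast_mem O3 r)

lemma EGS3_comp_mul {f : ℂ → ℂ} (hf : ∀ u, ∀ w ∈ O3, f (u + w) = f u) {m : ℕ} (hm : ¬ p ∣ m) :
    EGS3 p χ (fun u => f (m * u)) π ^ 3 = EGS3 p χ f π ^ 3 := by
  have key : EGS3 p χ f π = χ m * EGS3 p χ (fun u => f (m * u)) π := by
    have hinj : Set.InjOn (fun r => m * r % p) (Finset.Icc 1 (p - 1) : Finset ℕ) := by
      intro r hr r' hr' e
      rw [Finset.mem_coe, h.mem_Icc] at hr hr'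
      have := Nat.ModEq.cancel_left_of_coprime
        ((Nat.Prime.coprime_iff_not_dvd h.prime).mpr hm) (show m * r ≡ m * r' [MOD p] from e)
      exact this.eq_of_lt_of_lt hr.1 hr'.1
    have hmaps : Set.MapsTo (fun r => m * r % p) (Finset.Icc 1 (p - 1) : Finset ℕ)
        (Finset.Icc 1 (p - 1) : Finset ℕ) :=
      fun r hr => h.mul_mod_mem hm ((h.mem_Icc).mp hr).2
    have hsum : ∑ r ∈ Finset.Icc 1 (p - 1), χ (m : ℂ) * (χ (r : ℂ) * f (m * (r / π))) =
        ∑ r ∈ Finset.Icc 1 (p - 1), χ (r : ℂ) * f (r / π) := by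
      refine Finset.sum_nbij (fun r => m * r % p) hmaps hinj
        (Finset.surjOn_of_injOn_of_card_le _ hmaps hinj le_rfl) fun r _ => ?_
      rw [h.χ_mod hχ, χ_mul hχ, h.apply_mod hf, mul_assoc, Nat.cast_mul, mul_div_assoc]
    rw [EGS3, EGS3, mul_left_comm (χ m), ← hsum, Finset.mul_sum _ _ (χ m)]
  rw [key, mul_pow, h.χ_cube hχ hm, one_mul]

/-- The sum defining the elliptic Gauss sum is three times a sum over a third set. -/
lemma mul_EGS3_mem {f : ℂ → ℂ} (hf : ∀ u, ∀ w ∈ O3, f (u + w) = f u) {c : ℂ}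
    (hfρ : ∀ u, f (ρ3 * u) = c * f u) (hc : c * ρ3 ^ ((p - 1) / 3) = 1) (M : AddSubgroup ℂ)
    (d : ℂ) (hM : ∀ r : ℕ, ¬ p ∣ r → d * (χ r * f (r / π)) ∈ M) : d * EGS3 p χ f π ∈ M := by
  obtain ⟨n, w, hw, e⟩ := h.exists_natCast_congr ρ3_mem
  have hχn : χ n = ρ3 ^ ((p - 1) / 3) := by
    rw [← h.χ_ρ3 hχ]
    refine hχ.resChar.periodic _ (natCast_mem O3 _) _ ρ3_mem ⟨-w, neg_mem hw, ?_⟩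
    linear_combination -e
  have h0 := h.ne_zero
  have hn1 : ¬ (p : ℤ) ∣ n - 1 := by
    rw [← h.intCast_div_mem_iff]
    intro hd
    refine h.three_div_notMem ?_
    have h1 : (ρ3 - 1) / π ∈ O3 := by
      have : (ρ3 - 1) / π = ((n - 1 : ℤ) : ℂ) / π + w := by
        nth_rewrite 1 [e]; push_cast; field_simp; ring
      rw [this]; exact add_mem hd hw
    have : (3 : ℂ) / π = (ρ3 - 1) / π * (ρ3 ^ 2 - 1) := by
      rw [div_mul_eq_mul_div]; congr 1; linear_combination -ρ3_cube + ρ3_sq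
    rw [this]; exact mul_mem h1 (sub_mem (pow_mem ρ3_mem 2) (one_mem _))
  have hn3 : n * n * n ≡ 1 [MOD p] := by
    have : (p : ℤ) ∣ n * n * n - 1 := by
      rw [← h.intCast_div_mem_iff]
      have e' : ((n * n * n - 1 : ℤ) : ℂ) / π =
          -(w * (n * n + n * ρ3 + ρ3 ^ 2)) := by
        push_cast
        rw [div_eq_iff h0]
        linear_combination (-(n * n + n * ρ3 + ρ3 ^ 2)) * e + ρ3_cube
      rw [e']
      have := natCast_mem O3 n
      exact neg_mem (mul_mem hw (add_mem (add_mem (mul_mem this this) (mul_mem this ρ3_mem))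
        (pow_mem ρ3_mem 2)))
    refine Nat.ModEq.symm ((Nat.modEq_iff_dvd).mpr ?_)
    exact_mod_cast this
  have hn : ¬ p ∣ n := by
    intro hd
    have := (Nat.modEq_zero_iff_dvd.mpr (dvd_mul_of_dvd_right hd (n * n))).symm.trans hn3
    exact h.prime.not_dvd_one ((Nat.modEq_zero_iff_dvd).mp this.symm)
  obtain ⟨m, hm, e'⟩ := exists_sum_eq_three_mul M (fun r => n * r % p)
    (fun r : ℕ => d * (χ r * f (r / π))) (Finset.Icc 1 (p - 1))
    (fun r hr => hM r ((h.mem_Icc).mp hr).2)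
    (fun r hr => h.mul_mod_mem hn ((h.mem_Icc).mp hr).2)
    (fun r hr => by
      simp only [Nat.mul_mod_mod]
      have := hn3.mul_right r
      rw [one_mul, mul_assoc, mul_assoc] at this
      rw [Nat.ModEq] at this
      rw [this, Nat.mod_eq_of_lt ((h.mem_Icc).mp hr).1])
    (fun r hr heq => by
      have hr' := (h.mem_Icc).mp hr
      have : n * r ≡ r [MOD p] := by rw [Nat.ModEq, heq, Nat.mod_eq_of_lt hr'.1]
      have hd := (Nat.modEq_iff_dvd).mp this.symm
      push_cast at hd
      rw [show (n * r - r : ℤ) = (n - 1) * r by ring] at hd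
      rcases (Nat.prime_iff_prime_int.mp h.prime).dvd_mul.mp hd with hd | hd
      · exact hn1 hd
      · exact hr'.2 (by exact_mod_cast hd))
    (fun r hr => by
      rw [h.χ_mod hχ, χ_mul hχ, h.apply_mod hf, hχn, Nat.cast_mul]
      have e2 : (n * r : ℂ) / π = ρ3 * (r / π) + -(w * r) := by
        have : (n : ℂ) = ρ3 - π * w := by linear_combination -e
        rw [this]; field_simp; ring
      rw [e2, hf _ _ (neg_mem (mul_mem hw (natCast_mem O3 r))), hfρ]
      linear_combination (d * χ r * f (r / π)) * hc)
  have : d * EGS3 p χ f π = m := by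
    rw [EGS3, mul_left_comm, Finset.mul_sum, e']; ring
  rwa [this]

end IsSplitPrime

end Eisenstein

namespace Eisenstein
open PeriodPair cubicCurve WeierstrassCurve.Affine

lemma isPt_ρ3_mul {F : Type*} [Field F] [Algebra ℚ F] {a : ℚ} {x η s : F}
    (hs : s ^ 3 = 1) (h : Eqn a F x η) : Eqn a F (s * x) η := by
  unfold Eqn at h ⊢
  rw [mul_pow, hs, one_mul, h]

lemma xc_ρ3_mul (u : ℂ) : xc (ρ3 * u) = ρ3 * xc u := px_ρ3_mul u

lemma ηc_ρ3_mul (u : ℂ) : ηc (ρ3 * u) = ηc u := by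
  rw [ηc, ηc, py_ρ3_mul]

namespace IsSplitPrime

variable {p : ℕ} {π : ℂ} (h : IsSplitPrime p π)
include h

lemma div_notMem {r : ℕ} (hr : ¬ p ∣ r) : (r : ℂ) / π ∉ O3 := by
  have := h.intCast_div_mem_iff (k := r)
  rw [Int.cast_natCast, Int.natCast_dvd_natCast] at this
  rwa [this]

/-- The conjugates of the coordinates of a point of order `π` over `ℚ(ρ)`. -/
theorem exists_conj {F : Type*} [Field F] [Algebra ℚ F] (i τ : F →ₐ[ℚ] ℂ) {s x η : F}
    (hs : i s = ρ3) (hτs : τ s = ρ3) (hx : i x = xc (1 / π)) (hη : i η = ηc (1 / π)) :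
    ∃ m : ℕ, ¬ p ∣ m ∧ ∀ r : ℕ, ¬ p ∣ r → ∃ x' η' : F, i x' = xc (r / π) ∧ i η' = ηc (r / π) ∧
      τ x' = xc (m * (r / π)) ∧ τ η' = ηc (m * (r / π)) := by
  classical
  have h0 := h.ne_zero
  have hs3 : s ^ 3 = 1 := RingHom.injective (i : F →+* ℂ) (by simp [map_pow, hs, ρ3_cube])
  have heq : Eqn (-9) F x η := by
    have h1 := (isPt_point h.inv_notMem).eqn
    unfold Eqn at h1 ⊢
    apply RingHom.injective (i : F →+* ℂ)
    simp only [RingHom.coe_coe]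
    simp only [map_mul, map_add, map_sub, map_pow, map_ofNat, hx, hη, AlgHom.commutes]
    exact h1
  obtain ⟨P, hP⟩ := exists_isPt heq
  obtain ⟨Ps, hPs⟩ := exists_isPt (isPt_ρ3_mul hs3 heq)
  have hρ {u : ℂ} (hu : u ∉ O3) : ρ3 * u ∉ O3 := by
    rw [← mem_lattice_iff] at hu ⊢
    rwa [ρ3_mul_mem_iff]
  have hi : Point.map i P = eisPair.point varpi1 (-9) (1 / π) := by
    have := hP.map i
    rw [hx, hη] at this
    exact this.point_eq (isPt_point h.inv_notMem)
  have his : Point.map i Ps = eisPair.point varpi1 (-9) (ρ3 * (1 / π)) := by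
    have := hPs.map i
    rw [map_mul, hs, hx, hη, ← xc_ρ3_mul, ← ηc_ρ3_mul] at this
    exact this.point_eq (isPt_point (hρ h.inv_notMem))
  obtain ⟨a, b, hab⟩ := mem_O3_iff.mp h.mem
  have hrel : a • P + b • Ps = 0 := by
    apply Point.map_injective i
    rw [map_add, map_zsmul, map_zsmul, hi, his, map_zero, ← isScaled_varpi1.point_zsmul,
      ← isScaled_varpi1.point_zsmul, ← isScaled_varpi1.point_add]
    apply point_of_mem
    rw [mem_lattice_iff, show (a * (1 / π) + b * (ρ3 * (1 / π)) : ℂ) = (a + b * ρ3) / π by ring,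
      ← hab, div_self h0]
    exact one_mem _
  obtain ⟨u, hu⟩ := isScaled_varpi1.point_surjective (a := -9) (Point.map τ P)
  have huO : u ∉ O3 := by
    intro hm
    rw [point_of_mem (mem_lattice_iff.mpr hm)] at hu
    exact (hP.map τ).ne_zero hu.symm
  have hc := (hP.map τ).coord_eq (hu ▸ isPt_point huO)
  have hτ : Point.map τ Ps = eisPair.point varpi1 (-9) (ρ3 * u) := by
    have := hPs.map τ
    rw [map_mul, hτs, hc.1, hc.2, ← xc_ρ3_mul, ← ηc_ρ3_mul] at this
    exact this.point_eq (isPt_point (hρ huO))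
  have hrel' := congrArg (Point.map τ) hrel
  rw [map_add, map_zsmul, map_zsmul, hτ, ← hu, map_zero, ← isScaled_varpi1.point_zsmul,
    ← isScaled_varpi1.point_zsmul, ← isScaled_varpi1.point_add,
    isScaled_varpi1.point_eq_zero_iff, mem_lattice_iff,
    show (a * u + b * (ρ3 * u) : ℂ) = π * u by rw [hab]; ring] at hrel'
  obtain ⟨m, w, hw, e⟩ := h.exists_natCast_congr hrel'
  have hu' : u = m / π + w := by field_simp; linear_combination e
  have hm : ¬ p ∣ m := by
    intro hm
    refine huO (hu' ▸ add_mem ?_ hw)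
    have := h.intCast_div_mem_iff (k := m)
    rw [Int.cast_natCast, Int.natCast_dvd_natCast] at this
    exact this.mpr hm
  refine ⟨m, hm, fun r hr => ?_⟩
  have hir : Point.map i (r • P) = eisPair.point varpi1 (-9) (r / π) := by
    rw [map_nsmul, hi, ← point_nsmul, mul_one_div]
  have hτr : Point.map τ (r • P) = eisPair.point varpi1 (-9) (m * (r / π)) := by
    rw [map_nsmul, ← hu, ← point_nsmul, hu',
      show (r * (m / π + w) : ℂ) = m * (r / π) + r * w by ring,
      isScaled_varpi1.point_add_of_mem
        (mem_lattice_iff.mpr (mul_mem (natCast_mem O3 r) hw))]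
  have hmr : (m * (r / π) : ℂ) ∉ O3 := by
    have := h.div_notMem (r := m * r) (by rw [h.prime.dvd_mul]; tauto)
    rwa [Nat.cast_mul, mul_div_assoc] at this
  obtain ⟨x', η', hP'⟩ := exists_isPt_of_ne_zero (P := r • P) (by
    intro h0
    rw [h0, map_zero] at hir
    exact (isPt_point (h.div_notMem hr)).ne_zero hir.symm)
  have c1 := (hP'.map i).coord_eq (hir ▸ isPt_point (h.div_notMem hr))
  have c2 := (hP'.map τ).coord_eq (hτr ▸ isPt_point hmr)
  exact ⟨x', η', c1.1, c1.2, c2.1, c2.2⟩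

end IsSplitPrime

end Eisenstein

namespace Eisenstein
open IntermediateField

/-- The field `ℚ(ρ)`. -/
abbrev eisField : IntermediateField ℚ ℂ := ℚ⟮ρ3⟯

lemma exists_eq_add_mul_ρ3 {z : ℂ} (hz : z ∈ eisField) : ∃ a b : ℚ, z = a + b * ρ3 := by
  have hρ : IsIntegral ℚ ρ3 := isIntegral_ρ3.tower_top
  replace hz : z ∈ eisField.toSubalgebra := hz
  rw [adjoin_simple_toSubalgebra_of_isAlgebraic hρ.isAlgebraic] at hz
  induction hz using Algebra.adjoin_induction with
  | mem x hx => exact ⟨0, 1, by rw [Set.mem_singleton_iff.mp hx]; simp⟩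
  | algebraMap r => exact ⟨r, 0, by simp⟩
  | add x y _ _ hx hy =>
    obtain ⟨a, b, rfl⟩ := hx
    obtain ⟨c, d, rfl⟩ := hy
    exact ⟨a + c, b + d, by push_cast; ring⟩
  | mul x y _ _ hx hy =>
    obtain ⟨a, b, rfl⟩ := hx
    obtain ⟨c, d, rfl⟩ := hy
    exact ⟨a * c - b * d, a * d + b * c - b * d, by
      push_cast; linear_combination (b * d : ℂ) * ρ3_sq⟩

/-- The field of algebraic numbers in `ℂ`, as an extension of `ℚ(ρ)`. -/
abbrev algNumbers : IntermediateField eisField ℂ := algebraicClosure eisField ℂ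

lemma coe_mem_of_forall_eq {y : algNumbers}
    (h : ∀ τ : algNumbers →ₐ[eisField] ℂ, τ y = y) : (y : ℂ) ∈ eisField := by
  have hint : IsIntegral eisField y := Algebra.IsIntegral.isIntegral y
  have hr := Algebra.IsAlgebraic.range_eval_eq_rootSet_minpoly (F := eisField) ℂ y
  have hsub : (minpoly eisField y).rootSet ℂ = {(y : ℂ)} := by
    rw [← hr]
    ext z
    simp only [Set.mem_range, Set.mem_singleton_iff, h]
    exact ⟨fun ⟨_, e⟩ => e.symm, fun e => ⟨algNumbers.val, e.symm⟩⟩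
  have hcard := Polynomial.card_rootSet_eq_natDegree (K := ℂ)
    (minpoly.irreducible hint).separable (IsAlgClosed.splits _)
  have hone : (minpoly eisField y).natDegree = 1 := by
    rw [← hcard]
    simp [hsub]
  obtain ⟨k, hk⟩ := (minpoly.natDegree_eq_one_iff).mp hone
  rw [← hk]
  exact k.2

lemma mem_algNumbers {z : ℂ} (hz : IsIntegral ℤ z) : z ∈ algNumbers :=
  mem_algebraicClosure_iff'.mpr hz.tower_top

lemma psi3_eq_div (u : ℂ) : psi3 u = (9 - ηc u) / ηc u := by
  rw [psi3_eq, ηc, ← div_div_div_cancel_right₀ (two_ne_zero (α := ℂ)) (9 - _)]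
  congr 1 <;> ring

namespace IsSplitPrime

variable {p : ℕ} {π : ℂ} (h : IsSplitPrime p π)
include h

lemma ηc_mem_algNumbers : ηc (1 / π) ∈ algNumbers := by
  have h0 := ηc_ne_zero h.prime h.mod_three h.isTorsion
  have h1 := mem_algNumbers (isIntegral_of_forall_mem fun V =>
    map_psi3_le_one (v := V.valuation) h.prime h.mod_three h.isTorsion)
  have e : ηc (1 / π) = 9 / (1 + psi3 (1 / π)) := by
    rw [psi3_eq_div, eq_div_iff (by field_simp; simpa using h0)]
    field_simp
    ring
  rw [e]
  exact div_mem (ofNat_mem _ 9) (add_mem (one_mem _) h1)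

lemma xc_mem_algNumbers : xc (1 / π) ∈ algNumbers := by
  have h0 := ηc_ne_zero h.prime h.mod_three h.isTorsion
  have h1 := mem_algNumbers (isIntegral_of_forall_mem fun V =>
    map_phi3_le_one (v := V.valuation) h.prime h.mod_three h.isTorsion)
  have e : xc (1 / π) = phi3 (1 / π) * ηc (1 / π) / 3 := by
    rw [phi3_eq_div]
    field_simp
  rw [e]
  exact div_mem (mul_mem h1 h.ηc_mem_algNumbers) (ofNat_mem _ 3)

/-- The cube of an elliptic Gauss sum is fixed by conjugation over `ℚ(ρ)`. -/
lemma exists_map_eq_EGS3_cube {χ : ℂ → ℂ} (hχ : IsCubicChar π p χ) {f : ℂ → ℂ}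
    (hf : ∀ u, ∀ w ∈ O3, f (u + w) = f u) {F : Type*} [Field F] [Algebra ℚ F]
    (i τ : F →ₐ[ℚ] ℂ) {s x η : F} (hs : i s = ρ3) (hτs : τ s = ρ3) (hx : i x = xc (1 / π))
    (hη : i η = ηc (1 / π))
    (hrat : ∀ (x η : F) (u v : ℂ), i x = xc u → i η = ηc u → τ x = xc v → τ η = ηc v →
      ∃ y : F, i y = f u ∧ τ y = f v) :
    ∃ y : F, i y = EGS3 p χ f π ^ 3 ∧ τ y = EGS3 p χ f π ^ 3 := by
  obtain ⟨m, hm, H⟩ := h.exists_conj i τ hs hτs hx hη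
  have hterm : ∀ r : ℕ, ∃ y : F, ¬ p ∣ r →
      i y = χ r * f (r / π) ∧ τ y = χ r * f (m * (r / π)) := by
    intro r
    by_cases hr : p ∣ r
    · exact ⟨0, fun hr' => absurd hr hr'⟩
    obtain ⟨x', η', h1, h2, h3, h4⟩ := H r hr
    obtain ⟨y, hy, hy'⟩ := hrat x' η' _ _ h1 h2 h3 h4
    have hc : ∃ c : F, i c = χ r ∧ τ c = χ r := by
      rcases eq_of_cube_eq_one (h.χ_cube hχ hr) with e | e | e <;> rw [e]
      · exact ⟨1, map_one i, map_one τ⟩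
      · exact ⟨s, hs, hτs⟩
      · exact ⟨-1 - s, by simp [hs], by simp [hτs]⟩
    obtain ⟨c, hc, hc'⟩ := hc
    exact ⟨c * y, fun _ => by simp [hc, hc', hy, hy']⟩
  choose y hy using hterm
  refine ⟨(1 / 3 * ∑ r ∈ Finset.Icc 1 (p - 1), y r) ^ 3, ?_, ?_⟩
  · rw [EGS3]
    simp only [map_pow, map_mul, map_sum, map_div₀, map_one, map_ofNat]
    congr 2
    exact Finset.sum_congr rfl fun r hr => (hy r (h.mem_Icc.mp hr).2).1
  · rw [← h.EGS3_comp_mul hχ hf hm, EGS3]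
    simp only [map_pow, map_mul, map_sum, map_div₀, map_one, map_ofNat]
    congr 2
    exact Finset.sum_congr rfl fun r hr => (hy r (h.mem_Icc.mp hr).2).2

lemma EGS3_cube_mem_eisField {χ : ℂ → ℂ} (hχ : IsCubicChar π p χ) {f : ℂ → ℂ}
    (hf : ∀ u, ∀ w ∈ O3, f (u + w) = f u)
    (hrat : ∀ (i τ : algNumbers →ₐ[ℚ] ℂ) (x η : algNumbers) (u v : ℂ),
      i x = xc u → i η = ηc u → τ x = xc v → τ η = ηc v → ∃ y, i y = f u ∧ τ y = f v) :
    EGS3 p χ f π ^ 3 ∈ eisField := by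
  have hs (τ : algNumbers →ₐ[eisField] ℂ) :
      τ (algebraMap eisField algNumbers ⟨ρ3, mem_adjoin_simple_self ℚ ρ3⟩) = ρ3 := by
    rw [τ.commutes]; rfl
  have key (τ : algNumbers →ₐ[eisField] ℂ) :=
    h.exists_map_eq_EGS3_cube hχ hf (algNumbers.val.restrictScalars ℚ) (τ.restrictScalars ℚ)
      (hs algNumbers.val) (hs τ) (x := ⟨_, h.xc_mem_algNumbers⟩) (η := ⟨_, h.ηc_mem_algNumbers⟩)
      rfl rfl (hrat _ _)
  obtain ⟨y, hy, -⟩ := key algNumbers.val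
  rw [← hy]
  refine coe_mem_of_forall_eq fun τ => ?_
  obtain ⟨y', hy', e⟩ := key τ
  have : y = y' := Subtype.ext (hy.trans hy'.symm)
  rw [this]
  exact e.trans hy'.symm

end IsSplitPrime

lemma ρ3_pow_mod (n : ℕ) : ρ3 ^ n = ρ3 ^ (n % 3) := by
  conv_lhs => rw [← Nat.mod_add_div n 3, pow_add, pow_mul, ρ3_cube, one_pow, mul_one]

lemma mem_O3_of_mem_eisField {z : ℂ} (hz : z ∈ eisField) (h : IsIntegral ℤ z) : z ∈ O3 := by
  obtain ⟨a, b, rfl⟩ := exists_eq_add_mul_ρ3 hz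
  exact mem_O3_of_isIntegral h

lemma mem_eisField_of_mem_O3 {z : ℂ} (hz : z ∈ O3) : z ∈ eisField := by
  obtain ⟨a, b, rfl⟩ := mem_O3_iff.mp hz
  exact add_mem (intCast_mem _ a)
    (mul_mem (intCast_mem _ b) (IntermediateField.mem_adjoin_simple_self ℚ ρ3))

lemma map_eq_phi3 {F : Type*} [Field F] [Algebra ℚ F] (i : F →ₐ[ℚ] ℂ) {x η : F} {u : ℂ}
    (hx : i x = xc u) (hη : i η = ηc u) : i (3 * x / η) = phi3 u := by
  rw [phi3_eq_div, map_div₀, map_mul, map_ofNat, hx, hη]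

lemma map_eq_psi3 {F : Type*} [Field F] [Algebra ℚ F] (i : F →ₐ[ℚ] ℂ) {η : F} {u : ℂ}
    (hη : i η = ηc u) : i ((9 - η) / η) = psi3 u := by
  rw [psi3_eq_div, map_div₀, map_sub, map_ofNat, hη]

namespace IsSplitPrime

variable {p : ℕ} {π : ℂ} (h : IsSplitPrime p π)
include h

lemma isTorsion_div {r : ℕ} (hr : ¬ p ∣ r) : IsTorsion p (r / π) := by
  rw [← mul_one_div]
  exact (h.isTorsion.natCast_mul h.prime hr).1

variable {χ : ℂ → ℂ} (hχ : IsCubicChar π p χ)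
include hχ

lemma map_χ_le_one {r : ℕ} (hr : ¬ p ∣ r) (V : ValuationSubring ℂ) : V.valuation (χ r) ≤ 1 := by
  rw [← pow_le_one_iff (n := 3) three_ne_zero, ← map_pow, h.χ_cube hχ hr, map_one]

lemma map_mul_EGS3_le_one {f : ℂ → ℂ} (hf : ∀ u, ∀ w ∈ O3, f (u + w) = f u) {c : ℂ}
    (hfρ : ∀ u, f (ρ3 * u) = c * f u) (hc : c * ρ3 ^ ((p - 1) / 3) = 1)
    (V : ValuationSubring ℂ) (d : ℂ)
    (hd : ∀ r : ℕ, ¬ p ∣ r → V.valuation (d * f (r / π)) ≤ 1) :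
    V.valuation (d * EGS3 p χ f π) ≤ 1 := by
  rw [V.valuation_le_one_iff]
  refine h.mul_EGS3_mem hχ hf hfρ hc V.toSubring.toAddSubgroup d fun r hr => ?_
  change _ ∈ V
  rw [← V.valuation_le_one_iff, mul_left_comm, map_mul]
  exact mul_le_one' (h.map_χ_le_one hχ hr V) (hd r hr)

lemma EGS3_cube_mem_O3 {f : ℂ → ℂ} (hf : ∀ u, ∀ w ∈ O3, f (u + w) = f u) {c : ℂ}
    (hfρ : ∀ u, f (ρ3 * u) = c * f u) (hc : c * ρ3 ^ ((p - 1) / 3) = 1)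
    (hd : ∀ (V : ValuationSubring ℂ) (r : ℕ), ¬ p ∣ r → V.valuation (f (r / π)) ≤ 1)
    (hK : EGS3 p χ f π ^ 3 ∈ eisField) : EGS3 p χ f π ^ 3 ∈ O3 := by
  refine mem_O3_of_mem_eisField hK (IsIntegral.pow (isIntegral_of_forall_mem fun V => ?_) 3)
  simpa using h.map_mul_EGS3_le_one hχ hf hfρ hc V 1 (by simpa using hd V)

theorem EGS3_phi3_cube_mem (hp : p % 18 = 7) : EGS3 p χ phi3 π ^ 3 ∈ O3 := by
  refine h.EGS3_cube_mem_O3 hχ (fun u w hw => phi3_add_of_mem hw) (c := ρ3) phi3_ρ3_mul ?_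
    (fun V r hr => map_phi3_le_one h.prime h.mod_three (h.isTorsion_div hr))
    (h.EGS3_cube_mem_eisField hχ (fun u w hw => phi3_add_of_mem hw) ?_)
  · rw [ρ3_pow_mod, show (p - 1) / 3 % 3 = 2 by omega, ← pow_succ', ρ3_cube]
  · intro i τ x η u v h1 h2 h3 h4
    exact ⟨3 * x / η, map_eq_phi3 i h1 h2, map_eq_phi3 τ h3 h4⟩

theorem EGS3_psi3_cube_mem (hp : p % 18 = 1) : EGS3 p χ psi3 π ^ 3 ∈ O3 := by
  refine h.EGS3_cube_mem_O3 hχ (fun u w hw => psi3_add_of_mem hw) (c := 1)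
    (fun u => by rw [psi3_ρ3_mul, one_mul]) ?_
    (fun V r hr => map_psi3_le_one h.prime h.mod_three (h.isTorsion_div hr))
    (h.EGS3_cube_mem_eisField hχ (fun u w hw => psi3_add_of_mem hw) ?_)
  · rw [ρ3_pow_mod, show (p - 1) / 3 % 3 = 0 by omega, pow_zero, one_mul]
  · intro i τ x η u v h1 h2 h3 h4
    exact ⟨(9 - η) / η, map_eq_psi3 i h2, map_eq_psi3 τ h4⟩

theorem EGS3_phi3_inv_cube_mem (hp : p % 18 = 13) :
    EGS3 p χ (fun u => (phi3 u)⁻¹) π ^ 3 ∈ O3 := by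
  have hper : ∀ u, ∀ w ∈ O3, (phi3 (u + w))⁻¹ = (phi3 u)⁻¹ :=
    fun u w hw => by rw [phi3_add_of_mem hw]
  have hK := h.EGS3_cube_mem_eisField hχ (f := fun u => (phi3 u)⁻¹) hper (by
    intro i τ x η u v h1 h2 h3 h4
    exact ⟨(3 * x / η)⁻¹, by rw [map_inv₀, map_eq_phi3 i h1 h2],
      by rw [map_inv₀, map_eq_phi3 τ h3 h4]⟩)
  have h0 := h.ne_zero
  have hφ0 := phi3_ne_zero h.prime h.mod_three h.isTorsion
  set G := EGS3 p χ (fun u => (phi3 u)⁻¹) π with hG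
  have hle (V : ValuationSubring ℂ) : V.valuation (phi3 (1 / π)) * V.valuation G ≤ 1 := by
    rw [← map_mul]
    refine h.map_mul_EGS3_le_one hχ hper (c := ρ3⁻¹)
      (fun u => by rw [phi3_ρ3_mul, mul_inv]) ?_ V _ fun r hr => ?_
    · rw [ρ3_pow_mod, show (p - 1) / 3 % 3 = 1 by omega, pow_one]
      exact inv_mul_cancel₀ fun e => by simpa [e] using ρ3_cube
    · have := map_phi3_mul_eq (v := V.valuation) h.prime h.mod_three h.isTorsion hr
      rw [mul_one_div] at this
      rw [map_mul, map_inv₀, this, mul_inv_cancel₀]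
      simpa using hφ0
  have hint : IsIntegral ℤ (π * (G ^ 3) ^ 2) := by
    refine isIntegral_of_forall_mem fun V => ?_
    have hπ : V.valuation π ≤ V.valuation (phi3 (1 / π)) ^ 6 := by
      by_cases h1 : V.valuation (phi3 (1 / π)) = 1
      · rw [h1, one_pow, V.valuation_le_one_iff]
        exact Subring.closure_le (t := V.toSubring).mpr
          (Set.singleton_subset_iff.mpr ((V.valuation_le_one_iff _).mp map_ρ3.le)) h.mem
      · exact map_le_phi3_pow h.prime h.mod_three h.isTorsion h1 h.mem
          (by rw [mul_one_div_cancel h0]; exact one_mem _)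
    calc V.valuation (π * (G ^ 3) ^ 2) = V.valuation π * V.valuation G ^ 6 := by
          rw [map_mul, ← pow_mul, map_pow]
      _ ≤ V.valuation (phi3 (1 / π)) ^ 6 * V.valuation G ^ 6 := by gcongr
      _ = (V.valuation (phi3 (1 / π)) * V.valuation G) ^ 6 := (mul_pow _ _ _).symm
      _ ≤ 1 := pow_le_one' (hle V) 6
  have hπK := mem_eisField_of_mem_O3 h.mem
  have m1 := mem_O3_of_mem_eisField (mul_mem hπK (pow_mem hK 2)) hint
  have m2 : π * G ^ 3 ∈ O3 := by
    refine mem_O3_of_mem_eisField (mul_mem hπK hK) (IsIntegral.of_pow two_pos ?_)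
    rw [mul_pow, sq, mul_assoc]
    exact (isIntegral_of_mem_O3 h.mem).mul hint
  have := h.div_mem_of_sq m2 (by
    rwa [mul_pow, sq π, mul_assoc, mul_div_cancel_left₀ _ h0])
  rwa [mul_div_cancel_left₀ _ h0] at this

end IsSplitPrime

end Eisenstein

/-- **Lemma I.4.** Let `π ∈ ℤ[ρ]` be a primary prime with `p = π·π̄`, and let `f` be
any one of the functions `φ, φ⁻¹, ψ` (with `p ≡ 7, 13, 1 (mod 18)` in the respective
case). Then the cube `G_π(χ_π, f)³` of the elliptic Gauss sum is an algebraic integer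
lying in `ℤ[ρ]`. -/
theorem stmt_8
    (p : ℕ) (hp : p.Prime) (hp3 : p % 3 = 1)
    (π : ℂ) (hπ : π ∈ O3) (hprimary : ECong π 1 3)
    (hnorm : (p : ℂ) = π * (starRingEnd ℂ) π)
    (χ : ℂ → ℂ) (hχ : IsCubicChar π p χ) :
    (p % 18 = 7 → (EGS3 p χ phi3 π) ^ 3 ∈ O3) ∧
    (p % 18 = 13 → (EGS3 p χ (fun u => (phi3 u)⁻¹) π) ^ 3 ∈ O3) ∧
    (p % 18 = 1 → (EGS3 p χ psi3 π) ^ 3 ∈ O3) := by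
  have h : Eisenstein.IsSplitPrime p π := ⟨hp, hp3, hπ, hnorm⟩
  exact ⟨h.EGS3_phi3_cube_mem hχ, h.EGS3_phi3_inv_cube_mem hχ, h.EGS3_psi3_cube_mem hχ⟩

end
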